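/- arXiv:1511.02185 — 2 statements merged into one kernel-verified Lean document; each statement's English description precedes it below -/
import Mathlib

section
/- Let Ω ⊂ ℝⁿ be a smooth bounded open convex domain and T > 0. Let A : ℝⁿ × [0,T] → (symmetric n×n matrices) be continuous with A(p,t) positive semidefinite, and suppose there is a continuous function α : [0,∞) × [0,T] → ℝ with 0 < α(R,t) ≤ R² · inf{ vᵀA(p,t)v / (v·p)² : |p| = R, v·p ≠ 0 } for all R > 0 and t ∈ [0,T]. Let u be continuous on Ω̄ × [0,T), a viscosity solution of ∂_t u = tr(A(Du,t)D²u) in Ω × (0,T), with u(x,t) = 0 for all x ∈ ∂Ω and t ∈ (0,T). Let φ₀ : [0,∞) → ℝ be a modulus of continuity for u(·,0), i.e. u(y,0) − u(x,0) ≤ 2φ₀(|y − x|/2) for all x, y ∈ Ω̄. Suppose φ : [0,∞) × [0,T) → ℝ is C^{2,1}, nondecreasing and concave in its first variable, satisfies ∂_t φ ≥ α(|∂_s φ|, t) · ∂_s² φ everywhere, and φ(z,t) ≥ φ₀(z) for all z ≥ 0 and t ∈ [0,T). Then φ(·,t) is a modulus of continuity for u(·,t) for every t ∈ [0,T): u(y,t)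 − u(x,t) ≤ 2φ(|y − x|/2, t) for all x, y ∈ Ω̄ and t ∈ [0,T). -/
open Set
open scoped RealInnerProductSpace

/-- A `C^{2,1}` test function on `ℝⁿ × (0,T)`, presented by its data: `φ` together with
its time derivative `φt`, spatial gradient `Dφ` and spatial Hessian matrix `D2φ`,
all continuous. -/
def IsC21Test (n : ℕ) (T : ℝ) (φ φt : EuclideanSpace ℝ (Fin n) × ℝ → ℝ)
    (Dφ : EuclideanSpace ℝ (Fin n) × ℝ → EuclideanSpace ℝ (Fin n))
    (D2φ : EuclideanSpace ℝ (Fin n) × ℝ → Matrix (Fin n) (Fin n) ℝ) : Prop :=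
  (∀ w : EuclideanSpace ℝ (Fin n) × ℝ, w.2 ∈ Ioo (0 : ℝ) T →
    HasDerivAt (fun s => φ (w.1, s)) (φt w) w.2) ∧
  (∀ w : EuclideanSpace ℝ (Fin n) × ℝ, w.2 ∈ Ioo (0 : ℝ) T →
    HasGradientAt (fun x => φ (x, w.2)) (Dφ w) w.1) ∧
  (∀ w : EuclideanSpace ℝ (Fin n) × ℝ, w.2 ∈ Ioo (0 : ℝ) T →
    HasFDerivAt (fun x => Dφ (x, w.2))
      (LinearMap.toContinuousLinearMap (Matrix.toEuclideanLin (D2φ w))) w.1) ∧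
  ContinuousOn φt (univ ×ˢ Ioo (0 : ℝ) T) ∧
  ContinuousOn Dφ (univ ×ˢ Ioo (0 : ℝ) T) ∧
  ContinuousOn D2φ (univ ×ˢ Ioo (0 : ℝ) T)

/-- `u` is a viscosity subsolution of `∂ₜu = F(x, Du, D²u, t)` in `Ω × (0,T)`. -/
def IsViscositySubsoln (n : ℕ) (Ω : Set (EuclideanSpace ℝ (Fin n))) (T : ℝ)
    (F : EuclideanSpace ℝ (Fin n) → EuclideanSpace ℝ (Fin n) →
      Matrix (Fin n) (Fin n) ℝ → ℝ → ℝ)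
    (u : EuclideanSpace ℝ (Fin n) × ℝ → ℝ) : Prop :=
  ∀ (φ φt : EuclideanSpace ℝ (Fin n) × ℝ → ℝ)
    (Dφ : EuclideanSpace ℝ (Fin n) × ℝ → EuclideanSpace ℝ (Fin n))
    (D2φ : EuclideanSpace ℝ (Fin n) × ℝ → Matrix (Fin n) (Fin n) ℝ),
    IsC21Test n T φ φt Dφ D2φ →
    ∀ (x₀ : EuclideanSpace ℝ (Fin n)) (t₀ : ℝ), x₀ ∈ Ω → t₀ ∈ Ioo (0 : ℝ) T →
    IsLocalMax (fun w => u w - φ w) (x₀, t₀) →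
    φt (x₀, t₀) ≤ F x₀ (Dφ (x₀, t₀)) (D2φ (x₀, t₀)) t₀

/-- `u` is a viscosity supersolution of `∂ₜu = F(x, Du, D²u, t)` in `Ω × (0,T)`. -/
def IsViscositySupersoln (n : ℕ) (Ω : Set (EuclideanSpace ℝ (Fin n))) (T : ℝ)
    (F : EuclideanSpace ℝ (Fin n) → EuclideanSpace ℝ (Fin n) →
      Matrix (Fin n) (Fin n) ℝ → ℝ → ℝ)
    (u : EuclideanSpace ℝ (Fin n) × ℝ → ℝ) : Prop :=
  ∀ (φ φt : EuclideanSpace ℝ (Fin n) × ℝ → ℝ)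
    (Dφ : EuclideanSpace ℝ (Fin n) × ℝ → EuclideanSpace ℝ (Fin n))
    (D2φ : EuclideanSpace ℝ (Fin n) × ℝ → Matrix (Fin n) (Fin n) ℝ),
    IsC21Test n T φ φt Dφ D2φ →
    ∀ (x₀ : EuclideanSpace ℝ (Fin n)) (t₀ : ℝ), x₀ ∈ Ω → t₀ ∈ Ioo (0 : ℝ) T →
    IsLocalMin (fun w => u w - φ w) (x₀, t₀) →
    φt (x₀, t₀) ≥ F x₀ (Dφ (x₀, t₀)) (D2φ (x₀, t₀)) t₀

open MeasureTheory Filter Topology Asymptotics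

/-- A Lipschitz map between spaces of equal finite dimension maps null sets to null sets. -/
lemma LipschitzOnWith.addHaar_image_null {V W : Type*}
    [NormedAddCommGroup V] [NormedSpace ℝ V] [FiniteDimensional ℝ V]
    [MeasurableSpace V] [BorelSpace V]
    [NormedAddCommGroup W] [NormedSpace ℝ W] [FiniteDimensional ℝ W]
    [MeasurableSpace W] [BorelSpace W]
    (hdim : Module.finrank ℝ V = Module.finrank ℝ W)
    (μ : Measure V) [μ.IsAddHaarMeasure] (ν : Measure W) [ν.IsAddHaarMeasure]
    {K : NNReal} {f : V → W} {s : Set V} (hf : LipschitzOnWith K f s) (hs : μ s = 0) :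
    ν (f '' s) = 0 := by
  have h1 : Measure.hausdorffMeasure (Module.finrank ℝ V : ℝ) s = 0 :=
    Measure.absolutelyContinuous_isAddHaarMeasure
      (Measure.hausdorffMeasure (Module.finrank ℝ V : ℝ)) μ hs
  have h2 := hf.hausdorffMeasure_image_le (d := (Module.finrank ℝ V : ℝ)) (Nat.cast_nonneg _)
  rw [h1, mul_zero, nonpos_iff_eq_zero, hdim] at h2
  exact Measure.absolutelyContinuous_isAddHaarMeasure ν
      (Measure.hausdorffMeasure (Module.finrank ℝ W : ℝ)) h2

/-- A linear functional dominated by a multiple of the squared norm vanishes. -/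
lemma ContinuousLinearMap.eq_zero_of_le_sq {V : Type*} [NormedAddCommGroup V] [NormedSpace ℝ V]
    {L : V →L[ℝ] ℝ} {c : ℝ} (h : ∀ w, L w ≤ c * ‖w‖ ^ 2) : L = 0 := by
  have key : ∀ w, L w ≤ 0 := by
    intro w
    by_contra! hw
    set s : ℝ := L w / (2 * (|c| * ‖w‖ ^ 2 + 1)) with hs
    have hd : 0 < 2 * (|c| * ‖w‖ ^ 2 + 1) := by positivity
    have hs0 : 0 < s := by positivity
    have h1 := h (s • w)
    rw [map_smul, smul_eq_mul, norm_smul, Real.norm_of_nonneg hs0.le] at h1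
    have h2 : L w ≤ s * (c * ‖w‖ ^ 2) := by
      have : s * L w ≤ s * (s * (c * ‖w‖ ^ 2)) := by nlinarith
      exact le_of_mul_le_mul_left this hs0
    have h3 : s * (c * ‖w‖ ^ 2) ≤ s * (|c| * ‖w‖ ^ 2 + 1) := by
      have := mul_le_mul_of_nonneg_right (le_abs_self c) (sq_nonneg ‖w‖)
      exact mul_le_mul_of_nonneg_left (by linarith) hs0.le
    have h4 : s * (2 * (|c| * ‖w‖ ^ 2 + 1)) = L w := by
      rw [hs]; field_simp
    linarith
  ext w
  have := key (-w)
  rw [map_neg] at this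
  simpa using le_antisymm (key w) (by linarith)

/-- Jensen's lemma: the points at which a semiconvex function has a maximum after a small linear
perturbation form a set of positive measure. -/
lemma exists_perturbed_max_notMem_null {V : Type*}
    [NormedAddCommGroup V] [NormedSpace ℝ V] [FiniteDimensional ℝ V]
    [MeasurableSpace V] [BorelSpace V] (μ : Measure V) [μ.IsAddHaarMeasure]
    {w : V → ℝ} {δ c : ℝ} (hδ : 0 < δ) (hc : 0 ≤ c)
    (hmax : ∀ q : V →L[ℝ] ℝ, ‖q‖ < δ → ∃ x, ∀ z, w z ≤ w x + q (z - x))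
    (hsupp : ∀ q : V →L[ℝ] ℝ, ‖q‖ < δ → ∀ x, (∀ z, w z ≤ w x + q (z - x)) →
      ∃ ξ : V →L[ℝ] ℝ, ∀ z, w x + ξ (z - x) - c * ‖z - x‖ ^ 2 ≤ w z)
    {N : Set V} (hN : μ N = 0) :
    ∃ x ∉ N, ∃ q : V →L[ℝ] ℝ, ‖q‖ < δ ∧ ∀ z, w z ≤ w x + q (z - x) := by
  by_contra! hcon
  set S : Set V := {x | ∃ q : V →L[ℝ] ℝ, ‖q‖ < δ ∧ ∀ z, w z ≤ w x + q (z - x)} with hS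
  have hSN : S ⊆ N := by
    rintro x ⟨q, hq, hx⟩
    by_contra hxN
    obtain ⟨z, hz⟩ := hcon x hxN q hq
    exact absurd (hx z) (not_le.2 hz)
  have lower : ∀ q : V →L[ℝ] ℝ, ‖q‖ < δ → ∀ x, (∀ z, w z ≤ w x + q (z - x)) →
      ∀ z, w x + q (z - x) - c * ‖z - x‖ ^ 2 ≤ w z := by
    intro q hq x hx z
    obtain ⟨ξ, hξ⟩ := hsupp q hq x hx
    have h0 : ξ - q = 0 := by
      apply ContinuousLinearMap.eq_zero_of_le_sq (c := c)
      intro v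
      have h1 := hξ (x + v)
      have h2 := hx (x + v)
      rw [add_sub_cancel_left] at h1 h2
      rw [sub_apply]
      linarith
    rw [← sub_eq_zero.1 h0]
    exact hξ z
  classical
  set G : V → (V →L[ℝ] ℝ) := fun x => if h : x ∈ S then h.choose else 0 with hG
  have hGs : ∀ x ∈ S, ‖G x‖ < δ ∧ ∀ z, w z ≤ w x + G x (z - x) := by
    intro x hx
    simp only [hG, dif_pos hx]
    exact hx.choose_spec
  have hlip : LipschitzOnWith (4 * c).toNNReal G S := by
    apply LipschitzOnWith.of_dist_le_mul
    intro x₁ h₁ x₂ h₂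
    rw [dist_eq_norm, dist_eq_norm, Real.coe_toNNReal _ (by positivity)]
    obtain ⟨hq₁, hm₁⟩ := hGs x₁ h₁
    obtain ⟨hq₂, hm₂⟩ := hGs x₂ h₂
    have key : ∀ v, (G x₂ - G x₁) v ≤ c * (‖x₁ - x₂‖ + ‖v‖) ^ 2 := by
      intro v
      have e1 := hm₁ (x₁ + v)
      have e2 := lower _ hq₂ x₂ hm₂ (x₁ + v)
      have e3 := hm₂ x₁
      have e4 : x₁ + v - x₂ = (x₁ - x₂) + v := by abel
      rw [add_sub_cancel_left] at e1
      rw [e4, map_add] at e2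
      have e5 : ‖x₁ - x₂ + v‖ ^ 2 ≤ (‖x₁ - x₂‖ + ‖v‖) ^ 2 :=
        pow_le_pow_left₀ (norm_nonneg _) (norm_add_le _ _) 2
      rw [sub_apply]
      nlinarith
    rcases eq_or_ne x₁ x₂ with rfl | hne
    · simp
    have hpos : 0 < ‖x₁ - x₂‖ := norm_pos_iff.2 (sub_ne_zero.2 hne)
    rw [norm_sub_rev (G x₁)]
    refine ContinuousLinearMap.opNorm_le_of_unit_norm (by positivity) fun v hv => ?_
    have key' : ∀ v : V, ‖v‖ = 1 → (G x₂ - G x₁) v ≤ 4 * c * ‖x₁ - x₂‖ := by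
      intro v hv
      have h := key (‖x₁ - x₂‖ • v)
      rw [map_smul, smul_eq_mul, norm_smul, norm_norm, hv, mul_one] at h
      nlinarith
    rw [Real.norm_eq_abs, abs_le]
    have h := key' (-v) (by rw [norm_neg, hv])
    rw [map_neg] at h
    exact ⟨by linarith, key' v hv⟩
  have hdim : Module.finrank ℝ V = Module.finrank ℝ (V →L[ℝ] ℝ) := by
    rw [← Subspace.dual_finrank_eq (K := ℝ) (V := V)]
    exact LinearMap.toContinuousLinearMap.finrank_eq
  have hnull : (Measure.addHaar : Measure (V →L[ℝ] ℝ)) (G '' S) = 0 :=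
    hlip.addHaar_image_null hdim μ _ (measure_mono_null hSN hN)
  have hball : Metric.ball (0 : V →L[ℝ] ℝ) δ ⊆ G '' S := by
    intro q hq
    rw [mem_ball_zero_iff] at hq
    obtain ⟨x, hx⟩ := hmax q hq
    have hxS : x ∈ S := ⟨q, hq, hx⟩
    refine ⟨x, hxS, ?_⟩
    have h0 : q - G x = 0 := by
      apply ContinuousLinearMap.eq_zero_of_le_sq (c := c)
      intro v
      have h1 := lower q hq x hx (x + v)
      have h2 := (hGs x hxS).2 (x + v)
      rw [add_sub_cancel_left] at h1 h2
      rw [sub_apply]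
      linarith
    exact (sub_eq_zero.1 h0).symm
  exact absurd (measure_mono_null hball hnull) (Metric.measure_ball_pos _ _ hδ).ne'

/-- Minty's theorem for a finite convex function: the resolvent of its subdifferential is everywhere
defined. -/
lemma exists_resolvent {H : Type*} [NormedAddCommGroup H] [InnerProductSpace ℝ H]
    [FiniteDimensional ℝ H] {F : H → ℝ}
    (hF : ∀ y, ∃ ξ : H, ∀ z, F y + ⟪ξ, z - y⟫ ≤ F z) (x : H) :
    ∃ y, ∀ z, F y + ⟪x - y, z - y⟫ ≤ F z := by
  have hconv : ∀ a b : H, ∀ s : ℝ, 0 ≤ s → s ≤ 1 → F (a + s • (b - a)) ≤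
      (1 - s) * F a + s * F b := by
    intro a b s hs0 hs1
    obtain ⟨ξ, hξ⟩ := hF (a + s • (b - a))
    have h1 := hξ a
    have h2 := hξ b
    have e1 : a - (a + s • (b - a)) = (-s) • (b - a) := by module
    have e2 : b - (a + s • (b - a)) = (1 - s) • (b - a) := by module
    rw [e1, inner_smul_right] at h1
    rw [e2, inner_smul_right] at h2
    nlinarith [mul_le_mul_of_nonneg_left h1 (by linarith : 0 ≤ 1 - s),
      mul_le_mul_of_nonneg_left h2 hs0]
  have hco : ConvexOn ℝ univ F := by
    refine ⟨convex_univ, fun a _ b _ p q hp hq hpq => ?_⟩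
    have h := hconv a b q hq (by linarith)
    have e : a + q • (b - a) = p • a + q • b := by
      rw [show p = 1 - q by linarith]; module
    rw [e, show 1 - q = p by linarith] at h
    simpa using h
  have hcont : Continuous F := by
    rw [← continuousOn_univ]
    exact hco.continuousOn isOpen_univ
  obtain ⟨ξ, hξ⟩ := hF x
  have hcont2 : Continuous fun y => F y + 1 / 2 * ‖y - x‖ ^ 2 := by fun_prop
  obtain ⟨y, hy, hmin⟩ := (isCompact_closedBall x (2 * ‖ξ‖)).exists_isMinOn
    (Metric.nonempty_closedBall.2 (by positivity)) hcont2.continuousOn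
  have hglob : ∀ z, F y + 1 / 2 * ‖y - x‖ ^ 2 ≤ F z + 1 / 2 * ‖z - x‖ ^ 2 := by
    intro z
    by_cases hz : z ∈ Metric.closedBall x (2 * ‖ξ‖)
    · exact hmin hz
    · rw [mem_closedBall_iff_norm, not_le] at hz
      have h1 : F y + 1 / 2 * ‖y - x‖ ^ 2 ≤ F x + 1 / 2 * ‖x - x‖ ^ 2 :=
        hmin (Metric.mem_closedBall_self (by positivity))
      rw [sub_self, norm_zero] at h1
      have h2 := hξ z
      have h3 := neg_le_of_abs_le (abs_real_inner_le_norm ξ (z - x))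
      nlinarith [norm_nonneg (z - x), norm_nonneg ξ]
  refine ⟨y, fun z => ?_⟩
  have key : ∀ s : ℝ, 0 < s → s ≤ 1 → F y + ⟪x - y, z - y⟫ ≤ F z + s * (1 / 2 * ‖z - y‖ ^ 2) := by
    intro s hs0 hs1
    have h1 := hglob (y + s • (z - y))
    have h2 := hconv y z s hs0.le hs1
    have e : y + s • (z - y) - x = s • (z - y) - (x - y) := by abel
    rw [e, norm_sub_rev y x, norm_sub_sq_real (s • (z - y)), norm_smul, Real.norm_of_nonneg hs0.le,
      inner_smul_left, real_inner_comm] at h1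
    simp only [conj_trivial] at h1
    have : s * (F y + ⟪x - y, z - y⟫) ≤ s * (F z + s * (1 / 2 * ‖z - y‖ ^ 2)) := by nlinarith
    exact le_of_mul_le_mul_left this hs0
  refine le_of_forall_pos_le_add fun ε hε => ?_
  set s := min 1 (ε / (1 / 2 * ‖z - y‖ ^ 2 + 1)) with hs
  have hd : 0 < 1 / 2 * ‖z - y‖ ^ 2 + 1 := by positivity
  have hs0 : 0 < s := lt_min one_pos (by positivity)
  have h1 := key s hs0 (min_le_left _ _)
  have h2 : s * (1 / 2 * ‖z - y‖ ^ 2 + 1) ≤ ε := by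
    rw [← le_div_iff₀ hd]; exact min_le_right _ _
  linarith

/-- If the subgradients of a convex function are differentiable at a point, the function has a
second-order expansion there. -/
lemma quadratic_expansion_of_subgradient {H : Type*} [NormedAddCommGroup H]
    [InnerProductSpace ℝ H] {F : H → ℝ}
    (hF : ∀ y, ∃ ξ : H, ∀ z, F y + ⟪ξ, z - y⟫ ≤ F z) {y ξ : H} {B : H →L[ℝ] H}
    (hB : ∀ ε > 0, ∃ ρ > 0, ∀ h : H, ‖h‖ < ρ → ∀ ξ' : H,
      (∀ z, F (y + h) + ⟪ξ', z - (y + h)⟫ ≤ F z) → ‖ξ' - ξ - B h‖ ≤ ε * ‖h‖) :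
    (fun h => F (y + h) - F y - ⟪ξ, h⟫ - 1 / 2 * ⟪B h, h⟫) =o[𝓝 0] fun h => ‖h‖ ^ 2 := by
  rw [isLittleO_iff]
  intro ε hε
  obtain ⟨ρ, hρ, hρB⟩ := hB ε hε
  filter_upwards [Metric.ball_mem_nhds (0 : H) hρ] with h hh
  rw [mem_ball_zero_iff] at hh
  choose η hη using hF
  have hest : ∀ s : ℝ, 0 ≤ s → s ≤ 1 →
      |⟪η (y + s • h), h⟫ - ⟪ξ, h⟫ - s * ⟪B h, h⟫| ≤ ε * ‖h‖ ^ 2 := by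
    intro s hs0 hs1
    have hn : ‖s • h‖ ≤ ‖h‖ := by
      rw [norm_smul, Real.norm_of_nonneg hs0]
      exact mul_le_of_le_one_left (norm_nonneg _) hs1
    have h1 := hρB (s • h) (hn.trans_lt hh) _ (hη (y + s • h))
    have e : ⟪η (y + s • h), h⟫ - ⟪ξ, h⟫ - s * ⟪B h, h⟫ = ⟪η (y + s • h) - ξ - B (s • h), h⟫ := by
      rw [map_smul, inner_sub_left, inner_sub_left, inner_smul_left]; simp
    rw [e]
    calc _ ≤ ‖η (y + s • h) - ξ - B (s • h)‖ * ‖h‖ := abs_real_inner_le_norm _ _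
      _ ≤ (ε * ‖h‖) * ‖h‖ := by
        gcongr
        exact h1.trans (by gcongr)
      _ = _ := by ring
  set b := ⟪B h, h⟫ with hb
  set D : ℝ → ℝ := fun s => F (y + s • h) - F y - s * ⟪ξ, h⟫ - 1 / 2 * s ^ 2 * b with hD
  have hstep : ∀ s d : ℝ, 0 ≤ s → 0 ≤ d → s + d ≤ 1 →
      |D (s + d) - D s| ≤ d * (ε * ‖h‖ ^ 2) + d ^ 2 * |b| := by
    intro s d hs hd hsd
    have u1 := hη (y + s • h) (y + (s + d) • h)
    have u2 := hη (y + (s + d) • h) (y + s • h)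
    have e1 : y + (s + d) • h - (y + s • h) = d • h := by module
    have e2 : y + s • h - (y + (s + d) • h) = (-d) • h := by module
    rw [e1, inner_smul_right] at u1
    rw [e2, inner_smul_right] at u2
    have v1 := abs_le.1 (hest s hs (by linarith))
    have v2 := abs_le.1 (hest (s + d) (by linarith) hsd)
    have w1 := mul_le_mul_of_nonneg_left v1.1 hd
    have w2 := mul_le_mul_of_nonneg_left v2.2 hd
    have b1 := le_abs_self b
    have b2 := neg_abs_le b
    have q1 := mul_le_mul_of_nonneg_left b1 (sq_nonneg d)
    have q2 := mul_le_mul_of_nonneg_left b2 (sq_nonneg d)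
    have q3 := mul_nonneg (sq_nonneg d) (abs_nonneg b)
    simp only [hD]
    rw [abs_le]
    constructor <;> nlinarith
  have hm : ∀ m : ℕ, |D 1| ≤ ε * ‖h‖ ^ 2 + |b| / ((m : ℝ) + 1) := by
    intro m
    have hmp : (0 : ℝ) < (m : ℝ) + 1 := by positivity
    have hind : ∀ i : ℕ, i ≤ m + 1 → |D (i * (1 / ((m : ℝ) + 1)))| ≤
        i * ((1 / ((m : ℝ) + 1)) * (ε * ‖h‖ ^ 2) + (1 / ((m : ℝ) + 1)) ^ 2 * |b|) := by
      intro i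
      induction i with
      | zero => intro _; simp [hD]
      | succ i ih =>
        intro hi
        have h1 := ih (by omega)
        have hle : (i : ℝ) * (1 / ((m : ℝ) + 1)) + 1 / ((m : ℝ) + 1) ≤ 1 := by
          have : ((i : ℝ) + 1) ≤ (m : ℝ) + 1 := by exact_mod_cast hi
          rw [← add_one_mul, mul_one_div]
          exact (div_le_one hmp).2 this
        have h2 := hstep (i * (1 / ((m : ℝ) + 1))) (1 / ((m : ℝ) + 1)) (by positivity)
          (by positivity) hle
        push_cast
        rw [add_one_mul]
        have h3 := abs_add_le (D (i * (1 / ((m : ℝ) + 1)) + 1 / ((m : ℝ) + 1)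
          ) - D (i * (1 / ((m : ℝ) + 1)))) (D (i * (1 / ((m : ℝ) + 1))))
        rw [sub_add_cancel] at h3
        linarith
    have h1 := hind (m + 1) le_rfl
    push_cast at h1
    rw [mul_one_div_cancel hmp.ne'] at h1
    refine h1.trans (le_of_eq ?_)
    field_simp
  have hlim : |D 1| ≤ ε * ‖h‖ ^ 2 := by
    have ht : Tendsto (fun m : ℕ => ε * ‖h‖ ^ 2 + |b| / ((m : ℝ) + 1)) atTop
        (𝓝 (ε * ‖h‖ ^ 2 + 0)) := by
      refine tendsto_const_nhds.add ?_
      have := tendsto_one_div_add_atTop_nhds_zero_nat.const_mul |b|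
      simpa [div_eq_mul_inv] using this
    rw [add_zero] at ht
    exact ge_of_tendsto' ht hm
  simpa [hD] using hlim

/-- Alexandrov's theorem for finite convex functions on a finite-dimensional inner product space. -/
lemma ae_quadratic_expansion_of_convex {H : Type*} [NormedAddCommGroup H] [InnerProductSpace ℝ H]
    [FiniteDimensional ℝ H] [MeasurableSpace H] [BorelSpace H] (μ : Measure H) [μ.IsAddHaarMeasure]
    {F : H → ℝ} (hF : ∀ y, ∃ ξ : H, ∀ z, F y + ⟪ξ, z - y⟫ ≤ F z) :
    ∀ᵐ y ∂μ, ∃ (ξ : H) (B : H →L[ℝ] H),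
      (fun h => F (y + h) - F y - ⟪ξ, h⟫ - 1 / 2 * ⟪B h, h⟫) =o[𝓝 0] fun h => ‖h‖ ^ 2 := by
  choose J hJ using exists_resolvent hF
  have mono : ∀ x₁ x₂ y₁ y₂ : H, (∀ z, F y₁ + ⟪x₁ - y₁, z - y₁⟫ ≤ F z) →
      (∀ z, F y₂ + ⟪x₂ - y₂, z - y₂⟫ ≤ F z) → ‖y₁ - y₂‖ ^ 2 ≤ ⟪y₁ - y₂, x₁ - x₂⟫ := by
    intro x₁ x₂ y₁ y₂ h₁ h₂
    have a := h₁ y₂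
    have b := h₂ y₁
    have e : ⟪y₁ - y₂, x₁ - x₂⟫ - ‖y₁ - y₂‖ ^ 2 =
        - ⟪x₁ - y₁, y₂ - y₁⟫ - ⟪x₂ - y₂, y₁ - y₂⟫ := by
      rw [← real_inner_self_eq_norm_sq, ← inner_sub_right, ← neg_sub y₁ y₂, inner_neg_right,
        neg_neg, ← inner_sub_left, real_inner_comm]
      congr 1; abel
    linarith
  have hlip : LipschitzWith 1 J := by
    apply LipschitzWith.of_dist_le_mul
    intro x₁ x₂
    rw [dist_eq_norm, dist_eq_norm, NNReal.coe_one, one_mul]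
    have h1 := mono _ _ _ _ (hJ x₁) (hJ x₂)
    have h2 := real_inner_le_norm (J x₁ - J x₂) (x₁ - x₂)
    by_contra! hlt
    nlinarith [norm_nonneg (x₁ - x₂)]
  have hval : ∀ y ξ : H, (∀ z, F y + ⟪ξ, z - y⟫ ≤ F z) → J (y + ξ) = y := by
    intro y ξ h
    have h1 := mono (y + ξ) (y + ξ) _ y (hJ (y + ξ)) (by simpa using h)
    rw [sub_self, inner_zero_right] at h1
    exact sub_eq_zero.1 (norm_eq_zero.1 (pow_eq_zero_iff two_ne_zero |>.1
      (le_antisymm h1 (sq_nonneg _))))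
  have hN₁ : μ (J '' {x | ¬ DifferentiableAt ℝ J x}) = 0 :=
    (hlip.lipschitzOnWith (s := {x | ¬ DifferentiableAt ℝ J x})).addHaar_image_null rfl μ μ
      hlip.ae_differentiableAt
  have hN₂ : μ (J '' {x | DifferentiableAt ℝ J x ∧ (fderiv ℝ J x).det = 0}) = 0 :=
    addHaar_image_eq_zero_of_det_fderivWithin_eq_zero μ
      (fun x hx => hx.1.hasFDerivAt.hasFDerivWithinAt) (fun x hx => hx.2)
  have hN : ∀ᵐ y ∂μ, y ∉ J '' {x | ¬ DifferentiableAt ℝ J x} ∪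
      J '' {x | DifferentiableAt ℝ J x ∧ (fderiv ℝ J x).det = 0} :=
    measure_eq_zero_iff_ae_notMem.1 (measure_union_null hN₁ hN₂)
  filter_upwards [hN] with y hy
  obtain ⟨ξ, hξ⟩ := hF y
  set x := y + ξ with hx
  have hJx : J x = y := hval y ξ hξ
  have hdiff : DifferentiableAt ℝ J x := by
    by_contra h
    exact hy (Or.inl ⟨x, h, hJx⟩)
  have hdet : (fderiv ℝ J x).det ≠ 0 := fun h => hy (Or.inr ⟨x, ⟨hdiff, h⟩, hJx⟩)
  set L := (fderiv ℝ J x).toContinuousLinearEquivOfDetNeZero hdet with hL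
  set Li : H →L[ℝ] H := (L.symm : H →L[ℝ] H) with hLi
  have hLiL : ∀ v, Li (fderiv ℝ J x v) = v := fun v => L.symm_apply_apply v
  refine ⟨ξ, Li - ContinuousLinearMap.id ℝ H, quadratic_expansion_of_subgradient hF ?_⟩
  set M := ‖Li‖ + 1 with hM
  have hMpos : 0 < M := by positivity
  have hLiM : ∀ v, ‖Li v‖ ≤ M * ‖v‖ := fun v =>
    (Li.le_opNorm v).trans (by gcongr; simp [hM])
  have hexp : ∀ η > 0, ∃ ρ > 0, ∀ k : H, ‖k‖ ≤ ρ →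
      ‖J (x + k) - y - fderiv ℝ J x k‖ ≤ η * ‖k‖ := by
    intro η hη
    have h1 := (hasFDerivAt_iff_isLittleO_nhds_zero.1 hdiff.hasFDerivAt).def hη
    rw [hJx] at h1
    obtain ⟨ρ, hρ, hρ'⟩ := Metric.nhds_basis_closedBall.eventually_iff.1 h1
    exact ⟨ρ, hρ, fun k hk => hρ' (by simpa using hk)⟩
  intro ε hε
  set η := min (1 / (2 * M)) (ε / (2 * M ^ 2)) with hη
  have hηpos : 0 < η := lt_min (by positivity) (by positivity)
  have hη1 : M * η ≤ 1 / 2 := by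
    calc M * η ≤ M * (1 / (2 * M)) := by gcongr; exact min_le_left _ _
      _ = 1 / 2 := by field_simp
  have hη2 : 2 * M ^ 2 * η ≤ ε := by
    calc 2 * M ^ 2 * η ≤ 2 * M ^ 2 * (ε / (2 * M ^ 2)) := by gcongr; exact min_le_right _ _
      _ = ε := by field_simp
  obtain ⟨ρ, hρ, hρJ⟩ := hexp η hηpos
  have hlow : ∀ k : H, ‖k‖ ≤ ρ → ‖k - Li (J (x + k) - y)‖ ≤ M * η * ‖k‖ ∧
      ‖k‖ ≤ 2 * M * ‖J (x + k) - y‖ := by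
    intro k hk
    have e : k - Li (J (x + k) - y) = - Li (J (x + k) - y - fderiv ℝ J x k) := by
      rw [map_sub Li _ (fderiv ℝ J x k), hLiL]; abel
    have h1 : ‖k - Li (J (x + k) - y)‖ ≤ M * η * ‖k‖ := by
      rw [e, norm_neg]
      calc _ ≤ M * ‖J (x + k) - y - fderiv ℝ J x k‖ := hLiM _
        _ ≤ M * (η * ‖k‖) := by gcongr; exact hρJ k hk
        _ = _ := by ring
    refine ⟨h1, ?_⟩
    have h2 := norm_sub_norm_le k (Li (J (x + k) - y))
    have h3 := hLiM (J (x + k) - y)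
    have h4 := mul_le_mul_of_nonneg_right hη1 (norm_nonneg k)
    linarith
  refine ⟨ρ / (4 * M ^ 2), by positivity, fun h hh ξ' hξ' => ?_⟩
  set k := y + h + ξ' - x with hk
  have hJk : J (x + k) = y + h := by
    rw [hk, add_sub_cancel]; exact hval _ _ hξ'
  have hkρ : ‖k‖ ≤ ρ := by
    by_contra! hlt
    have hkpos : 0 < ‖k‖ := hρ.trans hlt
    set s := ρ / ‖k‖ with hs
    have hs0 : 0 < s := by positivity
    have hs1 : s < 1 := (div_lt_one hkpos).2 hlt
    have hsk : ‖s • k‖ = ρ := by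
      rw [norm_smul, Real.norm_of_nonneg hs0.le, hs]; field_simp
    have a1 := (hlow (s • k) hsk.le).2
    rw [hsk] at a1
    have a2 := mono _ _ _ _ (hJ (x + s • k)) (hJ x)
    rw [add_sub_cancel_left, inner_smul_right, hJx] at a2
    have a3 := mono _ _ _ _ (hJ (x + k)) (hJ (x + s • k))
    have e : x + k - (x + s • k) = (1 - s) • k := by module
    rw [e, inner_smul_right, hJk] at a3
    have a4 : 0 ≤ ⟪y + h - J (x + s • k), k⟫ := by
      by_contra! hneg
      nlinarith [sq_nonneg ‖y + h - J (x + s • k)‖]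
    have a5 : ⟪y + h - J (x + s • k), k⟫ = ⟪h, k⟫ - ⟪J (x + s • k) - y, k⟫ := by
      rw [← inner_sub_left]; congr 1; abel
    have a6 := real_inner_le_norm h k
    have a7 : s * ‖k‖ = ρ := by rw [hs]; field_simp
    have a8 : ‖J (x + s • k) - y‖ ^ 2 ≤ ρ * ‖h‖ := by
      calc _ ≤ s * ⟪J (x + s • k) - y, k⟫ := a2
        _ ≤ s * (‖h‖ * ‖k‖) := by gcongr; linarith
        _ = (s * ‖k‖) * ‖h‖ := by ring
        _ = _ := by rw [a7]
    have a9 : ρ ^ 2 ≤ 4 * M ^ 2 * (ρ * ‖h‖) := by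
      calc ρ ^ 2 ≤ (2 * M * ‖J (x + s • k) - y‖) ^ 2 := by gcongr
        _ = 4 * M ^ 2 * ‖J (x + s • k) - y‖ ^ 2 := by ring
        _ ≤ _ := by gcongr
    rw [lt_div_iff₀ (by positivity)] at hh
    nlinarith
  obtain ⟨b1, b2⟩ := hlow k hkρ
  rw [hJk, add_sub_cancel_left] at b1 b2
  have e : ξ' - ξ - (Li - ContinuousLinearMap.id ℝ H) h = k - Li h := by
    rw [sub_apply, ContinuousLinearMap.id_apply, hk, hx]; abel
  rw [e]
  calc _ ≤ M * η * ‖k‖ := b1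
    _ ≤ M * η * (2 * M * ‖h‖) := by gcongr
    _ = (2 * M ^ 2 * η) * ‖h‖ := by ring
    _ ≤ ε * ‖h‖ := by gcongr

/-- Alexandrov's theorem for semiconvex functions on a finite-dimensional normed space. -/
lemma ae_quadratic_expansion_of_semiconvex {V : Type*} [NormedAddCommGroup V] [NormedSpace ℝ V]
    [FiniteDimensional ℝ V] [MeasurableSpace V] [BorelSpace V] (μ : Measure V)
    [μ.IsAddHaarMeasure] {f : V → ℝ} {c : ℝ} (hc : 0 ≤ c)
    (hf : ∀ x, ∃ ξ : V →L[ℝ] ℝ, ∀ z, f x + ξ (z - x) - c * ‖z - x‖ ^ 2 ≤ f z) :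
    ∀ᵐ x ∂μ, ∃ (ξ : V →L[ℝ] ℝ) (B : V →L[ℝ] V →L[ℝ] ℝ),
      (fun h => f (x + h) - f x - ξ h - 1 / 2 * B h h) =o[𝓝 0] fun h => ‖h‖ ^ 2 := by
  set e := toEuclidean (E := V) with he
  set H := EuclideanSpace ℝ (Fin (Module.finrank ℝ V)) with hH
  set C := ‖(e.symm : H →L[ℝ] V)‖ with hC
  set d := c * C ^ 2 with hd
  set F : H → ℝ := fun x => f (e.symm x) + d * ‖x‖ ^ 2 with hFdef
  have hbound : ∀ v : H, c * ‖e.symm v‖ ^ 2 ≤ d * ‖v‖ ^ 2 := by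
    intro v
    have h1 : ‖e.symm v‖ ≤ C * ‖v‖ := (e.symm : H →L[ℝ] V).le_opNorm v
    calc c * ‖e.symm v‖ ^ 2 ≤ c * (C * ‖v‖) ^ 2 := by gcongr
      _ = _ := by rw [hd]; ring
  have hF : ∀ y, ∃ ξ : H, ∀ z, F y + ⟪ξ, z - y⟫ ≤ F z := by
    intro y
    obtain ⟨ξ, hξ⟩ := hf (e.symm y)
    refine ⟨(InnerProductSpace.toDual ℝ H).symm (ξ.comp (e.symm : H →L[ℝ] V)) + (2 * d) • y,
      fun z => ?_⟩
    have h1 := hξ (e.symm z)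
    rw [← map_sub] at h1
    have h2 := hbound (z - y)
    have h3 : ‖z‖ ^ 2 = ‖y‖ ^ 2 + 2 * ⟪y, z - y⟫ + ‖z - y‖ ^ 2 := by
      rw [← norm_add_sq_real, add_sub_cancel]
    simp only [hFdef]
    rw [inner_add_left, InnerProductSpace.toDual_symm_apply, inner_smul_left, h3]
    simp only [conj_trivial, ContinuousLinearMap.comp_apply, ContinuousLinearEquiv.coe_coe]
    nlinarith
  have hae := ae_quadratic_expansion_of_convex (Measure.addHaar : Measure H) hF
  obtain ⟨r, hr, hmap⟩ := LinearMap.exists_map_addHaar_eq_smul_addHaar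
    (e : V →ₗ[ℝ] H) μ (Measure.addHaar : Measure H) e.surjective
  have hq : Measure.QuasiMeasurePreserving e μ (Measure.addHaar : Measure H) := by
    refine ⟨e.continuous.measurable, ?_⟩
    change Measure.map (⇑(e : V →ₗ[ℝ] H)) μ ≪ _
    rw [hmap]
    exact Measure.smul_absolutelyContinuous
  filter_upwards [hq.ae hae] with x hx
  obtain ⟨ξ, B, hB⟩ := hx
  refine ⟨((InnerProductSpace.toDual ℝ H) (ξ - (2 * d) • e x)).comp (e : V →L[ℝ] H),
    ((innerSL ℝ).comp (B - (2 * d) • ContinuousLinearMap.id ℝ H)).bilinearComp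
      (e : V →L[ℝ] H) (e : V →L[ℝ] H), ?_⟩
  have ht : Tendsto e (𝓝 0) (𝓝 0) := by
    have := e.continuous.tendsto 0
    rwa [map_zero] at this
  have h1 := hB.comp_tendsto ht
  have h2 : ((fun h : H => ‖h‖ ^ 2) ∘ e) =O[𝓝 0] fun h : V => ‖h‖ ^ 2 := by
    have := ((e : V →L[ℝ] H).isBigO_id (𝓝 0)).norm_norm.pow 2
    exact this
  refine (h1.trans_isBigO h2).congr_left fun h => ?_
  have h3 : ‖e x + e h‖ ^ 2 = ‖e x‖ ^ 2 + 2 * ⟪e x, e h⟫ + ‖e h‖ ^ 2 := norm_add_sq_real _ _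
  simp only [Function.comp_apply, hFdef]
  rw [h3, ← map_add, e.symm_apply_apply, e.symm_apply_apply]
  simp
  ring

/-- The Riesz map of a finite-dimensional real inner product space as a continuous linear map. -/
lemma exists_riesz_clm (H : Type*) [NormedAddCommGroup H] [InnerProductSpace ℝ H]
    [FiniteDimensional ℝ H] : ∃ D : (H →L[ℝ] ℝ) →L[ℝ] H, ∀ l a, ⟪D l, a⟫ = l a :=
  ⟨LinearMap.toContinuousLinearMap
    { toFun := fun l => (InnerProductSpace.toDual ℝ H).symm l
      map_add' := fun _ _ => map_add _ _ _
      map_smul' := fun c l => by simp },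
    fun l a => InnerProductSpace.toDual_symm_apply⟩

/-- A viscosity subsolution touched from above by a quadratic polynomial satisfies the differential
inequality with the derivatives of that polynomial. -/
lemma IsViscositySubsoln.le_trace_of_quadratic {n : ℕ} {Ω : Set (EuclideanSpace ℝ (Fin n))} {T : ℝ}
    {A : EuclideanSpace ℝ (Fin n) → ℝ → Matrix (Fin n) (Fin n) ℝ} {v : EuclideanSpace ℝ
        (Fin n) × ℝ → ℝ}
    (hv : IsViscositySubsoln n Ω T (fun _ p X t => (A p t * X).trace) v)
    {w₀ : EuclideanSpace ℝ (Fin n) × ℝ} (hx₀ : w₀.1 ∈ Ω) (ht₀ : w₀.2 ∈ Ioo 0 T)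
    {ξ : EuclideanSpace ℝ (Fin n) × ℝ →L[ℝ] ℝ} {G : EuclideanSpace ℝ
        (Fin n) × ℝ →L[ℝ] EuclideanSpace ℝ (Fin n) × ℝ →L[ℝ] ℝ} (hG : ∀ h k, G h k = G k h)
    (hjet : ∀ᶠ h in 𝓝 0, v (w₀ + h) ≤ v w₀ + ξ h + 1 / 2 * G h h)
    {p : EuclideanSpace ℝ (Fin n)} (hp : ∀ h, ⟪p, h⟫ = ξ (h, 0)) {X : Matrix (Fin n) (Fin n) ℝ}
    (hX : ∀ a b : EuclideanSpace ℝ (Fin n), ⟪X.toEuclideanLin a, b⟫ = G (a, 0) (b, 0)) :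
    ξ (0, 1) ≤ (A p w₀.2 * X).trace := by
  set Φ : EuclideanSpace ℝ (Fin n) × ℝ → ℝ := fun w => ξ (w - w₀) + 1 / 2 * G (w - w₀)
      (w - w₀) with hΦ
  set L : EuclideanSpace ℝ (Fin n) × ℝ → (EuclideanSpace ℝ (Fin n) × ℝ →L[ℝ] ℝ) := fun w => ξ + G
      (w - w₀) with hL
  have h0 : ∀ w, HasFDerivAt (fun w : EuclideanSpace ℝ (Fin n) × ℝ => w - w₀)
      (ContinuousLinearMap.id ℝ _) w := fun w =>
    (hasFDerivAt_id w).sub_const w₀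
  have hder : ∀ w, HasFDerivAt Φ (L w) w := by
    intro w
    have h1 : HasFDerivAt (fun w : EuclideanSpace ℝ (Fin n) × ℝ => ξ (w - w₀)) (ξ.comp
        (ContinuousLinearMap.id ℝ _)) w :=
      ξ.hasFDerivAt.comp w (h0 w)
    have h2 := (G.hasFDerivAt.comp w (h0 w)).clm_apply (h0 w)
    refine (h1.add (h2.const_mul (1 / 2))).congr_fderiv ?_
    refine ContinuousLinearMap.ext fun k => ?_
    have h3 : L w k = ξ k + G (w - w₀) k := rfl
    rw [h3]
    have h4 : (1 / 2 : ℝ) * (G (w - w₀) k + G k (w - w₀)) = G (w - w₀) k := by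
      rw [hG k]; ring
    rw [← h4]
    rfl
  have hLc : Continuous L := by
    simp only [hL]; fun_prop
  obtain ⟨R, hR⟩ := exists_riesz_clm (EuclideanSpace ℝ (Fin n))
  set D : (EuclideanSpace ℝ (Fin n) × ℝ →L[ℝ] ℝ) →L[ℝ] EuclideanSpace ℝ (Fin n) :=
    R.comp ((ContinuousLinearMap.compL ℝ (EuclideanSpace ℝ (Fin n)) (EuclideanSpace ℝ
        (Fin n) × ℝ) ℝ).flip (ContinuousLinearMap.inl ℝ (EuclideanSpace ℝ (Fin n)) ℝ)) with hD
  have hDi : ∀ l a, ⟪D l, a⟫ = l (a, 0) := fun l a => hR _ _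
  have hDL : D (L w₀) = p := by
    refine ext_inner_right ℝ fun a => ?_
    rw [hDi, hp]; simp [hL]
  have h1 : ∀ w : EuclideanSpace ℝ (Fin n) × ℝ, HasFDerivAt (fun x : EuclideanSpace ℝ (Fin n) =>
      (x, w.2)) (ContinuousLinearMap.inl ℝ (EuclideanSpace ℝ (Fin n)) ℝ) w.1 :=
    fun w => hasFDerivAt_prodMk_left _ _
  have htest : IsC21Test n T Φ (fun w => L w (0, 1)) (fun w => D (L w)) (fun _ => X) := by
    refine ⟨fun w _ => ?_, fun w _ => ?_, fun w _ => ?_, ?_, ?_, continuousOn_const⟩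
    · have h1 : HasDerivAt (fun s : ℝ => (w.1, s)) ((0 : EuclideanSpace ℝ (Fin n)), (1 : ℝ)) w.2 :=
        (hasDerivAt_const _ _).prodMk (hasDerivAt_id _)
      exact (hder w).comp_hasDerivAt w.2 h1
    · rw [hasGradientAt_iff_hasFDerivAt]
      refine ((hder w).comp w.1 (h1 w)).congr_fderiv ?_
      refine ContinuousLinearMap.ext fun a => ?_
      rw [InnerProductSpace.toDual_apply_apply, hDi]; rfl
    · have h2 : HasFDerivAt L (G.comp (ContinuousLinearMap.id ℝ _)) w :=
        (G.hasFDerivAt.comp w (h0 w)).const_add ξ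
      refine (D.hasFDerivAt.comp w.1 (h2.comp w.1 (h1 w))).congr_fderiv ?_
      refine ContinuousLinearMap.ext fun a => ?_
      refine ext_inner_right ℝ fun b => ?_
      rw [ContinuousLinearMap.comp_apply, hDi]
      exact (hX a b).symm
    · exact (hLc.clm_apply continuous_const).continuousOn
    · exact (D.continuous.comp hLc).continuousOn
  have hmax : IsLocalMax (fun w => v w - Φ w) (w₀.1, w₀.2) := by
    have h0 : Tendsto (fun w : EuclideanSpace ℝ (Fin n) × ℝ => w - w₀) (𝓝 w₀) (𝓝 0) := by
      have : Continuous fun w : EuclideanSpace ℝ (Fin n) × ℝ => w - w₀ := by fun_prop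
      simpa using this.tendsto w₀
    filter_upwards [h0.eventually hjet] with w hw
    rw [add_sub_cancel] at hw
    simp only [hΦ, Prod.mk.eta, sub_self, map_zero, mul_zero, add_zero, sub_zero]
    linarith
  have h := hv _ _ _ _ htest w₀.1 w₀.2 hx₀ ht₀ hmax
  rw [Prod.mk.eta, hDL] at h
  simpa [hL] using h

/-- A second-order upper expansion of a viscosity subsolution yields the differential
inequality. -/
lemma IsViscositySubsoln.le_trace_of_expansion {n : ℕ} {Ω : Set (EuclideanSpace ℝ (Fin n))} {T : ℝ}
    {A : EuclideanSpace ℝ (Fin n) → ℝ → Matrix (Fin n) (Fin n) ℝ} {v : EuclideanSpace ℝ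
        (Fin n) × ℝ → ℝ}
    (hv : IsViscositySubsoln n Ω T (fun _ p X t => (A p t * X).trace) v)
    {w₀ : EuclideanSpace ℝ (Fin n) × ℝ} (hx₀ : w₀.1 ∈ Ω) (ht₀ : w₀.2 ∈ Ioo 0 T)
    {ξ : EuclideanSpace ℝ (Fin n) × ℝ →L[ℝ] ℝ} {B : EuclideanSpace ℝ
        (Fin n) × ℝ →L[ℝ] EuclideanSpace ℝ (Fin n) × ℝ →L[ℝ] ℝ}
    (hjet : ∀ η > 0, ∀ᶠ h in 𝓝 0, v (w₀ + h) ≤ v w₀ + ξ h + 1 / 2 * B h h + η * ‖h‖ ^ 2) :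
    ∃ (p : EuclideanSpace ℝ (Fin n)) (X : Matrix (Fin n) (Fin n) ℝ),
      (∀ h, ⟪p, h⟫ = ξ (h, 0)) ∧ X.IsHermitian ∧
      (∀ a : EuclideanSpace ℝ (Fin n), ⟪X.toEuclideanLin a, a⟫ = B (a, 0) (a, 0)) ∧
      ξ (0, 1) ≤ (A p w₀.2 * X).trace := by
  obtain ⟨G, hG⟩ : ∃ G : EuclideanSpace ℝ (Fin n) × ℝ →L[ℝ] EuclideanSpace ℝ
      (Fin n) × ℝ →L[ℝ] ℝ, ∀ h k, G h k = 1 / 2 * (B h k + B k h) :=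
    ⟨(1 / 2 : ℝ) • (B + B.flip), fun h k => rfl⟩
  obtain ⟨S, hS⟩ : ∃ S : EuclideanSpace ℝ (Fin n) →L[ℝ] EuclideanSpace ℝ
      (Fin n) →L[ℝ] ℝ, ∀ a b, S a b = ⟪a, b⟫ :=
    ⟨innerSL ℝ, fun _ _ => rfl⟩
  obtain ⟨I, hI⟩ : ∃ I : EuclideanSpace ℝ (Fin n) × ℝ →L[ℝ] EuclideanSpace ℝ
      (Fin n) × ℝ →L[ℝ] ℝ, ∀ h k, I h k = ⟪h.1, k.1⟫ + h.2 * k.2 :=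
    ⟨S.bilinearComp (ContinuousLinearMap.fst ℝ (EuclideanSpace ℝ (Fin n)) ℝ)
        (ContinuousLinearMap.fst ℝ (EuclideanSpace ℝ (Fin n)) ℝ) +
      (ContinuousLinearMap.mul ℝ ℝ).bilinearComp (ContinuousLinearMap.snd ℝ (EuclideanSpace ℝ
          (Fin n)) ℝ)
        (ContinuousLinearMap.snd ℝ (EuclideanSpace ℝ (Fin n)) ℝ),
      fun h k => by rw [← hS]; rfl⟩
  obtain ⟨R, hR⟩ := exists_riesz_clm (EuclideanSpace ℝ (Fin n))
  set p : EuclideanSpace ℝ (Fin n) := R (ξ.comp (ContinuousLinearMap.inl ℝ (EuclideanSpace ℝ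
      (Fin n)) ℝ)) with hp
  have hpi : ∀ h, ⟪p, h⟫ = ξ (h, 0) := fun h => hR _ _
  set C : EuclideanSpace ℝ (Fin n) →L[ℝ] EuclideanSpace ℝ (Fin n) := R.comp
    (G.bilinearComp (ContinuousLinearMap.inl ℝ (EuclideanSpace ℝ (Fin n)) ℝ)
        (ContinuousLinearMap.inl ℝ (EuclideanSpace ℝ (Fin n)) ℝ)) with hC
  have hCi : ∀ a b, ⟪C a, b⟫ = G (a, 0) (b, 0) := fun a b => hR _ _
  set X : Matrix (Fin n) (Fin n) ℝ := Matrix.toEuclideanLin.symm (C : EuclideanSpace ℝ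
      (Fin n) →ₗ[ℝ] EuclideanSpace ℝ (Fin n)) with hX
  have hXC : X.toEuclideanLin = (C : EuclideanSpace ℝ (Fin n) →ₗ[ℝ] EuclideanSpace ℝ
      (Fin n)) := by rw [hX, LinearEquiv.apply_symm_apply]
  have hXi : ∀ a b, ⟪X.toEuclideanLin a, b⟫ = G (a, 0) (b, 0) := fun a b => by
    rw [hXC]; exact hCi a b
  refine ⟨p, X, hpi, ?_, fun a => ?_, ?_⟩
  · rw [← Matrix.isSymmetric_toEuclideanLin_iff]
    intro a b
    rw [hXi, real_inner_comm, hXi, hG, hG]; ring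
  · rw [hXi, hG]; ring
  · have key : ∀ η > 0, ξ (0, 1) ≤ (A p w₀.2 * X).trace + η * (2 * (A p w₀.2).trace) := by
      intro η hη
      obtain ⟨G', hG'⟩ : ∃ G' : EuclideanSpace ℝ (Fin n) × ℝ →L[ℝ] EuclideanSpace ℝ
          (Fin n) × ℝ →L[ℝ] ℝ,
        ∀ h k, G' h k = G h k + 2 * η * (⟪h.1, k.1⟫ + h.2 * k.2) :=
          ⟨G + (2 * η) • I, fun h k => by rw [← hI]; rfl⟩
      have hj : ∀ᶠ h in 𝓝 0, v (w₀ + h) ≤ v w₀ + ξ h + 1 / 2 * G' h h := by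
        filter_upwards [hjet η hη] with h hh
        have h1 : ‖h‖ ^ 2 ≤ ⟪h.1, h.1⟫ + h.2 * h.2 := by
          rw [Prod.norm_def, real_inner_self_eq_norm_sq, ← sq, ← sq_abs h.2, ← Real.norm_eq_abs]
          rcases max_cases ‖h.1‖ ‖h.2‖ with ⟨e, -⟩ | ⟨e, -⟩ <;> rw [e] <;>
            nlinarith [sq_nonneg ‖h.1‖, sq_nonneg ‖h.2‖]
        have h2 : B h h + 2 * η * ‖h‖ ^ 2 ≤ G' h h := by
          rw [hG', hG]; nlinarith
        linarith
      have h3 := hv.le_trace_of_quadratic hx₀ ht₀ (fun h k => ?_) hj hpi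
        (X := X + (2 * η) • (1 : Matrix (Fin n) (Fin n) ℝ)) (fun a b => ?_)
      · refine h3.trans (le_of_eq ?_)
        rw [mul_add, Matrix.trace_add, Matrix.mul_smul, mul_one, Matrix.trace_smul, smul_eq_mul]
        ring
      · rw [hG', hG', hG, hG, real_inner_comm]; ring
      · rw [map_add, map_smul, LinearMap.add_apply, LinearMap.smul_apply, inner_add_left, hXi,
          inner_smul_left, hG']
        simp [Matrix.toEuclideanLin]
    refine le_of_forall_pos_le_add fun ε hε => ?_
    set a := 2 * (A p w₀.2).trace with ha
    have h1 := key (ε / (|a| + 1)) (by positivity)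
    have h2 : ε / (|a| + 1) * a ≤ ε := by
      rw [div_mul_eq_mul_div, div_le_iff₀ (by positivity)]
      nlinarith [le_abs_self a]
    linarith

/-- `f` is the sup-convolution of `v` over `K`, with weights `a` in space and `b` in time. -/
def IsSupConv {H : Type*} [NormedAddCommGroup H] (K : Set (H × ℝ)) (a b : ℝ)
    (v f : H × ℝ → ℝ) : Prop :=
  (∀ w, ∀ w' ∈ K, v w' - a * ‖w.1 - w'.1‖ ^ 2 - b * (w.2 - w'.2) ^ 2 ≤ f w) ∧
  ∀ w, ∃ w' ∈ K, f w = v w' - a * ‖w.1 - w'.1‖ ^ 2 - b * (w.2 - w'.2) ^ 2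

lemma exists_isSupConv {H : Type*} [NormedAddCommGroup H] {K : Set (H × ℝ)} (hK : IsCompact K)
    (hne : K.Nonempty) (a b : ℝ) {v : H × ℝ → ℝ} (hv : ContinuousOn v K) :
    ∃ f, IsSupConv K a b v f := by
  have h : ∀ w : H × ℝ, ∃ w' ∈ K, ∀ z ∈ K, v z - a * ‖w.1 - z.1‖ ^ 2 - b * (w.2 - z.2) ^ 2 ≤
      v w' - a * ‖w.1 - w'.1‖ ^ 2 - b * (w.2 - w'.2) ^ 2 := by
    intro w
    have hc : ContinuousOn (fun z => v z - a * ‖w.1 - z.1‖ ^ 2 - b * (w.2 - z.2) ^ 2) K := by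
      fun_prop
    obtain ⟨w', hw', hmax⟩ := hK.exists_isMaxOn hne hc
    exact ⟨w', hw', fun z hz => hmax hz⟩
  choose P hP hPmax using h
  exact ⟨fun w => v (P w) - a * ‖w.1 - (P w).1‖ ^ 2 - b * (w.2 - (P w).2) ^ 2,
    fun w w' hw' => hPmax w w' hw', fun w => ⟨P w, hP w, rfl⟩⟩

/-- A sup-convolution is semiconvex. -/
lemma IsSupConv.exists_lower_support {H : Type*} [NormedAddCommGroup H] [InnerProductSpace ℝ H]
    {K : Set (H × ℝ)} {a b : ℝ} {v f : H × ℝ → ℝ} (hf : IsSupConv K a b v f) (w : H × ℝ) :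
    ∃ ξ : H × ℝ →L[ℝ] ℝ, ∀ z,
      f w + ξ (z - w) - (a * ‖z.1 - w.1‖ ^ 2 + b * (z.2 - w.2) ^ 2) ≤ f z := by
  obtain ⟨w', hw', h⟩ := hf.2 w
  refine ⟨(-2 * a) • (innerSL ℝ (w.1 - w'.1)).comp (ContinuousLinearMap.fst ℝ H ℝ) +
    (-2 * b * (w.2 - w'.2)) • ContinuousLinearMap.snd ℝ H ℝ, fun z => ?_⟩
  have h1 := hf.1 z w' hw'
  have e : ‖z.1 - w'.1‖ ^ 2 = ‖w.1 - w'.1‖ ^ 2 + 2 * ⟪w.1 - w'.1, z.1 - w.1⟫ + ‖z.1 - w.1‖ ^ 2 := by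
    rw [← norm_add_sq_real]; congr 2; abel
  rw [e] at h1
  refine le_trans (le_of_eq ?_) h1
  rw [h]
  simp only [add_apply, smul_apply, ContinuousLinearMap.comp_apply, innerSL_apply_apply,
    ContinuousLinearMap.coe_fst', ContinuousLinearMap.coe_snd', Prod.fst_sub, Prod.snd_sub,
    smul_eq_mul]
  ring

/-- The second-order behaviour of `f` at `w` along lines in space, and the first-order behaviour in
time, are given by the gradient `p`, the Hessian `X` and the time derivative `b`. -/
def HasParabolicJet {n : ℕ} (f : EuclideanSpace ℝ (Fin n) × ℝ → ℝ) (w : EuclideanSpace ℝ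
    (Fin n) × ℝ) (p : EuclideanSpace ℝ (Fin n)) (b : ℝ)
    (X : Matrix (Fin n) (Fin n) ℝ) : Prop :=
  (∀ a : EuclideanSpace ℝ (Fin n), (fun r : ℝ => f (w + (r • a, 0)) - f w - r * ⟪p, a⟫ -
    1 / 2 * r ^ 2 * ⟪X.toEuclideanLin a, a⟫) =o[𝓝 0] fun r => r ^ 2) ∧
  HasDerivAt (fun τ : ℝ => f (w + (0, τ))) b 0

/-- At almost every point, the sup-convolution of a viscosity subsolution has a parabolic jet
satisfying the differential inequality at the optimal point. -/
lemma IsViscositySubsoln.ae_jet_supConv {n : ℕ} {Ω : Set (EuclideanSpace ℝ (Fin n))} {T T' : ℝ}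
    (hΩ : IsOpen Ω)
    (hT : T' < T) {A : EuclideanSpace ℝ (Fin n) → ℝ → Matrix (Fin n) (Fin n) ℝ}
        {v f : EuclideanSpace ℝ (Fin n) × ℝ → ℝ}
    (hv : IsViscositySubsoln n Ω T (fun _ p X t => (A p t * X).trace) v) {a b : ℝ} (ha : 0 ≤ a)
    (hb : 0 ≤ b) (hf : IsSupConv (closure Ω ×ˢ Icc 0 T') a b v f)
    (μ : Measure (EuclideanSpace ℝ (Fin n) × ℝ)) [μ.IsAddHaarMeasure] :
    ∀ᵐ w ∂μ, ∀ w' : EuclideanSpace ℝ (Fin n) × ℝ, w'.1 ∈ Ω → w'.2 ∈ Ioo 0 T' →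
      f w = v w' - a * ‖w.1 - w'.1‖ ^ 2 - b * (w.2 - w'.2) ^ 2 →
      ∃ p c X, HasParabolicJet f w p c X ∧ X.IsHermitian ∧
        (∀ k : EuclideanSpace ℝ (Fin n), - (2 * a) * ‖k‖ ^ 2 ≤ ⟪X.toEuclideanLin k, k⟫) ∧
        c ≤ (A p w'.2 * X).trace := by
  have hsemi : ∀ x, ∃ ξ : EuclideanSpace ℝ (Fin n) × ℝ →L[ℝ] ℝ, ∀ z, f x + ξ (z - x) -
      (a + b) * ‖z - x‖ ^ 2 ≤ f z := by
    intro x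
    obtain ⟨ξ, hξ⟩ := hf.exists_lower_support x
    refine ⟨ξ, fun z => le_trans ?_ (hξ z)⟩
    have h1 : ‖z.1 - x.1‖ ≤ ‖z - x‖ := norm_fst_le (z - x)
    have h2 : ‖z.2 - x.2‖ ≤ ‖z - x‖ := norm_snd_le (z - x)
    have h3 : ‖z.1 - x.1‖ ^ 2 ≤ ‖z - x‖ ^ 2 := by gcongr
    have h4 : (z.2 - x.2) ^ 2 ≤ ‖z - x‖ ^ 2 := by
      rw [← sq_abs, ← Real.norm_eq_abs]; gcongr
    nlinarith
  filter_upwards [ae_quadratic_expansion_of_semiconvex μ (add_nonneg ha hb) hsemi] with w hw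
  intro w' hw'1 hw'2 hfw
  obtain ⟨ξ, B, hB⟩ := hw
  have hjet : ∀ η > 0, ∀ᶠ h in 𝓝 0, v (w' + h) ≤ v w' + ξ h + 1 / 2 * B h h + η * ‖h‖ ^ 2 := by
    intro η hη
    have hin : ∀ᶠ h in 𝓝 (0 : EuclideanSpace ℝ (Fin n) × ℝ), w' + h ∈ Ω ×ˢ Ioo 0 T' := by
      have hc : Continuous fun h : EuclideanSpace ℝ (Fin n) × ℝ => w' + h := by fun_prop
      refine hc.continuousAt.eventually_mem ((hΩ.prod isOpen_Ioo).mem_nhds ?_)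
      rw [add_zero]; exact ⟨hw'1, hw'2⟩
    filter_upwards [hin, hB.def hη] with h h1 h2
    have h3 := hf.1 (w + h) (w' + h) ⟨subset_closure h1.1, Ioo_subset_Icc_self h1.2⟩
    simp only [Prod.fst_add, Prod.snd_add, add_sub_add_right_eq_sub] at h3
    rw [Real.norm_eq_abs, norm_pow, norm_norm] at h2
    have h4 := le_of_abs_le h2
    linarith
  obtain ⟨p, X, hp, hX, hXB, hle⟩ := hv.le_trace_of_expansion hw'1
    ⟨hw'2.1, hw'2.2.trans hT⟩ hjet
  have hBs : ∀ (r : ℝ) (h k : EuclideanSpace ℝ (Fin n) × ℝ), B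
      (r • h) k = r * B h k := fun r h k => by
    rw [map_smul]; rfl
  have hline : ∀ k : EuclideanSpace ℝ (Fin n), (fun r : ℝ => f (w + (r • k, 0)) - f w - r * ⟪p, k⟫ -
      1 / 2 * r ^ 2 * ⟪X.toEuclideanLin k, k⟫) =o[𝓝 0] fun r => r ^ 2 := by
    intro k
    have ht : Tendsto (fun r : ℝ => (r • k, (0 : ℝ))) (𝓝 0) (𝓝 0) := by
      have hc : Continuous fun r : ℝ => (r • k, (0 : ℝ)) := by fun_prop
      exact hc.tendsto' 0 0 (by simp)
    have hO : ((fun h : EuclideanSpace ℝ (Fin n) × ℝ => ‖h‖ ^ 2) ∘ fun r : ℝ => (r • k,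
        (0 : ℝ))) =O[𝓝 0]
        fun r => r ^ 2 := by
      refine IsBigO.of_bound (‖k‖ ^ 2) (Eventually.of_forall fun r => ?_)
      have e : ‖(r • k, (0 : ℝ))‖ = |r| * ‖k‖ := by
        rw [Prod.norm_mk, norm_zero, norm_smul, Real.norm_eq_abs]
        exact max_eq_left (by positivity)
      simp only [Function.comp_apply]
      rw [e, mul_pow, sq_abs, norm_mul, norm_pow, norm_pow, norm_norm, Real.norm_eq_abs, sq_abs]
      simp [mul_comm]
    refine ((hB.comp_tendsto ht).trans_isBigO hO).congr_left fun r => ?_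
    have e : (r • k, (0 : ℝ)) = r • (k, (0 : ℝ)) := by simp
    simp only [Function.comp_apply]
    rw [hp, hXB, e, map_smul, hBs, map_smul]
    simp only [smul_eq_mul]
    ring
  refine ⟨p, ξ (0, 1), X, ⟨hline, ?_⟩, hX, fun k => ?_, hle⟩
  · rw [hasDerivAt_iff_isLittleO_nhds_zero]
    have ht : Tendsto (fun τ : ℝ => ((0 : EuclideanSpace ℝ (Fin n)), τ)) (𝓝 0) (𝓝 0) := by
      have hc : Continuous fun τ : ℝ => ((0 : EuclideanSpace ℝ (Fin n)), τ) := by fun_prop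
      exact hc.tendsto' 0 0 rfl
    have hO : ((fun h : EuclideanSpace ℝ (Fin n) × ℝ => ‖h‖ ^ 2) ∘ fun τ : ℝ =>
        ((0 : EuclideanSpace ℝ (Fin n)), τ)) =o[𝓝 0] fun τ => τ := by
      have h1 : ((fun h : EuclideanSpace ℝ (Fin n) × ℝ => ‖h‖ ^ 2) ∘ fun τ : ℝ =>
          ((0 : EuclideanSpace ℝ (Fin n)), τ)) = fun τ => τ ^ 2 := by
        funext τ; simp
      rw [h1]
      exact isLittleO_pow_id one_lt_two
    have h2 : (fun τ : ℝ => 1 / 2 * τ ^ 2 * B (0, 1) (0, 1)) =o[𝓝 0] fun τ => τ := by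
      have := (isLittleO_pow_id (𝕜 := ℝ) one_lt_two).const_mul_left (1 / 2 * B (0, 1) (0, 1))
      exact this.congr_left fun τ => by ring
    have h1 := (hB.comp_tendsto ht).isBigO.trans_isLittleO hO
    refine (h1.add h2).congr_left fun τ => ?_
    have e : ((0 : EuclideanSpace ℝ (Fin n)), τ) = τ • ((0 : EuclideanSpace ℝ (Fin n)),
        (1 : ℝ)) := by simp
    simp only [Function.comp_apply]
    rw [e, map_smul, hBs, map_smul]
    simp only [smul_eq_mul, zero_add]
    rw [show ((0 : EuclideanSpace ℝ (Fin n)), (0 : ℝ)) = 0 from rfl, add_zero, ← e]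
    ring
  · obtain ⟨ζ, hζ⟩ := hf.exists_lower_support w
    have h1 := (hline k).add ((hline (-k)))
    refine le_of_forall_pos_le_add fun η hη => ?_
    have h2 := h1.def (half_pos hη)
    obtain ⟨r, hr, hr0⟩ := ((h2.filter_mono nhdsWithin_le_nhds).and
      (eventually_mem_nhdsWithin (s := Ioi (0 : ℝ)) (a := (0 : ℝ)))).exists
    have hr0 : 0 < r := hr0
    have a1 := hζ (w + (r • k, 0))
    have a2 := hζ (w + (r • -k, 0))
    rw [Real.norm_eq_abs, norm_pow, Real.norm_eq_abs, sq_abs] at hr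
    have hr := le_of_abs_le hr
    have e : ((r • -k, 0) : EuclideanSpace ℝ (Fin n) × ℝ) = - (r • k, 0) := by simp
    rw [add_sub_cancel_left] at a1 a2
    rw [e, map_neg] at a2
    rw [e] at hr
    simp only [Prod.fst_add, Prod.snd_add, Prod.fst_neg, Prod.snd_neg, add_sub_cancel_left,
      norm_neg, norm_smul, mul_pow, Real.norm_eq_abs, sq_abs, neg_zero, inner_neg_right, map_neg,
      inner_neg_left, neg_neg] at a1 a2 hr
    have h5 : 0 ≤ r ^ 2 * (⟪X.toEuclideanLin k, k⟫ + η - - (2 * a) * ‖k‖ ^ 2) := by nlinarith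
    nlinarith [nonneg_of_mul_nonneg_right h5 (by positivity)]

/-- A concave function lies below its tangents. -/
lemma ConcaveOn.le_tangent {c : ℝ → ℝ} {S : Set ℝ} (hc : ConcaveOn ℝ S c) {g s₀ : ℝ} (hs₀ : s₀ ∈ S)
    (hg : HasDerivWithinAt c g S s₀) {s : ℝ} (hs : s ∈ S) : c s ≤ c s₀ + g * (s - s₀) := by
  rcases lt_trichotomy s s₀ with h | rfl | h
  · have := hc.le_slope_of_hasDerivWithinAt hs hs₀ h hg
    rw [slope_def_field, le_div_iff₀ (by linarith)] at this
    linarith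
  · simp
  · have := hc.slope_le_of_hasDerivWithinAt hs₀ hs h hg
    rw [slope_def_field, div_le_iff₀ (by linarith)] at this
    linarith

/-- A positive increasing function that is small at `t₀` and large at `t₁`. -/
lemma exists_exp_penalty {t₀ t₁ d : ℝ} (hd : 0 < d) (ht : t₀ < t₁) (M : ℝ) :
    ∃ (m m' : ℝ → ℝ) (μ : ℝ), 0 < μ ∧ (∀ t, HasDerivAt m (m' t) t) ∧ Continuous m' ∧
      (∀ t ≥ 0, μ ≤ m' t) ∧ (∀ t, 0 < m t) ∧ m t₀ < d ∧ M < m t₁ := by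
  set k := 2 * (|M| + 1) / (d * (t₁ - t₀)) with hk
  have h1 : 0 < t₁ - t₀ := sub_pos.2 ht
  have hk0 : 0 < k := by positivity
  refine ⟨fun t => d / 2 * Real.exp (k * (t - t₀)), fun t => d / 2 * (Real.exp (k * (t - t₀)) * k),
    d / 2 * (Real.exp (k * (0 - t₀)) * k), by positivity, fun t => ?_, by fun_prop, fun t ht => ?_,
    fun t => by positivity, ?_, ?_⟩
  · have h2 : HasDerivAt (fun t => k * (t - t₀)) k t := by
      simpa using ((hasDerivAt_id t).sub_const t₀).const_mul k
    exact h2.exp.const_mul _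
  · have h2 : k * (0 - t₀) ≤ k * (t - t₀) := by gcongr
    exact mul_le_mul_of_nonneg_left (mul_le_mul_of_nonneg_right (Real.exp_le_exp.2 h2) hk0.le)
      (by positivity)
  · simp; linarith
  · have h2 := Real.add_one_le_exp (k * (t₁ - t₀))
    have h3 : d / 2 * (k * (t₁ - t₀)) = |M| + 1 := by
      rw [hk]; field_simp
    have h4 : d / 2 * (k * (t₁ - t₀) + 1) ≤ d / 2 * Real.exp (k * (t₁ - t₀)) := by gcongr
    have h5 := le_abs_self M
    simp only
    linarith

/-- Comparison of a viscosity subsolution with an affine function. -/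
lemma IsViscositySubsoln.le_affine {n : ℕ} {Ω : Set (EuclideanSpace ℝ (Fin n))} {T : ℝ}
    {A : EuclideanSpace ℝ (Fin n) → ℝ → Matrix (Fin n) (Fin n) ℝ} {v : EuclideanSpace ℝ
        (Fin n) × ℝ → ℝ} (hΩ : IsOpen Ω)
    (hb : Bornology.IsBounded Ω)
    (hv : IsViscositySubsoln n Ω T (fun _ p X t => (A p t * X).trace) v)
    (hvc : ContinuousOn v (closure Ω ×ˢ Ico 0 T)) {k : EuclideanSpace ℝ (Fin n)} {a : ℝ}
    (h0 : ∀ x ∈ closure Ω, v (x, 0) ≤ ⟪k, x⟫ + a)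
    (hfr : ∀ x ∈ frontier Ω, ∀ t ∈ Ioo 0 T, v (x, t) ≤ ⟪k, x⟫ + a) :
    ∀ x ∈ closure Ω, ∀ t ∈ Ico 0 T, v (x, t) ≤ ⟪k, x⟫ + a := by
  intro xs hxs ts hts
  by_contra! hlt
  obtain ⟨T', hT1, hT2⟩ := exists_between hts.2
  have hK : IsCompact (closure Ω ×ˢ Icc 0 T') := hb.isCompact_closure.prod isCompact_Icc
  have hKs : closure Ω ×ˢ Icc 0 T' ⊆ closure Ω ×ˢ Ico 0 T :=
    prod_mono_right fun t ht => ⟨ht.1, ht.2.trans_lt hT2⟩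
  have hℓ : Continuous fun w : EuclideanSpace ℝ (Fin n) × ℝ => ⟪k, w.1⟫ + a := by fun_prop
  obtain ⟨M, hM⟩ := hK.bddAbove_image ((hvc.mono hKs).sub hℓ.continuousOn)
  obtain ⟨m, m', μ, hμ, hm, hm'c, hm', hmpos, hmt, hmT⟩ :=
    exists_exp_penalty (sub_pos.2 hlt) hT1 M
  have hmc : Continuous m := continuous_iff_continuousAt.2 fun t => (hm t).continuousAt
  obtain ⟨⟨x, t⟩, hxt, hmax⟩ := hK.exists_isMaxOn ⟨(xs, ts), hxs, hts.1, hT1.le⟩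
    ((hvc.mono hKs).sub (hℓ.add (hmc.comp continuous_snd)).continuousOn)
  have hpos : 0 < v (x, t) - (⟪k, x⟫ + a + m t) := by
    have := hmax (show (xs, ts) ∈ _ from ⟨hxs, hts.1, hT1.le⟩)
    simp only [Pi.sub_apply, Pi.add_apply, Function.comp_apply, mem_ofPred_eq] at this
    linarith
  have ht0 : 0 < t := by
    refine hxt.2.1.lt_of_ne fun (h : 0 = t) => ?_
    have := h0 x hxt.1
    have := hmpos t
    rw [← h] at hpos this
    linarith
  have htT : t < T' := by
    refine hxt.2.2.lt_of_ne fun (h : t = T') => ?_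
    have := hM (mem_image_of_mem _ hxt)
    simp only [Pi.sub_apply] at this
    rw [h] at hpos this
    linarith
  have hx : x ∈ Ω := by
    by_contra hx
    have := hfr x ⟨hxt.1, by rwa [hΩ.interior_eq]⟩ t ⟨ht0, htT.trans hT2⟩
    have := hmpos t
    linarith
  have hloc : IsLocalMax (fun w : EuclideanSpace ℝ (Fin n) × ℝ => v w - (⟪k, w.1⟫ + a + m w.2))
      (x, t) :=
    hmax.isLocalMax (prod_mem_nhds (mem_of_superset (hΩ.mem_nhds hx) subset_closure)
      (Icc_mem_nhds ht0 htT))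
  have h := hv _ (fun w => m' w.2) (fun _ => k) (fun _ => 0) ⟨fun w _ => ?_, fun w _ => ?_,
    fun w _ => ?_, (hm'c.comp continuous_snd).continuousOn, continuousOn_const,
    continuousOn_const⟩ x t hx ⟨ht0, htT.trans hT2⟩ hloc
  · simp only [mul_zero, Matrix.trace_zero] at h
    linarith [hm' t ht0.le]
  · exact (hm w.2).const_add (⟪k, w.1⟫ + a)
  · rw [hasGradientAt_iff_hasFDerivAt]
    have h1 : HasFDerivAt (fun x : EuclideanSpace ℝ (Fin n) => ⟪k, x⟫) (InnerProductSpace.toDual ℝ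
        (EuclideanSpace ℝ (Fin n)) k) w.1 :=
      (InnerProductSpace.toDual ℝ (EuclideanSpace ℝ (Fin n)) k).hasFDerivAt
    exact (h1.add_const a).add_const (m w.2)
  · simpa using hasFDerivAt_const k w.1

/-- A segment from a point of the closure of a set to a point outside the set meets its
frontier. -/
lemma exists_frontier_mem_segment {H : Type*} [AddCommGroup H] [Module ℝ H] [TopologicalSpace H]
    [ContinuousAdd H] [ContinuousSMul ℝ H] {Ω : Set H} {x y : H} (hx : x ∈ closure Ω)
    (hy : y ∉ Ω) : ∃ z ∈ segment ℝ x y, z ∈ frontier Ω := by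
  by_contra! h
  have h1 : segment ℝ x y ⊆ interior Ω :=
    (convex_segment x y).isPreconnected.subset_left_of_subset_union isOpen_interior
      isClosed_closure.isOpen_compl
      (disjoint_compl_right.mono_left (interior_subset.trans subset_closure))
      (fun z hz => or_iff_not_imp_left.2 fun hzi hzc => h z hz ⟨hzc, hzi⟩)
      ⟨x, left_mem_segment ℝ x y, by
        by_contra hxi
        exact h x (left_mem_segment ℝ x y) ⟨hx, hxi⟩⟩
  exact hy (interior_subset (h1 (right_mem_segment ℝ x y)))

/-- A convex open set has an inner unit normal at every point of its frontier. -/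
lemma Convex.exists_unit_normal {H : Type*} [NormedAddCommGroup H] [InnerProductSpace ℝ H]
    [CompleteSpace H] {Ω : Set H} (hΩ : IsOpen Ω) (hc : Convex ℝ Ω) {y : H} (hy : y ∈ frontier Ω) :
    ∃ ν : H, ‖ν‖ = 1 ∧ (∀ z ∈ Ω, 0 < ⟪ν, z - y⟫) ∧ ∀ z ∈ closure Ω, 0 ≤ ⟪ν, z - y⟫ := by
  have hyn : y ∉ Ω := by
    have := hy.2
    rwa [hΩ.interior_eq] at this
  obtain ⟨f, hf⟩ := geometric_hahn_banach_point_open hc hΩ hyn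
  set ξ := (InnerProductSpace.toDual ℝ H).symm f with hξ
  have hi : ∀ z, ⟪ξ, z⟫ = f z := fun z => InnerProductSpace.toDual_symm_apply
  obtain ⟨z₀, hz₀⟩ : Ω.Nonempty := closure_nonempty_iff.1 ⟨y, hy.1⟩
  have hξ0 : ξ ≠ 0 := by
    intro h
    have h1 := hf z₀ hz₀
    rw [← hi, ← hi, h, inner_zero_left, inner_zero_left] at h1
    exact lt_irrefl _ h1
  have h1 : ∀ z ∈ Ω, 0 < ⟪‖ξ‖⁻¹ • ξ, z - y⟫ := by
    intro z hz
    rw [real_inner_smul_left, inner_sub_right, hi, hi]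
    exact mul_pos (inv_pos.2 (norm_pos_iff.2 hξ0)) (sub_pos.2 (hf z hz))
  refine ⟨‖ξ‖⁻¹ • ξ, norm_smul_inv_norm hξ0, h1, fun z hz => ?_⟩
  have hcl : IsClosed {z | 0 ≤ ⟪‖ξ‖⁻¹ • ξ, z - y⟫} := isClosed_le (by fun_prop) (by fun_prop)
  exact closure_minimal (fun z hz => (h1 z hz).le) hcl hz

/-- A subsolution vanishing on the lateral boundary of a convex domain is bounded near the boundary
by any concave modulus of continuity of its initial values. -/
lemma IsViscositySubsoln.le_modulus_of_mem_frontier {n : ℕ} {Ω : Set (EuclideanSpace ℝ (Fin n))}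
    {T : ℝ}
    {A : EuclideanSpace ℝ (Fin n) → ℝ → Matrix (Fin n) (Fin n) ℝ} {v : EuclideanSpace ℝ
        (Fin n) × ℝ → ℝ} (hΩ : IsOpen Ω)
    (hb : Bornology.IsBounded Ω) (hΩc : Convex ℝ Ω) (hT : 0 < T)
    (hv : IsViscositySubsoln n Ω T (fun _ p X t => (A p t * X).trace) v)
    (hvc : ContinuousOn v (closure Ω ×ˢ Ico 0 T))
    (hfr : ∀ x ∈ frontier Ω, ∀ t ∈ Ioo 0 T, v (x, t) = 0) {c : ℝ → ℝ}
    (hc : ConcaveOn ℝ (Ici 0) c) (hmono : MonotoneOn c (Ici 0))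
    (hdiff : ∀ s ∈ Ici (0 : ℝ), ∃ g, HasDerivWithinAt c g (Ici 0) s)
    (h0 : ∀ x ∈ closure Ω, ∀ y ∈ closure Ω, v (x, 0) - v (y, 0) ≤ c ‖x - y‖) :
    ∀ y ∈ frontier Ω, ∀ x ∈ closure Ω, ∀ t ∈ Ico 0 T, v (x, t) ≤ c ‖x - y‖ := by
  intro y hy x hx t ht
  obtain ⟨ν, hν, hνo, hνc⟩ := hΩc.exists_unit_normal hΩ hy
  obtain ⟨g, hg⟩ := hdiff ⟪ν, x - y⟫ (hνc x hx)
  have htan : ∀ z ∈ closure Ω, c ⟪ν, z - y⟫ ≤ c ⟪ν, x - y⟫ + g * (⟪ν, z - y⟫ - ⟪ν, x - y⟫) :=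
    fun z hz => hc.le_tangent (hνc x hx) hg (hνc z hz)
  have hc0 : 0 ≤ c 0 := by
    have := h0 x hx x hx
    simpa using this
  have hcnn : ∀ s ≥ 0, 0 ≤ c s := fun s hs => hc0.trans (hmono self_mem_Ici hs hs)
  have hfr0 : ∀ z ∈ frontier Ω, v (z, 0) = 0 := by
    intro z hz
    have h1 : ContinuousWithinAt (fun t => v (z, t)) (Ioo 0 T) 0 := by
      refine (hvc (z, 0) ⟨hz.1, le_rfl, hT⟩).comp (by fun_prop) fun t ht => ?_
      exact ⟨hz.1, ht.1.le, ht.2⟩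
    have h2 : (𝓝[Ioo 0 T] (0 : ℝ)).NeBot := left_nhdsWithin_Ioo_neBot hT
    refine tendsto_nhds_unique h1 (tendsto_const_nhds.congr' ?_)
    filter_upwards [self_mem_nhdsWithin] with t ht
    exact (hfr z hz t ht).symm
  have haff : ∀ z, ⟪g • ν, z⟫ + (c ⟪ν, x - y⟫ - g * ⟪ν, x⟫) =
      c ⟪ν, x - y⟫ + g * (⟪ν, z - y⟫ - ⟪ν, x - y⟫) := by
    intro z
    rw [real_inner_smul_left, inner_sub_right ν z, inner_sub_right ν x]
    ring
  have h := hv.le_affine hΩ hb hvc (k := g • ν) (a := c ⟪ν, x - y⟫ - g * ⟪ν, x⟫)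
    (fun z hz => ?_) (fun z hz t ht => ?_) x hx t ht
  · rw [haff, sub_self, mul_zero, add_zero] at h
    refine h.trans (hmono (hνc x hx) (norm_nonneg _) ?_)
    simpa [hν] using real_inner_le_norm ν (x - y)
  · rw [haff]
    refine le_trans ?_ (htan z hz)
    have hout : z - ⟪ν, z - y⟫ • ν ∉ Ω := by
      intro hmem
      have h1 := hνo _ hmem
      rw [show z - ⟪ν, z - y⟫ • ν - y = (z - y) - ⟪ν, z - y⟫ • ν by abel, inner_sub_right,
        real_inner_smul_right, real_inner_self_eq_norm_sq, hν] at h1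
      simp at h1
    obtain ⟨z', hz', hz'f⟩ := exists_frontier_mem_segment hz hout
    have h1 := h0 z hz z' hz'f.1
    rw [hfr0 z' hz'f, sub_zero] at h1
    refine h1.trans (hmono (norm_nonneg _) (hνc z hz) ?_)
    have h2 := norm_sub_le_of_mem_segment hz'
    rw [norm_sub_rev]
    refine h2.trans ?_
    rw [sub_sub_cancel_left, norm_neg, norm_smul, hν, Real.norm_of_nonneg (hνc z hz), mul_one]
  · rw [hfr z hz t ht, haff]
    exact (hcnn _ (hνc z hz.1)).trans (htan z hz.1)

/-- Points that nearly realise a nonnegative value of `u + v - ψ` are interior, provided that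
`u + v < ψ` on the parabolic boundary and on the diagonal. -/
lemma exists_interior_radius {H : Type*} [NormedAddCommGroup H] {Ω : Set H} (hΩ : IsOpen Ω)
    (hc : IsCompact (closure Ω)) {T' : ℝ} {u v : H × ℝ → ℝ} {ψ : ℝ × ℝ → ℝ}
    (hu : ContinuousOn u (closure Ω ×ˢ Icc 0 T')) (hv : ContinuousOn v (closure Ω ×ˢ Icc 0 T'))
    (hψ : ContinuousOn ψ (Ici 0 ×ˢ Icc 0 T'))
    (hstrict : ∀ x ∈ closure Ω, ∀ y ∈ closure Ω, ∀ t ∈ Icc 0 T',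
      ψ (‖y - x‖, t) ≤ u (y, t) + v (x, t) → x ∈ Ω ∧ y ∈ Ω ∧ t ∈ Ioo 0 T' ∧ x ≠ y) :
    ∃ r > 0, ∀ w₁ ∈ closure Ω ×ˢ Icc 0 T', ∀ w₂ ∈ closure Ω ×ˢ Icc 0 T', ∀ t₃ ∈ Icc 0 T',
      ∀ x y t, ‖y - w₁.1‖ < r → ‖x - w₂.1‖ < r → |t - w₁.2| < r → |t - w₂.2| < r →
      |t - t₃| < r → ψ (‖y - x‖, t₃) - r < u w₁ + v w₂ →
      w₁.1 ∈ Ω ∧ w₂.1 ∈ Ω ∧ w₁.2 ∈ Ioo 0 T' ∧ w₂.2 ∈ Ioo 0 T' ∧ t₃ ∈ Ioo 0 T' ∧ r ≤ ‖y - x‖ := by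
  by_contra! hcon
  set ρ : ℕ → ℝ := fun k => 1 / ((k : ℝ) + 1) with hρ
  have hρ0 : Tendsto ρ atTop (𝓝 0) := tendsto_one_div_add_atTop_nhds_zero_nat
  have hρpos : ∀ k, 0 < ρ k := fun k => by positivity
  choose w₁ hw₁ w₂ hw₂ t₃ ht₃ x y t h1 h2 h3 h4 h5 h6 h7 using fun k => hcon (ρ k) (hρpos k)
  have hK : IsCompact (closure Ω ×ˢ Icc 0 T') := hc.prod isCompact_Icc
  obtain ⟨⟨⟨yb, tb⟩, ⟨xb, tb₂⟩, tb₃⟩, ⟨hb1, hb2, hb3⟩, σ, hσ, hlim⟩ :=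
    (hK.prod (hK.prod isCompact_Icc)).tendsto_subseq
      (x := fun k => (w₁ k, w₂ k, t₃ k)) fun k => ⟨hw₁ k, hw₂ k, ht₃ k⟩
  have hρσ : Tendsto (fun k => ρ (σ k)) atTop (𝓝 0) := hρ0.comp hσ.tendsto_atTop
  have l1 : Tendsto (fun k => w₁ (σ k)) atTop (𝓝 (yb, tb)) := (continuous_fst.tendsto _).comp hlim
  have l2 : Tendsto (fun k => w₂ (σ k)) atTop (𝓝 (xb, tb₂)) :=
    ((continuous_fst.comp continuous_snd).tendsto _).comp hlim
  have l3 : Tendsto (fun k => t₃ (σ k)) atTop (𝓝 tb₃) :=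
    ((continuous_snd.comp continuous_snd).tendsto _).comp hlim
  have l1a := (continuous_fst.tendsto _).comp l1
  have l1b := (continuous_snd.tendsto _).comp l1
  have l2a := (continuous_fst.tendsto _).comp l2
  have l2b := (continuous_snd.tendsto _).comp l2
  have ly : Tendsto (fun k => y (σ k)) atTop (𝓝 yb) := by
    have : Tendsto (fun k => y (σ k) - (w₁ (σ k)).1) atTop (𝓝 0) :=
      squeeze_zero_norm (fun k => (h1 (σ k)).le) hρσ
    simpa using this.add l1a
  have lx : Tendsto (fun k => x (σ k)) atTop (𝓝 xb) := by
    have : Tendsto (fun k => x (σ k) - (w₂ (σ k)).1) atTop (𝓝 0) :=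
      squeeze_zero_norm (fun k => (h2 (σ k)).le) hρσ
    simpa using this.add l2a
  have lt : Tendsto (fun k => t (σ k)) atTop (𝓝 tb) := by
    have : Tendsto (fun k => t (σ k) - (w₁ (σ k)).2) atTop (𝓝 0) :=
      squeeze_zero_norm (fun k => (h3 (σ k)).le) hρσ
    simpa using this.add l1b
  have e2 : tb₂ = tb := by
    have : Tendsto (fun k => t (σ k) - (w₂ (σ k)).2) atTop (𝓝 0) :=
      squeeze_zero_norm (fun k => (h4 (σ k)).le) hρσ
    exact (sub_eq_zero.1 (tendsto_nhds_unique (lt.sub l2b) this)).symm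
  have e3 : tb₃ = tb := by
    have : Tendsto (fun k => t (σ k) - t₃ (σ k)) atTop (𝓝 0) :=
      squeeze_zero_norm (fun k => (h5 (σ k)).le) hρσ
    exact (sub_eq_zero.1 (tendsto_nhds_unique (lt.sub l3) this)).symm
  subst e2 e3
  have lu : Tendsto (fun k => u (w₁ (σ k))) atTop (𝓝 (u (yb, tb₃))) :=
    (hu _ hb1).tendsto.comp (tendsto_nhdsWithin_iff.2 ⟨l1, Eventually.of_forall fun k => hw₁ _⟩)
  have lv : Tendsto (fun k => v (w₂ (σ k))) atTop (𝓝 (v (xb, tb₃))) :=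
    (hv _ hb2).tendsto.comp (tendsto_nhdsWithin_iff.2 ⟨l2, Eventually.of_forall fun k => hw₂ _⟩)
  have lψ : Tendsto (fun k => ψ (‖y (σ k) - x (σ k)‖, t₃ (σ k))) atTop
      (𝓝 (ψ (‖yb - xb‖, tb₃))) :=
    (hψ (‖yb - xb‖, tb₃) ⟨norm_nonneg _, hb3⟩).tendsto.comp (tendsto_nhdsWithin_iff.2
      ⟨(ly.sub lx).norm.prodMk_nhds l3, Eventually.of_forall fun k => ⟨norm_nonneg _, ht₃ _⟩⟩)
  have hle : ψ (‖yb - xb‖, tb₃) ≤ u (yb, tb₃) + v (xb, tb₃) := by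
    have := le_of_tendsto_of_tendsto' (lψ.sub hρσ) (lu.add lv) fun k => (h6 (σ k)).le
    simpa using this
  obtain ⟨g1, g2, g3, g4⟩ := hstrict xb hb2.1 yb hb1.1 tb₃ hb3 hle
  have hev : ∀ᶠ k in atTop, ρ (σ k) < ‖y (σ k) - x (σ k)‖ :=
    hρσ.eventually_lt (ly.sub lx).norm (norm_pos_iff.2 (sub_ne_zero.2 g4.symm))
  obtain ⟨k, k1, k2, k3, k4, k5, k6⟩ := ((l1a.eventually (hΩ.mem_nhds g2)).and
    ((l2a.eventually (hΩ.mem_nhds g1)).and ((l1b.eventually (isOpen_Ioo.mem_nhds g3)).and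
    ((l2b.eventually (isOpen_Ioo.mem_nhds g3)).and
    ((l3.eventually (isOpen_Ioo.mem_nhds g3)).and hev))))).exists
  exact (h7 (σ k) k1 k2 k3 k4 k5).not_ge k6.le

/-- The value at a maximum point of a penalised doubled function is close to the unpenalised
one. -/
lemma penalty_le_of_almost_max {C R D ρ δ : ℝ} (hR : 0 ≤ R) (hD : 0 ≤ D) (hδ0 : 0 ≤ δ)
    (hδ : δ ≤ 1) (h1 : D ≤ C + δ * ρ) (h2 : ρ ≤ R + √D) :
    D ≤ 2 * (C + R) + 1 ∧ ρ ≤ C + 2 * R + 1 := by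
  have h3 := Real.sq_sqrt hD
  have h4 := Real.sqrt_nonneg D
  have h5 : √D ≤ (1 + D) / 2 := by nlinarith [sq_nonneg (√D - 1)]
  have h6 : δ * ρ ≤ R + √D := by
    have : δ * ρ ≤ δ * (R + √D) := by gcongr
    nlinarith
  have h7 : D ≤ 2 * (C + R) + 1 := by linarith
  exact ⟨h7, by linarith⟩

/-- Linear upper bound with quadratic remainder for the norm. -/
lemma norm_le_norm_add_inner_add_sq {H : Type*} [NormedAddCommGroup H] [InnerProductSpace ℝ H]
    {z : H} (hz : z ≠ 0) (d : H) :
    ‖z + d‖ ≤ ‖z‖ + ⟪‖z‖⁻¹ • z, d⟫ + ‖d‖ ^ 2 / (2 * ‖z‖) := by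
  have hz0 : 0 < ‖z‖ := norm_pos_iff.2 hz
  have h1 := norm_add_sq_real z d
  have h2 : ‖z‖ * ‖z + d‖ ≤ ‖z‖ * (‖z‖ + ⟪‖z‖⁻¹ • z, d⟫ + ‖d‖ ^ 2 / (2 * ‖z‖)) := by
    rw [real_inner_smul_left]
    have h3 : ‖z‖ * (‖z‖ + ‖z‖⁻¹ * ⟪z, d⟫ + ‖d‖ ^ 2 / (2 * ‖z‖)) =
        ‖z‖ ^ 2 + ⟪z, d⟫ + ‖d‖ ^ 2 / 2 := by field_simp
    rw [h3]
    nlinarith [sq_nonneg (‖z + d‖ - ‖z‖)]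
  exact le_of_mul_le_mul_left h2 hz0

/-- A nondecreasing concave function of the norm is bounded above by a quadratic polynomial touching
it at a given nonzero point. -/
lemma ConcaveOn.comp_norm_le {H : Type*} [NormedAddCommGroup H] [InnerProductSpace ℝ H]
    {c : ℝ → ℝ} (hc : ConcaveOn ℝ (Ici 0) c) {g : ℝ} (hg0 : 0 ≤ g) {z : H} (hz : z ≠ 0)
    (hg : HasDerivWithinAt c g (Ici 0) ‖z‖) (d : H) :
    c ‖z + d‖ ≤ c ‖z‖ + g * ⟪‖z‖⁻¹ • z, d⟫ + g / (2 * ‖z‖) * ‖d‖ ^ 2 := by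
  have h1 := hc.le_tangent (norm_nonneg z) hg (norm_nonneg (z + d))
  have h2 := norm_le_norm_add_inner_add_sq hz d
  have h3 : g * (‖z + d‖ - ‖z‖) ≤ g * (⟪‖z‖⁻¹ • z, d⟫ + ‖d‖ ^ 2 / (2 * ‖z‖)) := by
    gcongr; linarith
  have h4 : g * (⟪‖z‖⁻¹ • z, d⟫ + ‖d‖ ^ 2 / (2 * ‖z‖)) =
    g * ⟪‖z‖⁻¹ • z, d⟫ + g / (2 * ‖z‖) * ‖d‖ ^ 2 := by ring
  linarith

open scoped MatrixOrder Matrix.Norms.L2Operator in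
/-- The trace of a product of two positive semidefinite matrices is nonnegative. -/
lemma Matrix.PosSemidef.trace_mul_nonneg {ι : Type*} [Fintype ι] [DecidableEq ι]
    {B N : Matrix ι ι ℝ} (hB : B.PosSemidef) (hN : N.PosSemidef) : 0 ≤ (B * N).trace := by
  obtain ⟨C, rfl⟩ := CStarAlgebra.nonneg_iff_eq_star_mul_self.1 hB.nonneg
  rw [mul_assoc, Matrix.trace_mul_comm, Matrix.star_eq_conjTranspose]
  exact (hN.mul_mul_conjTranspose_same C).trace_nonneg

lemma Matrix.inner_toEuclideanLin_self {n : ℕ} (X : Matrix (Fin n) (Fin n) ℝ) (w : EuclideanSpace ℝ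
    (Fin n)) :
    ⟪X.toEuclideanLin w, w⟫ = ∑ i, ∑ j, w i * X i j * w j := by
  simp only [PiLp.inner_apply, Matrix.toLpLin_apply, Matrix.mulVec, dotProduct,
    RCLike.inner_apply, conj_trivial, Finset.mul_sum]
  exact Finset.sum_congr rfl fun i _ => Finset.sum_congr rfl fun j _ => by ring

/-- If `A` dominates `α e eᵀ` and `Y ≤ 0`, then `tr (A Y) ≤ α ⟨Y e, e⟩`. -/
lemma Matrix.trace_mul_le_of_rank_one_le {n : ℕ} {A Y : Matrix (Fin n) (Fin n) ℝ}
    (hA : A.PosSemidef) (hY : Y.IsHermitian) (hY0 : ∀ w : EuclideanSpace ℝ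
        (Fin n), ⟪Y.toEuclideanLin w, w⟫ ≤ 0)
    {α : ℝ} {e : EuclideanSpace ℝ (Fin n)} (hα : ∀ w : EuclideanSpace ℝ
        (Fin n), α * ⟪w, e⟫ ^ 2 ≤ ⟪A.toEuclideanLin w, w⟫) :
    (A * Y).trace ≤ α * ⟪Y.toEuclideanLin e, e⟫ := by
  have hq : ∀ (M : Matrix (Fin n) (Fin n) ℝ) (x : Fin n → ℝ),
      star x ⬝ᵥ M.mulVec x = ⟪M.toEuclideanLin (WithLp.toLp 2 x), WithLp.toLp 2 x⟫ := by
    intro M x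
    rw [Matrix.inner_toEuclideanLin_self]
    simp only [Matrix.mulVec, dotProduct, Finset.mul_sum, star_trivial]
    exact Finset.sum_congr rfl fun i _ => Finset.sum_congr rfl fun j _ => by ring
  have hB : (A - α • Matrix.vecMulVec e e).PosSemidef := by
    refine .of_dotProduct_mulVec_nonneg (hA.1.sub ?_) fun x => ?_
    · refine Matrix.IsHermitian.ext fun i j => ?_
      simp [Matrix.vecMulVec_apply, mul_comm]
    · rw [hq]
      have h := hα (WithLp.toLp 2 x)
      rw [map_sub, map_smul, LinearMap.sub_apply, LinearMap.smul_apply, inner_sub_left,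
        real_inner_smul_left]
      have h2 : ⟪(Matrix.vecMulVec e e).toEuclideanLin (WithLp.toLp 2 x), WithLp.toLp 2 x⟫ =
          ⟪WithLp.toLp 2 x, e⟫ ^ 2 := by
        rw [Matrix.inner_toEuclideanLin_self, sq, PiLp.inner_apply, Finset.sum_mul_sum]
        refine Finset.sum_congr rfl fun i _ => Finset.sum_congr rfl fun j _ => ?_
        simp only [Matrix.vecMulVec_apply, RCLike.inner_apply, conj_trivial]
        ring
      rw [h2]; linarith
  have hN : (-Y).PosSemidef := by
    refine .of_dotProduct_mulVec_nonneg hY.neg fun x => ?_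
    rw [hq, map_neg, LinearMap.neg_apply, inner_neg_left]
    linarith [hY0 (WithLp.toLp 2 x)]
  have h := hB.trace_mul_nonneg hN
  have h3 : (Matrix.vecMulVec e e * Y).trace = ⟪Y.toEuclideanLin e, e⟫ := by
    rw [Matrix.inner_toEuclideanLin_self, Finset.sum_comm]
    simp only [Matrix.trace, Matrix.diag, Matrix.mul_apply, Matrix.vecMulVec_apply]
    exact Finset.sum_congr rfl fun i _ => Finset.sum_congr rfl fun j _ => by ring
  rw [mul_neg, Matrix.trace_neg, sub_mul, Matrix.trace_sub, Matrix.smul_mul, Matrix.trace_smul,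
    h3, smul_eq_mul] at h
  linarith

/-- The entries of a symmetric matrix are bounded by its quadratic form. -/
lemma Matrix.IsHermitian.abs_apply_le {n : ℕ} {X : Matrix (Fin n) (Fin n) ℝ} (hX : X.IsHermitian)
    {c : ℝ} (hc : ∀ k : EuclideanSpace ℝ (Fin n), |⟪X.toEuclideanLin k, k⟫| ≤ c * ‖k‖ ^ 2)
        (i j : Fin n) : |X i j| ≤ c := by
  have hs := Matrix.isSymmetric_toEuclideanLin_iff.2 hX
  set a : EuclideanSpace ℝ (Fin n) := EuclideanSpace.single i 1 with ha
  set b : EuclideanSpace ℝ (Fin n) := EuclideanSpace.single j 1 with hb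
  have hij : ⟪X.toEuclideanLin b, a⟫ = X i j := by
    simp [ha, hb, Matrix.toLpLin_apply, PiLp.inner_apply]
  have hn : ‖a + b‖ ^ 2 + ‖a - b‖ ^ 2 = 4 := by
    have := parallelogram_law_with_norm ℝ a b
    have h1 : ‖a‖ = 1 := by simp [ha]
    have h2 : ‖b‖ = 1 := by simp [hb]
    rw [h1, h2] at this
    nlinarith
  have h1 := hs a b
  rw [real_inner_comm] at h1
  have h2 : 4 * X i j = ⟪X.toEuclideanLin (a + b), a + b⟫ - ⟪X.toEuclideanLin (a - b), a - b⟫ := by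
    rw [← hij, map_add, map_sub]
    simp only [inner_add_left, inner_add_right, inner_sub_left, inner_sub_right]
    rw [real_inner_comm b, h1, real_inner_comm]
    ring
  have h3 := abs_le.1 (hc (a + b))
  have h4 := abs_le.1 (hc (a - b))
  rw [abs_le]
  constructor <;> nlinarith

/-- Perturbation bound for `tr (A X)` when the entries of `A` are perturbed. -/
lemma Matrix.trace_mul_le_of_abs_sub_le {n : ℕ} {A A₀ X : Matrix (Fin n) (Fin n) ℝ} {η c : ℝ}
    (hη : 0 ≤ η) (hA : ∀ i j, |A i j - A₀ i j| ≤ η) (hX : ∀ i j, |X i j| ≤ c) :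
    (A * X).trace ≤ (A₀ * X).trace + n ^ 2 * (η * c) := by
  have h : ((A - A₀) * X).trace ≤ ∑ _i : Fin n, ∑ _j : Fin n, η * c := by
    simp only [Matrix.trace, Matrix.diag, Matrix.mul_apply]
    refine Finset.sum_le_sum fun i _ => Finset.sum_le_sum fun j _ => ?_
    refine (le_abs_self _).trans ?_
    rw [abs_mul]
    exact mul_le_mul (hA i j) (hX j i) (abs_nonneg _) hη
  rw [sub_mul, Matrix.trace_sub] at h
  simp only [Finset.sum_const, Finset.card_univ, Fintype.card_fin, nsmul_eq_mul] at h
  linarith [h]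

/-- Symmetric second differences of a twice differentiable function. -/
lemma isLittleO_second_difference {c c' : ℝ → ℝ} {s κ : ℝ} (hc : ∀ᶠ σ in 𝓝 s, HasDerivAt c (c' σ) σ)
    (hc' : HasDerivAt c' κ s) :
    (fun ρ => c (s + ρ) + c (s - ρ) - 2 * c s - ρ ^ 2 * κ) =o[𝓝 0] fun ρ => ρ ^ 2 := by
  have hplus : Tendsto (fun ρ : ℝ => s + ρ) (𝓝 0) (𝓝 s) := by
    have h : Continuous fun ρ : ℝ => s + ρ := by fun_prop
    simpa using h.tendsto 0
  have hminus : Tendsto (fun ρ : ℝ => s - ρ) (𝓝 0) (𝓝 s) := by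
    have h : Continuous fun ρ : ℝ => s - ρ := by fun_prop
    simpa using h.tendsto 0
  have hd : ∀ᶠ ρ in 𝓝 (0 : ℝ), HasDerivAt (fun ρ => c (s + ρ) + c (s - ρ) - 2 * c s - ρ ^ 2 * κ)
      (c' (s + ρ) - c' (s - ρ) - 2 * ρ * κ) ρ := by
    filter_upwards [hplus.eventually hc, hminus.eventually hc] with ρ h1 h2
    have h3 := h1.comp_const_add s ρ
    have h4 := h2.comp_const_sub s ρ
    have h5 : HasDerivAt (fun ρ : ℝ => ρ ^ 2 * κ) (2 * ρ * κ) ρ := by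
      simpa using (hasDerivAt_pow 2 ρ).mul_const κ
    exact ((h3.add h4).sub_const (2 * c s)).sub h5
  have hd' : (fun ρ => c' (s + ρ) - c' (s - ρ) - 2 * ρ * κ) =o[𝓝 0] fun ρ => ρ := by
    have h1 := hc'.isLittleO.comp_tendsto hplus
    have h2 := hc'.isLittleO.comp_tendsto hminus
    have h1' : (fun ρ => c' (s + ρ) - c' s - ρ * κ) =o[𝓝 0] fun ρ : ℝ => ρ := by
      simpa [Function.comp_def] using h1
    have h2' : (fun ρ => c' (s - ρ) - c' s - -(ρ * κ)) =o[𝓝 0] fun ρ : ℝ => ρ := by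
      refine IsLittleO.of_neg_right ?_
      simpa [Function.comp_def] using h2
    exact (h1'.sub h2').congr_left fun ρ => by ring
  rw [isLittleO_iff] at hd' ⊢
  intro ε hε
  obtain ⟨r, hr, hball⟩ := Metric.eventually_nhds_iff_ball.1 (hd.and (hd' hε))
  filter_upwards [Metric.ball_mem_nhds 0 hr] with ρ hρ
  have hsub : Icc (-|ρ|) |ρ| ⊆ Metric.ball 0 r := by
    intro τ hτ
    rw [mem_ball_zero_iff] at hρ ⊢
    exact (abs_le.2 hτ).trans_lt hρ
  have h := (convex_Icc (-|ρ|) |ρ|).norm_image_sub_le_of_norm_hasDerivWithin_le (C := ε * |ρ|)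
    (x := 0) (y := ρ) (fun τ hτ => (hball τ (hsub hτ)).1.hasDerivWithinAt)
    (fun τ hτ => (hball τ (hsub hτ)).2.trans ?_) (by simp) ⟨neg_abs_le ρ, le_abs_self ρ⟩
  · have e : c (s + 0) + c (s - 0) - 2 * c s - 0 ^ 2 * κ = 0 := by
      rw [add_zero, sub_zero]; ring
    rw [e, sub_zero, sub_zero] at h
    rw [norm_pow, Real.norm_eq_abs ρ]
    rw [Real.norm_eq_abs ρ] at h
    linarith
  · rw [Real.norm_eq_abs]
    exact mul_le_mul_of_nonneg_left (abs_le.2 hτ) hε.le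

/-- Comparison of second-order coefficients at a point. -/
lemma le_of_second_order_le {F G Q : ℝ → ℝ} {p p' X X' κ : ℝ}
    (hF : (fun r => F r - F 0 - r * p - 1 / 2 * r ^ 2 * X) =o[𝓝 0] fun r => r ^ 2)
    (hG : (fun r => G r - G 0 - r * p' - 1 / 2 * r ^ 2 * X') =o[𝓝 0] fun r => r ^ 2)
    (hQ : (fun r => Q r - r ^ 2 * κ) =o[𝓝 0] fun r => r ^ 2)
    (hle : ∀ᶠ r in 𝓝 0, F r + F (-r) + G r + G (-r) - 2 * F 0 - 2 * G 0 ≤ Q r) :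
    X + X' ≤ κ := by
  have hneg : Tendsto (fun r : ℝ => -r) (𝓝 0) (𝓝 0) := by
    simpa using (continuous_neg : Continuous fun r : ℝ => -r).tendsto 0
  have hF' := hF.comp_tendsto hneg
  have hG' := hG.comp_tendsto hneg
  simp only [Function.comp_def, neg_sq] at hF' hG'
  have h := ((((hF.add hF').add hG).add hG').sub hQ)
  refine le_of_forall_pos_le_add fun ε hε => ?_
  have h1 := isLittleO_iff.1 h hε
  obtain ⟨r, hr, h1, h2⟩ : ∃ r : ℝ, 0 < r ∧ _ ∧ _ :=
    (((h1.and hle).filter_mono nhdsWithin_le_nhds).and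
      (self_mem_nhdsWithin : ∀ᶠ r : ℝ in 𝓝[>] 0, 0 < r)).exists.imp fun r h => ⟨h.2, h.1.1, h.1.2⟩
  rw [norm_pow, Real.norm_eq_abs r, sq_abs] at h1
  have h3 := (abs_le.1 h1).1
  have hr2 : 0 < r ^ 2 := by positivity
  have h4 : r ^ 2 * (X + X') ≤ r ^ 2 * (κ + ε) := by nlinarith
  exact le_of_mul_le_mul_left h4 hr2

lemma HasParabolicJet.hasDerivAt_space {n : ℕ} {f : EuclideanSpace ℝ (Fin n) × ℝ → ℝ}
    {w : EuclideanSpace ℝ (Fin n) × ℝ} {p : EuclideanSpace ℝ (Fin n)} {γ : ℝ}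
    {X : Matrix (Fin n) (Fin n) ℝ} (hf : HasParabolicJet f w p γ X) (a : EuclideanSpace ℝ (Fin n)) :
    HasDerivAt (fun r : ℝ => f (w + (r • a, 0))) ⟪p, a⟫ 0 := by
  have h1 : (fun r : ℝ => r ^ 2) =o[𝓝 0] fun r => r := by
    simpa using isLittleO_pow_id (𝕜 := ℝ) (n := 2) (by norm_num)
  have h2 : (fun r : ℝ => 1 / 2 * r ^ 2 * ⟪X.toEuclideanLin a, a⟫) =o[𝓝 0] fun r => r :=
    (h1.const_mul_left (1 / 2 * ⟪X.toEuclideanLin a, a⟫)).congr_left fun r => by ring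
  rw [hasDerivAt_iff_isLittleO]
  have h3 : w + ((0 : ℝ) • a, (0 : ℝ)) = w := by simp
  simp only [h3, sub_zero, smul_eq_mul]
  exact (((hf.1 a).trans h1).add h2).congr_left fun r => by ring

lemma norm_le_of_inner_le {H : Type*} [NormedAddCommGroup H] [InnerProductSpace ℝ H] {v : H} {C : ℝ}
    (hC : 0 ≤ C) (h : ∀ a, ⟪v, a⟫ ≤ C * ‖a‖) : ‖v‖ ≤ C := by
  rcases eq_or_ne v 0 with rfl | hv
  · simpa using hC
  · have h1 := h v
    rw [real_inner_self_eq_norm_sq, sq] at h1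
    exact le_of_mul_le_mul_right h1 (norm_pos_iff.2 hv)

/-- First and second order relations at a contact point of the doubled functions. -/
lemma HasParabolicJet.contact_relations {n : ℕ} {f g : EuclideanSpace ℝ (Fin n) × ℝ → ℝ}
    {x y : EuclideanSpace ℝ (Fin n)} {t : ℝ} {p p' : EuclideanSpace ℝ (Fin n)}
    {γ γ' : ℝ} {X X' : Matrix (Fin n) (Fin n) ℝ} (hf : HasParabolicJet f (y, t) p γ X)
    (hg : HasParabolicJet g (x, t) p' γ' X') {ψ : ℝ × ℝ → ℝ} {ψs : ℝ → ℝ} {ψt κ b t₃ T' : ℝ}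
    {q : (EuclideanSpace ℝ (Fin n)) × (EuclideanSpace ℝ (Fin n)) × ℝ →L[ℝ] ℝ} (hxy : y ≠ x)
        (ht₃ : t₃ ∈ Ioo 0 T')
    (hcontact : ∀ k h τ, ∀ τ₃ ∈ Icc 0 T', f ((y, t) + (h, τ)) + g ((x, t) + (k, τ)) -
      ψ (‖y + h - (x + k)‖, τ₃) - b * (t + τ - τ₃) ^ 2 ≤
      f (y, t) + g (x, t) - ψ (‖y - x‖, t₃) - b * (t - t₃) ^ 2 + q (k, h, τ))
    (hs : ∀ᶠ σ in 𝓝 ‖y - x‖, HasDerivAt (fun σ => ψ (σ, t₃)) (ψs σ) σ)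
    (hss : HasDerivAt ψs κ ‖y - x‖) (ht : HasDerivAt (fun τ => ψ (‖y - x‖, τ)) ψt t₃) :
    ‖p - ψs ‖y - x‖ • ‖y - x‖⁻¹ • (y - x)‖ ≤ ‖q‖ ∧
    ‖p' + ψs ‖y - x‖ • ‖y - x‖⁻¹ • (y - x)‖ ≤ ‖q‖ ∧ ψt - ‖q‖ ≤ γ + γ' ∧
    (∀ a : EuclideanSpace ℝ (Fin n), ⟪X.toEuclideanLin a, a⟫ + ⟪X'.toEuclideanLin a, a⟫ ≤ 0) ∧
    ⟪X.toEuclideanLin (‖y - x‖⁻¹ • (y - x)), ‖y - x‖⁻¹ • (y - x)⟫ +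
      ⟪X'.toEuclideanLin (‖y - x‖⁻¹ • (y - x)), ‖y - x‖⁻¹ • (y - x)⟫ ≤ 4 * κ := by
  have ht₃' : t₃ ∈ Icc 0 T' := Ioo_subset_Icc_self ht₃
  set z := y - x with hz
  have hz0 : z ≠ 0 := sub_ne_zero.2 hxy
  have hz1 : 0 < ‖z‖ := norm_pos_iff.2 hz0
  set e := ‖z‖⁻¹ • z with he
  have hez : z = ‖z‖ • e := by rw [he, smul_inv_smul₀ hz1.ne']
  have he1 : ‖e‖ = 1 := norm_smul_inv_norm hz0
  have hray : ∀ r : ℝ, -‖z‖ < r → ‖z + r • e‖ = ‖z‖ + r := by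
    intro r hr
    conv_lhs => rw [hez, ← add_smul, norm_smul, he1, mul_one, Real.norm_of_nonneg (by linarith)]
  have hnorm : ∀ a : EuclideanSpace ℝ (Fin n), HasDerivAt (fun r : ℝ => ψ (‖z + r • a‖, t₃))
      (ψs ‖z‖ * ⟪e, a⟫) 0 := by
    intro a
    have h1 : HasDerivAt (fun r : ℝ => z + r • a) a 0 := by
      simpa using ((hasDerivAt_id (0 : ℝ)).smul_const a).const_add z
    have h2 : HasDerivAt (fun r : ℝ => ‖z + r • a‖) ⟪e, a⟫ 0 := by
      have h3 := h1.norm_sq.sqrt (by simpa using hz0)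
      simp only [Real.sqrt_sq (norm_nonneg _), zero_smul, add_zero] at h3
      convert h3 using 1
      rw [he, real_inner_smul_left]
      field_simp
    have h3 : HasDerivAt (fun σ => ψ (σ, t₃)) (ψs ‖z‖) ‖z + (0 : ℝ) • a‖ := by
      simpa using hs.self_of_nhds
    exact h3.comp 0 h2
  have hqb : ∀ a : (EuclideanSpace ℝ (Fin n)) × (EuclideanSpace ℝ
      (Fin n)) × ℝ, |q a| ≤ ‖q‖ * ‖a‖ := fun a => q.le_opNorm a
  have hqlin : ∀ a : (EuclideanSpace ℝ (Fin n)) × (EuclideanSpace ℝ (Fin n)) × ℝ, HasDerivAt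
      (fun r : ℝ => q (r • a)) (q a) 0 := by
    intro a
    simpa using (hasDerivAt_id (0 : ℝ)).mul_const (q a)
  refine ⟨?_, ?_, ?_, ?_, ?_⟩
  · refine norm_le_of_inner_le (norm_nonneg q) fun a => ?_
    have hmin : IsLocalMax (fun r : ℝ => f ((y, t) + (r • a, 0)) - ψ (‖z + r • a‖, t₃) -
        q (r • ((0 : EuclideanSpace ℝ (Fin n)), a, (0 : ℝ)))) 0 := by
      refine Eventually.of_forall fun r => ?_
      have := hcontact 0 (r • a) 0 t₃ ht₃'
      have e1 : y + r • a - (x + 0) = z + r • a := by rw [hz]; abel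
      have e2 : r • ((0 : EuclideanSpace ℝ (Fin n)), a, (0 : ℝ)) = (0, r • a, 0) := by simp
      rw [e1, ← e2] at this
      simp only [zero_smul, add_zero, map_zero] at this ⊢
      simp only [Prod.mk_zero_zero, add_zero] at this ⊢
      linarith
    have h := hmin.hasDerivAt_eq_zero
      (((hf.hasDerivAt_space a).sub (hnorm a)).sub (hqlin _))
    rw [inner_sub_left, real_inner_smul_left]
    have h2 := (abs_le.1 (hqb ((0 : EuclideanSpace ℝ (Fin n)), a, (0 : ℝ)))).2
    have h3 : ‖((0 : EuclideanSpace ℝ (Fin n)), a, (0 : ℝ))‖ = ‖a‖ := by simp [Prod.norm_def]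
    rw [h3] at h2
    linarith
  · refine norm_le_of_inner_le (norm_nonneg q) fun a => ?_
    have hmin : IsLocalMax (fun r : ℝ => g ((x, t) + (r • a, 0)) - ψ (‖z + r • (-a)‖, t₃) -
        q (r • (a, (0 : EuclideanSpace ℝ (Fin n)), (0 : ℝ)))) 0 := by
      refine Eventually.of_forall fun r => ?_
      have := hcontact (r • a) 0 0 t₃ ht₃'
      have e1 : y + 0 - (x + r • a) = z + r • (-a) := by rw [hz, smul_neg]; abel
      have e2 : r • (a, (0 : EuclideanSpace ℝ (Fin n)), (0 : ℝ)) = (r • a, 0, 0) := by simp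
      rw [e1, ← e2] at this
      simp only [zero_smul, add_zero, map_zero] at this ⊢
      simp only [Prod.mk_zero_zero, add_zero] at this ⊢
      linarith
    have h := hmin.hasDerivAt_eq_zero
      (((hg.hasDerivAt_space a).sub (hnorm (-a))).sub (hqlin _))
    rw [inner_neg_right] at h
    rw [inner_add_left, real_inner_smul_left]
    have h2 := (abs_le.1 (hqb (a, (0 : EuclideanSpace ℝ (Fin n)), (0 : ℝ)))).2
    have h3 : ‖(a, (0 : EuclideanSpace ℝ (Fin n)), (0 : ℝ))‖ = ‖a‖ := by simp [Prod.norm_def]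
    rw [h3] at h2
    linarith
  · have hmin : IsLocalMax (fun τ : ℝ => f ((y, t) + (0, τ)) + g ((x, t) + (0, τ)) -
        b * (t - t₃ + τ) ^ 2 - q (τ • ((0 : EuclideanSpace ℝ (Fin n)), (0 : EuclideanSpace ℝ
            (Fin n)), (1 : ℝ)))) 0 := by
      refine Eventually.of_forall fun τ => ?_
      have := hcontact 0 0 τ t₃ ht₃'
      have e2 : τ • ((0 : EuclideanSpace ℝ (Fin n)), (0 : EuclideanSpace ℝ (Fin n)), (1 : ℝ)) =
          (0, 0, τ) := by simp
      rw [← e2, add_zero, add_zero, show t + τ - t₃ = t - t₃ + τ by ring] at this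
      simp only [zero_smul, add_zero, map_zero] at this ⊢
      simp only [Prod.mk_zero_zero, add_zero] at this ⊢
      linarith
    have hsq : HasDerivAt (fun τ : ℝ => b * (t - t₃ + τ) ^ 2) (b * (2 * (t - t₃))) 0 := by
      simpa using (((hasDerivAt_id (0 : ℝ)).const_add (t - t₃)).pow 2).const_mul b
    have h := hmin.hasDerivAt_eq_zero (((hf.2.add hg.2).sub hsq).sub (hqlin _))
    have hmin' : IsLocalMax (fun τ : ℝ => -ψ (‖z‖, τ) - b * (t - τ) ^ 2) t₃ := by
      filter_upwards [Icc_mem_nhds ht₃.1 ht₃.2] with τ hτ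
      have := hcontact 0 0 0 τ hτ
      simp only [Prod.mk_zero_zero, add_zero, map_zero] at this
      linarith
    have hsq' : HasDerivAt (fun τ : ℝ => b * (t - τ) ^ 2) (b * (2 * (t - t₃) * -1)) t₃ := by
      simpa using (((hasDerivAt_id t₃).const_sub t).pow 2).const_mul b
    have h' := hmin'.hasDerivAt_eq_zero (ht.neg.sub hsq')
    have h2 := (abs_le.1 (hqb ((0 : EuclideanSpace ℝ (Fin n)), (0 : EuclideanSpace ℝ (Fin n)),
        (1 : ℝ)))).1
    have h3 : ‖((0 : EuclideanSpace ℝ (Fin n)), (0 : EuclideanSpace ℝ (Fin n)),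
        (1 : ℝ))‖ = 1 := by simp [Prod.norm_def]
    rw [h3] at h2
    linarith
  · intro a
    have e0 : ∀ w : EuclideanSpace ℝ (Fin n) × ℝ, w + ((0 : ℝ) • a, (0 : ℝ)) = w := fun w => by simp
    refine le_of_second_order_le (Q := fun _ => 0) (κ := 0)
      (F := fun r => f ((y, t) + (r • a, 0))) (G := fun r => g ((x, t) + (r • a, 0)))
      (by simpa only [e0] using hf.1 a) (by simpa only [e0] using hg.1 a) (by simp)
      (Eventually.of_forall fun r => ?_)
    have h1 := hcontact (r • a) (r • a) 0 t₃ ht₃'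
    have h2 := hcontact ((-r) • a) ((-r) • a) 0 t₃ ht₃'
    have e1 : q ((-r) • a, (-r) • a, 0) = -q (r • a, r • a, 0) := by
      rw [← map_neg]; simp
    rw [add_sub_add_right_eq_sub, add_zero] at h1 h2
    rw [e1] at h2
    simp only [e0]
    linarith
  · have e0 : ∀ (a : EuclideanSpace ℝ (Fin n)) (w : EuclideanSpace ℝ (Fin n) × ℝ), w +
      ((0 : ℝ) • a, (0 : ℝ)) = w := fun a w => by simp
    have hQ := isLittleO_second_difference hs hss
    have h2r : Tendsto (fun r : ℝ => 2 * r) (𝓝 0) (𝓝 0) := by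
      simpa using (tendsto_id (x := 𝓝 (0 : ℝ))).const_mul 2
    have hQ' := hQ.comp_tendsto h2r
    have hg' := hg.1 (-e)
    rw [map_neg, inner_neg_neg] at hg'
    refine le_of_second_order_le
      (Q := fun r => ψ (‖z‖ + 2 * r, t₃) + ψ (‖z‖ - 2 * r, t₃) - 2 * ψ (‖z‖, t₃)) (κ := 4 * κ)
      (F := fun r => f ((y, t) + (r • e, 0))) (G := fun r => g ((x, t) + (r • (-e), 0)))
      (by simpa only [e0] using hf.1 e) (by simpa only [e0] using hg') ?_ ?_
    · refine IsLittleO.trans_isBigO (hQ'.congr_left fun r => ?_) ?_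
      · simp only [Function.comp_apply]; ring
      · refine IsBigO.of_bound 4 (Eventually.of_forall fun r => le_of_eq ?_)
        simp only [Function.comp_apply, norm_pow, norm_mul, mul_pow]
        norm_num
    · filter_upwards [Ioo_mem_nhds (show -(‖z‖ / 2) < 0 by linarith) (half_pos hz1)] with r hr
      have h1 := hcontact (r • -e) (r • e) 0 t₃ ht₃'
      have h2 := hcontact ((-r) • -e) ((-r) • e) 0 t₃ ht₃'
      have e1 : q ((-r) • -e, (-r) • e, 0) = -q (r • -e, r • e, 0) := by
        rw [← map_neg]; simp
      have e2 : y + r • e - (x + r • -e) = z + (2 * r) • e := by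
        rw [hz]; module
      have e3 : y + (-r) • e - (x + (-r) • -e) = z + (-(2 * r)) • e := by
        rw [hz]; module
      rw [e2, hray _ (by linarith [hr.1]), add_zero] at h1
      rw [e3, hray _ (by linarith [hr.2]), add_zero, e1] at h2
      simp only [e0, ← sub_eq_add_neg] at h1 h2 ⊢
      linarith

/-- Doubling of variables: linearly perturbed doubled functions have global maximum points, and all
of these are interior, provided that the penalisation is strong enough and the perturbation is
small enough. -/
lemma exists_doubling_parameters {H : Type*} [NormedAddCommGroup H] [NormedSpace ℝ H]
    [FiniteDimensional ℝ H] {Ω : Set H} (hΩ : IsOpen Ω) (hc : IsCompact (closure Ω)) {T' : ℝ}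
    {u v : H × ℝ → ℝ} {ψ : ℝ × ℝ → ℝ}
    (hu : ContinuousOn u (closure Ω ×ˢ Icc 0 T')) (hv : ContinuousOn v (closure Ω ×ˢ Icc 0 T'))
    (hψ : ContinuousOn ψ (Ici 0 ×ˢ Icc 0 T'))
    (hmono : ∀ t ∈ Icc 0 T', MonotoneOn (fun s => ψ (s, t)) (Ici 0))
    (hstrict : ∀ x ∈ closure Ω, ∀ y ∈ closure Ω, ∀ t ∈ Icc 0 T',
      ψ (‖y - x‖, t) ≤ u (y, t) + v (x, t) → x ∈ Ω ∧ y ∈ Ω ∧ t ∈ Ioo 0 T' ∧ x ≠ y)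
    {x₀ y₀ : H} {t₀ : ℝ} (hx₀ : x₀ ∈ closure Ω) (hy₀ : y₀ ∈ closure Ω) (ht₀ : t₀ ∈ Icc 0 T')
    (h₀ : ψ (‖y₀ - x₀‖, t₀) ≤ u (y₀, t₀) + v (x₀, t₀)) :
    ∃ r > 0, ∃ C > 0, ∃ δ > 0, ∃ a₀ > 0, ∀ a ≥ a₀, ∀ b ≥ a₀, ∀ f g : H × ℝ → ℝ,
      ∀ h : H × H × ℝ → ℝ, IsSupConv (closure Ω ×ˢ Icc 0 T') a b u f →
      IsSupConv (closure Ω ×ˢ Icc 0 T') a b v g →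
      (∀ w, ∀ τ ∈ Icc 0 T', -ψ (‖w.2.1 - w.1‖, τ) - b * (w.2.2 - τ) ^ 2 ≤ h w) →
      (∀ w, ∃ τ ∈ Icc 0 T', h w = -ψ (‖w.2.1 - w.1‖, τ) - b * (w.2.2 - τ) ^ 2) →
      ∀ q : H × H × ℝ →L[ℝ] ℝ, ‖q‖ < δ →
        (∃ w, ∀ z, f z.2 + g (z.1, z.2.2) + h z ≤ f w.2 + g (w.1, w.2.2) + h w + q (z - w)) ∧
        ∀ w, (∀ z, f z.2 + g (z.1, z.2.2) + h z ≤ f w.2 + g (w.1, w.2.2) + h w + q (z - w)) →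
        ∀ w₁ ∈ closure Ω ×ˢ Icc 0 T', ∀ w₂ ∈ closure Ω ×ˢ Icc 0 T', ∀ τ ∈ Icc 0 T',
          f w.2 = u w₁ - a * ‖w.2.1 - w₁.1‖ ^ 2 - b * (w.2.2 - w₁.2) ^ 2 →
          g (w.1, w.2.2) = v w₂ - a * ‖w.1 - w₂.1‖ ^ 2 - b * (w.2.2 - w₂.2) ^ 2 →
          h w = -ψ (‖w.2.1 - w.1‖, τ) - b * (w.2.2 - τ) ^ 2 →
          w₁.1 ∈ Ω ∧ w₂.1 ∈ Ω ∧ w₁.2 ∈ Ioo 0 T' ∧ w₂.2 ∈ Ioo 0 T' ∧ τ ∈ Ioo 0 T' ∧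
          r ≤ ‖w.2.1 - w.1‖ ∧ ‖w.2.1 - w.1‖ ≤ C ∧ b * (w.2.2 - w₁.2) ^ 2 ≤ C ∧
          b * (w.2.2 - w₂.2) ^ 2 ≤ C ∧ b * (w.2.2 - τ) ^ 2 ≤ C := by
  obtain ⟨r, hr, hgood⟩ := exists_interior_radius hΩ hc hu hv hψ hstrict
  set K : Set (H × ℝ) := closure Ω ×ˢ Icc 0 T' with hKdef
  have hK : IsCompact K := hc.prod isCompact_Icc
  obtain ⟨M₁, hM₁⟩ := hK.bddAbove_image hu
  obtain ⟨M₂, hM₂⟩ := hK.bddAbove_image hv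
  obtain ⟨m₀, hm₀⟩ := (isCompact_Icc (a := (0 : ℝ)) (b := T')).bddBelow_image
    (f := fun τ => ψ (0, τ)) (hψ.comp (by fun_prop) fun τ hτ => ⟨self_mem_Ici, hτ⟩)
  have hψ0 : ∀ s ≥ 0, ∀ τ ∈ Icc 0 T', m₀ ≤ ψ (s, τ) := fun s hs τ hτ =>
    (hm₀ (mem_image_of_mem _ hτ)).trans (hmono τ hτ self_mem_Ici hs hs)
  set B := M₁ + M₂ - m₀ with hB
  have hval : ∀ w₁ ∈ K, ∀ w₂ ∈ K, ∀ s ≥ 0, ∀ τ ∈ Icc 0 T', u w₁ + v w₂ - ψ (s, τ) ≤ B := by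
    intro w₁ h1 w₂ h2 s hs τ hτ
    have := hM₁ (mem_image_of_mem _ h1)
    have := hM₂ (mem_image_of_mem _ h2)
    have := hψ0 s hs τ hτ
    linarith
  have hB0 : 0 ≤ B := (sub_nonneg.2 h₀).trans
    (hval (y₀, t₀) ⟨hy₀, ht₀⟩ (x₀, t₀) ⟨hx₀, ht₀⟩ _ (norm_nonneg _) _ ht₀)
  obtain ⟨R, hR⟩ : ∃ R, ∀ w₁ ∈ K, ∀ w₂ ∈ K, dist w₁ w₂ ≤ R :=
    ⟨Metric.diam K, fun w₁ h1 w₂ h2 => Metric.dist_le_diam_of_mem hK.isBounded h1 h2⟩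
  have hR0 : 0 ≤ R := dist_nonneg.trans (hR (x₀, t₀) ⟨hx₀, ht₀⟩ (x₀, t₀) ⟨hx₀, ht₀⟩)
  set C₁ := 2 * (B + R) + 1 with hC₁
  set C₂ := B + 2 * R + 1 with hC₂
  set w₀ : H × H × ℝ := (x₀, y₀, t₀) with hw₀
  set val : (H × H × ℝ) × (H × ℝ) × (H × ℝ) × ℝ → ℝ := fun P =>
    u P.2.1 + v P.2.2.1 - ψ (‖P.1.2.1 - P.1.1‖, P.2.2.2) with hvaldef
  refine ⟨r, hr, C₁ + R + 2 * r, by positivity, min 1 (r / (C₂ + 1)), by positivity,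
    1 + C₁ / r ^ 2, by positivity, ?_⟩
  intro a ha b hb f g h hf hg hh1 hh2 q hq
  have hq1 : ‖q‖ ≤ 1 := hq.le.trans (min_le_left _ _)
  have hqC : ‖q‖ * C₂ < r := by
    have h1 : ‖q‖ < r / (C₂ + 1) := hq.trans_le (min_le_right _ _)
    rw [lt_div_iff₀ (by positivity)] at h1
    nlinarith [norm_nonneg q]
  have ha1 : 1 ≤ a := le_trans (le_add_of_nonneg_right (by positivity)) ha
  have hb1 : 1 ≤ b := le_trans (le_add_of_nonneg_right (by positivity)) hb
  have hclose : ∀ c ≥ 1 + C₁ / r ^ 2, ∀ d ≥ 0, c * d ^ 2 ≤ C₁ → d < r := by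
    intro c hc d hd hcd
    by_contra! hrd
    have hc0 : 0 ≤ c := le_trans (by positivity) hc
    have h1 : (1 + C₁ / r ^ 2) * r ^ 2 = r ^ 2 + C₁ := by field_simp
    have h2 : (1 + C₁ / r ^ 2) * r ^ 2 ≤ c * d ^ 2 := by gcongr
    nlinarith [sq_pos_of_pos hr]
  set pen : (H × H × ℝ) × (H × ℝ) × (H × ℝ) × ℝ → ℝ := fun P =>
    a * ‖P.1.2.1 - P.2.1.1‖ ^ 2 + b * (P.1.2.2 - P.2.1.2) ^ 2 + a * ‖P.1.1 - P.2.2.1.1‖ ^ 2 +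
      b * (P.1.2.2 - P.2.2.1.2) ^ 2 + b * (P.1.2.2 - P.2.2.2) ^ 2 with hpendef
  set W : H × H × ℝ → ℝ := fun z => f z.2 + g (z.1, z.2.2) + h z with hWdef
  set S : Set ((H × ℝ) × (H × ℝ) × ℝ) := K ×ˢ K ×ˢ Icc 0 T' with hSdef
  have hWle : ∀ z, ∀ P ∈ S, val (z, P) - pen (z, P) ≤ W z := by
    rintro z ⟨w₁, w₂, τ⟩ ⟨h1, h2, h3⟩
    have := hf.1 z.2 w₁ h1
    have := hg.1 (z.1, z.2.2) w₂ h2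
    have := hh1 z τ h3
    simp only [hvaldef, hpendef, hWdef] at *
    linarith
  have hWeq : ∀ z, ∃ P ∈ S, W z = val (z, P) - pen (z, P) := by
    intro z
    obtain ⟨w₁, h1, e1⟩ := hf.2 z.2
    obtain ⟨w₂, h2, e2⟩ := hg.2 (z.1, z.2.2)
    obtain ⟨τ, h3, e3⟩ := hh2 z
    refine ⟨(w₁, w₂, τ), ⟨h1, h2, h3⟩, ?_⟩
    simp only [hvaldef, hpendef, hWdef, e1, e2, e3]
    ring
  set P₀ : (H × ℝ) × (H × ℝ) × ℝ := ((y₀, t₀), (x₀, t₀), t₀) with hP₀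
  have hP₀S : P₀ ∈ S := ⟨⟨hy₀, ht₀⟩, ⟨hx₀, ht₀⟩, ht₀⟩
  have hv₀ : 0 ≤ val (w₀, P₀) - pen (w₀, P₀) := by
    simp only [hvaldef, hpendef, hw₀, hP₀, sub_self, norm_zero]
    linarith
  have hconf : ∀ z, ∀ P ∈ S, q (z - w₀) ≤ val (z, P) - pen (z, P) →
      pen (z, P) ≤ C₁ ∧ ‖z - w₀‖ ≤ C₂ := by
    rintro z ⟨w₁, w₂, τ⟩ ⟨h1, h2, h3⟩ hle
    have hqz := (abs_le.1 (q.le_opNorm (z - w₀))).1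
    have hpos : ∀ c ≥ 1, ∀ d : ℝ, d ^ 2 ≤ c * d ^ 2 := fun c hc d =>
      le_mul_of_one_le_left (sq_nonneg d) hc
    have p1 := hpos a ha1 ‖z.2.1 - w₁.1‖
    have p2 := hpos b hb1 (z.2.2 - w₁.2)
    have p3 := hpos a ha1 ‖z.1 - w₂.1‖
    have p4 := hpos b hb1 (z.2.2 - w₂.2)
    have p5 := hpos b hb1 (z.2.2 - τ)
    have s1 := sq_nonneg ‖z.2.1 - w₁.1‖
    have s2 := sq_nonneg (z.2.2 - w₁.2)
    have s3 := sq_nonneg ‖z.1 - w₂.1‖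
    have s4 := sq_nonneg (z.2.2 - w₂.2)
    have s5 := sq_nonneg (z.2.2 - τ)
    have hpe : pen (z, w₁, w₂, τ) = a * ‖z.2.1 - w₁.1‖ ^ 2 + b * (z.2.2 - w₁.2) ^ 2 +
      a * ‖z.1 - w₂.1‖ ^ 2 + b * (z.2.2 - w₂.2) ^ 2 + b * (z.2.2 - τ) ^ 2 := rfl
    have d1 := hR w₁ h1 (y₀, t₀) ⟨hy₀, ht₀⟩
    have d2 := hR w₂ h2 (x₀, t₀) ⟨hx₀, ht₀⟩
    rw [Prod.dist_eq, max_le_iff, dist_eq_norm, dist_eq_norm] at d1 d2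
    refine penalty_le_of_almost_max hR0 (by linarith) (norm_nonneg q) hq1 ?_ ?_
    · have := hval w₁ h1 w₂ h2 ‖z.2.1 - z.1‖ (norm_nonneg _) τ h3
      have e : val (z, w₁, w₂, τ) = u w₁ + v w₂ - ψ (‖z.2.1 - z.1‖, τ) := rfl
      have hqz' := neg_le_of_abs_le (q.le_opNorm (z - w₀))
      linarith
    · have q1 : ‖z.1 - x₀‖ ≤ R + √(pen (z, w₁, w₂, τ)) := by
        have := Real.le_sqrt_of_sq_le (show ‖z.1 - w₂.1‖ ^ 2 ≤ pen (z, w₁, w₂, τ) by linarith)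
        have := norm_sub_le_norm_sub_add_norm_sub z.1 w₂.1 x₀
        linarith [d2.1]
      have q2 : ‖z.2.1 - y₀‖ ≤ R + √(pen (z, w₁, w₂, τ)) := by
        have := Real.le_sqrt_of_sq_le (show ‖z.2.1 - w₁.1‖ ^ 2 ≤ pen (z, w₁, w₂, τ) by linarith)
        have := norm_sub_le_norm_sub_add_norm_sub z.2.1 w₁.1 y₀
        linarith [d1.1]
      have q3 : ‖z.2.2 - t₀‖ ≤ R + √(pen (z, w₁, w₂, τ)) := by
        have := Real.le_sqrt_of_sq_le (show ‖z.2.2 - w₁.2‖ ^ 2 ≤ pen (z, w₁, w₂, τ) by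
          rw [Real.norm_eq_abs, sq_abs]; linarith)
        have := norm_sub_le_norm_sub_add_norm_sub z.2.2 w₁.2 t₀
        linarith [d1.2]
      exact max_le q1 (max_le q2 q3)
  refine ⟨?_, ?_⟩
  · have hcpt : IsCompact (Metric.closedBall w₀ C₂ ×ˢ S) :=
      (isCompact_closedBall w₀ C₂).prod (hK.prod (hK.prod isCompact_Icc))
    have hcont : ContinuousOn (fun P => val P - pen P - q P.1) (Metric.closedBall w₀ C₂ ×ˢ S) := by
      have c1 : ContinuousOn (fun P : (H × H × ℝ) × (H × ℝ) × (H × ℝ) × ℝ => u P.2.1)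
          (Metric.closedBall w₀ C₂ ×ˢ S) := hu.comp (by fun_prop) fun P hP => hP.2.1
      have c2 : ContinuousOn (fun P : (H × H × ℝ) × (H × ℝ) × (H × ℝ) × ℝ => v P.2.2.1)
          (Metric.closedBall w₀ C₂ ×ˢ S) := hv.comp (by fun_prop) fun P hP => hP.2.2.1
      have c3 : ContinuousOn (fun P : (H × H × ℝ) × (H × ℝ) × (H × ℝ) × ℝ =>
          ψ (‖P.1.2.1 - P.1.1‖, P.2.2.2)) (Metric.closedBall w₀ C₂ ×ˢ S) :=
        hψ.comp (by fun_prop) fun P hP => ⟨norm_nonneg _, hP.2.2.2⟩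
      have c4 : Continuous pen := by fun_prop
      have c5 : Continuous fun P : (H × H × ℝ) × (H × ℝ) × (H × ℝ) × ℝ => q P.1 := by fun_prop
      exact (((c1.add c2).sub c3).sub c4.continuousOn).sub c5.continuousOn
    have hmem₀ : (w₀, P₀) ∈ Metric.closedBall w₀ C₂ ×ˢ S :=
      ⟨Metric.mem_closedBall_self (by positivity), hP₀S⟩
    obtain ⟨⟨w, P⟩, ⟨hw, hP⟩, hmax⟩ := hcpt.exists_isMaxOn ⟨_, hmem₀⟩ hcont
    have h0 : val (w₀, P₀) - pen (w₀, P₀) - q w₀ ≤ val (w, P) - pen (w, P) - q w := hmax hmem₀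
    refine ⟨w, fun z => ?_⟩
    change W z ≤ W w + q (z - w)
    obtain ⟨Q, hQ, e⟩ := hWeq z
    have h1 := hWle w P hP
    rw [map_sub]
    by_cases hz : q (z - w₀) ≤ val (z, Q) - pen (z, Q)
    · have h2 : val (z, Q) - pen (z, Q) - q z ≤ val (w, P) - pen (w, P) - q w :=
        hmax (show (z, Q) ∈ _ from ⟨by
          rw [mem_closedBall_iff_norm]; exact (hconf z Q hQ hz).2, hQ⟩)
      linarith
    · rw [map_sub] at hz
      linarith
  · intro w hw w₁ h1 w₂ h2 τ h3 e1 e2 e3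
    change ∀ z, W z ≤ W w + q (z - w) at hw
    have hPS : (w₁, w₂, τ) ∈ S := ⟨h1, h2, h3⟩
    have e : W w = val (w, w₁, w₂, τ) - pen (w, w₁, w₂, τ) := by
      simp only [hvaldef, hpendef, hWdef, e1, e2, e3]
      ring
    have h4 : q (w - w₀) ≤ val (w, w₁, w₂, τ) - pen (w, w₁, w₂, τ) := by
      have := hw w₀
      have := hWle w₀ P₀ hP₀S
      rw [← neg_sub w w₀, map_neg] at *
      linarith
    obtain ⟨h5, h6⟩ := hconf w _ hPS h4
    have hpe : pen (w, w₁, w₂, τ) = a * ‖w.2.1 - w₁.1‖ ^ 2 + b * (w.2.2 - w₁.2) ^ 2 +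
      a * ‖w.1 - w₂.1‖ ^ 2 + b * (w.2.2 - w₂.2) ^ 2 + b * (w.2.2 - τ) ^ 2 := rfl
    have s1 : 0 ≤ a * ‖w.2.1 - w₁.1‖ ^ 2 := by positivity
    have s2 : 0 ≤ b * (w.2.2 - w₁.2) ^ 2 := by positivity
    have s3 : 0 ≤ a * ‖w.1 - w₂.1‖ ^ 2 := by positivity
    have s4 : 0 ≤ b * (w.2.2 - w₂.2) ^ 2 := by positivity
    have s5 : 0 ≤ b * (w.2.2 - τ) ^ 2 := by positivity
    have r1 := hclose a ha _ (norm_nonneg (w.2.1 - w₁.1)) (by linarith)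
    have r2 := hclose a ha _ (norm_nonneg (w.1 - w₂.1)) (by linarith)
    have r3 := hclose b hb _ (abs_nonneg (w.2.2 - w₁.2)) (by rw [sq_abs]; linarith)
    have r4 := hclose b hb _ (abs_nonneg (w.2.2 - w₂.2)) (by rw [sq_abs]; linarith)
    have r5 := hclose b hb _ (abs_nonneg (w.2.2 - τ)) (by rw [sq_abs]; linarith)
    have h7 : ψ (‖w.2.1 - w.1‖, τ) - r < u w₁ + v w₂ := by
      have h8 := neg_le_of_abs_le (q.le_opNorm (w - w₀))
      have h9 : ‖q‖ * ‖w - w₀‖ ≤ ‖q‖ * C₂ := by gcongr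
      have e : val (w, w₁, w₂, τ) = u w₁ + v w₂ - ψ (‖w.2.1 - w.1‖, τ) := rfl
      linarith
    obtain ⟨g1, g2, g3, g4, g5, g6⟩ := hgood w₁ h1 w₂ h2 τ h3 w.1 w.2.1 w.2.2 r1 r2 r3 r4 r5 h7
    have h8 : ‖w.2.1 - w.1‖ ≤ R + 2 * r := by
      have d := hR w₁ h1 w₂ h2
      rw [Prod.dist_eq, max_le_iff, dist_eq_norm] at d
      have k1 := norm_sub_le_norm_sub_add_norm_sub w.2.1 w₁.1 w.1
      have k2 := norm_sub_le_norm_sub_add_norm_sub w₁.1 w₂.1 w.1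
      rw [norm_sub_rev w₂.1] at k2
      linarith [d.1]
    exact ⟨g1, g2, g3, g4, g5, g6, by linarith, by linarith, by linarith, by linarith⟩

lemma ae_comp_of_surjective {V W : Type*} [NormedAddCommGroup V] [NormedSpace ℝ V]
    [FiniteDimensional ℝ V] [MeasurableSpace V] [BorelSpace V] [NormedAddCommGroup W]
    [NormedSpace ℝ W] [FiniteDimensional ℝ W] [MeasurableSpace W] [BorelSpace W]
    (μ : Measure V) [μ.IsAddHaarMeasure] (ν : Measure W) [ν.IsAddHaarMeasure] {L : V →L[ℝ] W}
    (hL : Function.Surjective L) {P : W → Prop} (h : ∀ᵐ y ∂ν, P y) : ∀ᵐ x ∂μ, P (L x) := by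
  obtain ⟨r, hr, hmap⟩ := LinearMap.exists_map_addHaar_eq_smul_addHaar (L : V →ₗ[ℝ] W) μ ν hL
  have hq : Measure.QuasiMeasurePreserving L μ ν := by
    refine ⟨L.continuous.measurable, ?_⟩
    change Measure.map (⇑(L : V →ₗ[ℝ] W)) μ ≪ _
    rw [hmap]
    exact Measure.smul_absolutelyContinuous
  exact hq.ae h

/-- The ellipticity hypothesis in terms of unit vectors, extended to `R = 0` by continuity. -/
lemma mul_inner_sq_le_of_ellipticity {n : ℕ} {A : (EuclideanSpace ℝ (Fin n)) → ℝ → Matrix (Fin n)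
    (Fin n) ℝ} {T : ℝ}
    (hAc : Continuous fun q : (EuclideanSpace ℝ (Fin n)) × ℝ => A q.1 q.2) (hApsd : ∀ p t,
        (A p t).PosSemidef)
    {α : ℝ → ℝ → ℝ} (hαc : Continuous fun q : ℝ × ℝ => α q.1 q.2)
    (hαle : ∀ R > (0 : ℝ), ∀ t ∈ Icc (0 : ℝ) T, ∀ p v : EuclideanSpace ℝ (Fin n),
      ‖p‖ = R → ⟪v, p⟫ ≠ 0 →
      α R t ≤ R ^ 2 * ((∑ i, ∑ j, v i * A p t i j * v j) / ⟪v, p⟫ ^ 2))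
    {R : ℝ} (hR : 0 ≤ R) {t : ℝ} (ht : t ∈ Icc 0 T) {e : EuclideanSpace ℝ (Fin n)} (he : ‖e‖ = 1)
        (w : EuclideanSpace ℝ (Fin n)) :
    α R t * ⟪w, e⟫ ^ 2 ≤ ⟪(A (R • e) t).toEuclideanLin w, w⟫ := by
  have hpos : ∀ R > 0, α R t * ⟪w, e⟫ ^ 2 ≤ ∑ i, ∑ j, w i * A (R • e) t i j * w j := by
    intro R hR
    rcases eq_or_ne ⟪w, e⟫ 0 with h | h
    · rw [h]
      rw [← Matrix.inner_toEuclideanLin_self]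
      simpa using (Matrix.isPositive_toEuclideanLin_iff.2 (hApsd (R • e) t)).inner_nonneg_left w
    · have h1 := hαle R hR t ht (R • e) w (by rw
        [norm_smul, he, Real.norm_of_nonneg hR.le, mul_one])
        (by rw [inner_smul_right]; exact mul_ne_zero hR.ne' h)
      rw [inner_smul_right, mul_pow, ← mul_div_assoc, mul_div_mul_left _ _ (by positivity),
        le_div_iff₀ (by positivity)] at h1
      exact h1
  rw [Matrix.inner_toEuclideanLin_self]
  have hcl : IsClosed {R : ℝ | α R t * ⟪w, e⟫ ^ 2 ≤ ∑ i, ∑ j, w i * A (R • e) t i j * w j} := by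
    have hα' : Continuous fun R => α R t := hαc.comp (by fun_prop : Continuous fun R : ℝ => (R, t))
    have hA' : Continuous fun R : ℝ => A (R • e) t :=
      hAc.comp (by fun_prop : Continuous fun R : ℝ => (R • e, t))
    refine isClosed_le (by fun_prop) ?_
    refine continuous_finsetSum _ fun i _ => continuous_finsetSum _ fun j _ => ?_
    exact (continuous_const.mul (hA'.matrix_elem i j)).mul continuous_const
  have hsub : closure (Ioi (0 : ℝ)) ⊆
      {R : ℝ | α R t * ⟪w, e⟫ ^ 2 ≤ ∑ i, ∑ j, w i * A (R • e) t i j * w j} :=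
    hcl.closure_subset_iff.2 fun R hR => hpos R hR
  rw [closure_Ioi] at hsub
  exact hsub hR

lemma nonneg_of_pos_of_continuous {α : ℝ → ℝ} (hα : Continuous α) (h : ∀ R > 0, 0 < α R) {R : ℝ}
    (hR : 0 ≤ R) : 0 ≤ α R := by
  have hsub : closure (Ioi (0 : ℝ)) ⊆ {R | 0 ≤ α R} :=
    (isClosed_le continuous_const hα).closure_subset_iff.2 fun R hR => (h R hR).le
  rw [closure_Ioi] at hsub
  exact hsub hR

/-- Lower support by paraboloids for the regularised modulus term of the doubled function. -/
lemma exists_lower_support_modulus {H : Type*} [NormedAddCommGroup H] [InnerProductSpace ℝ H]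
    {c : ℝ → ℝ} (hc : ConcaveOn ℝ (Ici 0) c) {h : H × H × ℝ → ℝ} {b g r L τ : ℝ}
    (hr : 0 < r) (hb : 0 ≤ b) {w : H × H × ℝ} (hw : r ≤ ‖w.2.1 - w.1‖) (hg0 : 0 ≤ g) (hgL : g ≤ L)
    (hg : HasDerivWithinAt c g (Ici 0) ‖w.2.1 - w.1‖)
    (hle : ∀ z, -c ‖z.2.1 - z.1‖ - b * (z.2.2 - τ) ^ 2 ≤ h z)
    (heq : h w = -c ‖w.2.1 - w.1‖ - b * (w.2.2 - τ) ^ 2) :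
    ∃ ξ : H × H × ℝ →L[ℝ] ℝ, ∀ z,
      h w + ξ (z - w) - (2 * (L / r) + b) * ‖z - w‖ ^ 2 ≤ h z := by
  set z₀ := w.2.1 - w.1 with hz₀
  have hz : 0 < ‖z₀‖ := hr.trans_le hw
  set e := ‖z₀‖⁻¹ • z₀ with he
  refine ⟨-(g • (innerSL ℝ e).comp ((ContinuousLinearMap.fst ℝ H ℝ).comp
      (ContinuousLinearMap.snd ℝ H (H × ℝ)) - ContinuousLinearMap.fst ℝ H (H × ℝ)))
    - (2 * b * (w.2.2 - τ)) • (ContinuousLinearMap.snd ℝ H ℝ).comp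
      (ContinuousLinearMap.snd ℝ H (H × ℝ)), fun z => ?_⟩
  obtain ⟨d, rfl⟩ : ∃ d, z = w + d := ⟨z - w, by abel⟩
  have h1 := hle (w + d)
  have h2 := hc.comp_norm_le hg0 (norm_pos_iff.1 hz) hg (d.2.1 - d.1)
  have h3 : (w + d).2.1 - (w + d).1 = z₀ + (d.2.1 - d.1) := by
    simp only [Prod.fst_add, Prod.snd_add, hz₀]; abel
  have h4 : ‖d.2.1 - d.1‖ ≤ 2 * ‖d‖ := by
    have h5 := norm_sub_le d.2.1 d.1
    have h6 := norm_fst_le d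
    have h7 := (norm_fst_le d.2).trans (norm_snd_le d)
    linarith
  have h5 : g / (2 * ‖z₀‖) * ‖d.2.1 - d.1‖ ^ 2 ≤ 2 * (L / r) * ‖d‖ ^ 2 := by
    calc g / (2 * ‖z₀‖) * ‖d.2.1 - d.1‖ ^ 2 ≤ L / (2 * r) * (2 * ‖d‖) ^ 2 := by
          have hL : 0 ≤ L := hg0.trans hgL
          gcongr
      _ = _ := by field_simp
  have h6 : d.2.2 ^ 2 ≤ ‖d‖ ^ 2 := by
    rw [← sq_abs]
    have h7 := (norm_snd_le d.2).trans (norm_snd_le d)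
    rw [Real.norm_eq_abs] at h7
    gcongr
  rw [h3] at h1
  rw [heq, add_sub_cancel_left]
  simp only [sub_apply, neg_apply,
    smul_apply, ContinuousLinearMap.comp_apply, innerSL_apply_apply,
    ContinuousLinearMap.coe_fst', ContinuousLinearMap.coe_snd', smul_eq_mul]
  have h7 : (w + d).2.2 = w.2.2 + d.2.2 := rfl
  rw [h7] at h1
  have h8 := mul_le_mul_of_nonneg_left h6 hb
  rw [inner_sub_right] at h2 ⊢
  nlinarith

/-- Lower support by paraboloids for the doubled function. -/
lemma IsSupConv.exists_lower_support_doubled {H : Type*} [NormedAddCommGroup H]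
    [InnerProductSpace ℝ H] {K : Set (H × ℝ)} {a b c : ℝ} (ha : 0 ≤ a) (hb : 0 ≤ b)
    {u v f g : H × ℝ → ℝ} {h : H × H × ℝ → ℝ} (hf : IsSupConv K a b u f)
    (hg : IsSupConv K a b v g) {w : H × H × ℝ}
    (hh : ∃ ξ : H × H × ℝ →L[ℝ] ℝ, ∀ z, h w + ξ (z - w) - c * ‖z - w‖ ^ 2 ≤ h z) :
    ∃ ξ : H × H × ℝ →L[ℝ] ℝ, ∀ z,
      f w.2 + g (w.1, w.2.2) + h w + ξ (z - w) - (2 * (a + b) + c) * ‖z - w‖ ^ 2 ≤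
        f z.2 + g (z.1, z.2.2) + h z := by
  obtain ⟨ξ₁, h₁⟩ := hf.exists_lower_support w.2
  obtain ⟨ξ₂, h₂⟩ := hg.exists_lower_support (w.1, w.2.2)
  obtain ⟨ξ₃, h₃⟩ := hh
  refine ⟨ξ₁.comp (ContinuousLinearMap.snd ℝ H (H × ℝ)) +
    ξ₂.comp ((ContinuousLinearMap.fst ℝ H (H × ℝ)).prod
      ((ContinuousLinearMap.snd ℝ H ℝ).comp (ContinuousLinearMap.snd ℝ H (H × ℝ)))) + ξ₃,
    fun z => ?_⟩
  have e₁ := h₁ z.2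
  have e₂ := h₂ (z.1, z.2.2)
  have e₃ := h₃ z
  have hx : ‖z.1 - w.1‖ ^ 2 ≤ ‖z - w‖ ^ 2 := by
    have := norm_fst_le (z - w)
    rw [Prod.fst_sub] at this
    gcongr
  have hy : ‖z.2.1 - w.2.1‖ ^ 2 ≤ ‖z - w‖ ^ 2 := by
    have := (norm_fst_le (z - w).2).trans (norm_snd_le (z - w))
    rw [Prod.snd_sub, Prod.fst_sub] at this
    gcongr
  have ht : (z.2.2 - w.2.2) ^ 2 ≤ ‖z - w‖ ^ 2 := by
    have := (norm_snd_le (z - w).2).trans (norm_snd_le (z - w))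
    rw [Prod.snd_sub, Prod.snd_sub, Real.norm_eq_abs] at this
    rw [← sq_abs]
    gcongr
  have m₁ := mul_le_mul_of_nonneg_left hx ha
  have m₂ := mul_le_mul_of_nonneg_left hy ha
  have m₃ := mul_le_mul_of_nonneg_left ht hb
  simp only [add_apply, ContinuousLinearMap.comp_apply,
    ContinuousLinearMap.prod_apply, ContinuousLinearMap.coe_fst', ContinuousLinearMap.coe_snd']
  simp only [Prod.mk_sub_mk] at e₂
  simp only [Prod.snd_sub, Prod.fst_sub] at e₁ e₂ e₃ ⊢
  linarith

lemma Matrix.trace_mul_add_trace_mul_le {n : ℕ} {A₀ A₁ A₂ X X' : Matrix (Fin n) (Fin n) ℝ}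
    {α κ a η : ℝ} {e : EuclideanSpace ℝ (Fin n)} (hA₀ : A₀.PosSemidef) (hα0 : 0 ≤ α)
    (hα : ∀ w, α * ⟪w, e⟫ ^ 2 ≤ ⟪A₀.toEuclideanLin w, w⟫) (hη : 0 ≤ η)
    (hX : X.IsHermitian) (hX' : X'.IsHermitian)
    (hXa : ∀ k : EuclideanSpace ℝ (Fin n), -(2 * a) * ‖k‖ ^ 2 ≤ ⟪X.toEuclideanLin k, k⟫)
    (hXa' : ∀ k : EuclideanSpace ℝ (Fin n), -(2 * a) * ‖k‖ ^ 2 ≤ ⟪X'.toEuclideanLin k, k⟫)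
    (hadd : ∀ k : EuclideanSpace ℝ (Fin n), ⟪X.toEuclideanLin k, k⟫ + ⟪X'.toEuclideanLin k, k⟫ ≤ 0)
    (he : ⟪X.toEuclideanLin e, e⟫ + ⟪X'.toEuclideanLin e, e⟫ ≤ 4 * κ)
    (h₁ : ∀ i j, |A₁ i j - A₀ i j| ≤ η) (h₂ : ∀ i j, |A₂ i j - A₀ i j| ≤ η) :
    (A₁ * X).trace + (A₂ * X').trace ≤ 4 * (α * κ) + n ^ 2 * (η * (4 * a)) := by
  have b₁ := Matrix.trace_mul_le_of_abs_sub_le hη h₁ (hX.abs_apply_le (c := 2 * a) fun k => by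
    rw [abs_le]; constructor <;> linarith [hXa k, hXa' k, hadd k])
  have b₂ := Matrix.trace_mul_le_of_abs_sub_le hη h₂ (hX'.abs_apply_le (c := 2 * a) fun k => by
    rw [abs_le]; constructor <;> linarith [hXa k, hXa' k, hadd k])
  have hsum : ∀ k : EuclideanSpace ℝ (Fin n), ⟪(X + X').toEuclideanLin k, k⟫ =
      ⟪X.toEuclideanLin k, k⟫ + ⟪X'.toEuclideanLin k, k⟫ := fun k => by
    rw [map_add, LinearMap.add_apply, inner_add_left]
  have b₃ := Matrix.trace_mul_le_of_rank_one_le hA₀ (hX.add hX') (fun w => by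
    rw [hsum]; exact hadd w) hα
  rw [hsum, Matrix.mul_add, Matrix.trace_add] at b₃
  have b₄ := mul_le_mul_of_nonneg_left he hα0
  linarith

lemma exists_uniform_modulus {n : ℕ} {A : (EuclideanSpace ℝ (Fin n)) → ℝ → Matrix (Fin n) (Fin n) ℝ}
    (hAc : Continuous fun q : (EuclideanSpace ℝ (Fin n)) × ℝ => A q.1 q.2) (L T' : ℝ) {η : ℝ}
        (hη : 0 < η) :
    ∃ ρ > 0, ∀ p p₀ : EuclideanSpace ℝ
        (Fin n), ‖p‖ ≤ L → ‖p₀‖ ≤ L → ‖p - p₀‖ < ρ → ∀ t ∈ Icc 0 T', ∀ t₀ ∈ Icc 0 T',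
      |t - t₀| < ρ → ∀ i j, |A p t i j - A p₀ t₀ i j| ≤ η := by
  have hF : Continuous fun (q : (EuclideanSpace ℝ (Fin n)) × ℝ) i j => A q.1 q.2 i j :=
    continuous_pi fun i => continuous_pi fun j => hAc.matrix_elem i j
  have hu := ((isCompact_closedBall (0 : EuclideanSpace ℝ (Fin n)) L).prod
    (isCompact_Icc (a := (0 : ℝ)) (b := T'))).uniformContinuousOn_of_continuous hF.continuousOn
  obtain ⟨ρ, hρ, h⟩ := Metric.uniformContinuousOn_iff.1 hu η hη
  refine ⟨ρ, hρ, fun p p₀ hp hp₀ hpp t ht t₀ ht₀ htt i j => ?_⟩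
  have h1 := h (p, t) ⟨by simpa using hp, ht⟩ (p₀, t₀) ⟨by simpa using hp₀, ht₀⟩ (by
    rw [Prod.dist_eq, dist_eq_norm, Real.dist_eq]
    exact max_lt hpp htt)
  rw [← Real.dist_eq]
  exact ((dist_le_pi_dist _ _ j).trans (dist_le_pi_dist _ _ i)).trans h1.le

/-- Comparison of a doubled pair of subsolutions with a strict supersolution of the
one-dimensional equation. -/
lemma IsViscositySubsoln.add_lt_modulus {n : ℕ} {Ω : Set (EuclideanSpace ℝ (Fin n))} {T T' : ℝ}
    (hΩ : IsOpen Ω)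
    (hc : IsCompact (closure Ω)) (hT : T' < T) {A : (EuclideanSpace ℝ (Fin n)) → ℝ → Matrix (Fin n)
        (Fin n) ℝ}
    (hAc : Continuous fun q : (EuclideanSpace ℝ (Fin n)) × ℝ => A q.1 q.2) (hApsd : ∀ p t,
        (A p t).PosSemidef)
    {α : ℝ → ℝ → ℝ} (hα0 : ∀ R ≥ 0, ∀ t ∈ Icc 0 T', 0 ≤ α R t)
    (hαA : ∀ R ≥ 0, ∀ t ∈ Icc 0 T', ∀ e : EuclideanSpace ℝ
        (Fin n), ‖e‖ = 1 → ∀ w : EuclideanSpace ℝ (Fin n),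
      α R t * ⟪w, e⟫ ^ 2 ≤ ⟪(A (R • e) t).toEuclideanLin w, w⟫)
    {u v : (EuclideanSpace ℝ (Fin n)) × ℝ → ℝ}
    (hus : IsViscositySubsoln n Ω T (fun _ p X t => (A p t * X).trace) u)
    (hvs : IsViscositySubsoln n Ω T (fun _ p X t => (A (-p) t * X).trace) v)
    (hu : ContinuousOn u (closure Ω ×ˢ Icc 0 T')) (hv : ContinuousOn v (closure Ω ×ˢ Icc 0 T'))
    {ψ ψt ψs ψss : ℝ × ℝ → ℝ} {μ : ℝ} (hμ : 0 < μ)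
    (hψ : ContinuousOn ψ (Ici 0 ×ˢ Icc 0 T'))
    (hmono : ∀ t ∈ Icc 0 T', MonotoneOn (fun s => ψ (s, t)) (Ici 0))
    (hconc : ∀ t ∈ Icc 0 T', ConcaveOn ℝ (Ici 0) (fun s => ψ (s, t)))
    (hψs : ∀ s ∈ Ici (0 : ℝ), ∀ t ∈ Icc 0 T',
      HasDerivWithinAt (fun σ => ψ (σ, t)) (ψs (s, t)) (Ici 0) s)
    (hψsc : ContinuousOn ψs (Ici 0 ×ˢ Icc 0 T'))
    (hψss : ∀ s ∈ Ici (0 : ℝ), ∀ t ∈ Icc 0 T',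
      HasDerivWithinAt (fun σ => ψs (σ, t)) (ψss (s, t)) (Ici 0) s)
    (hψt : ∀ s ∈ Ici (0 : ℝ), ∀ t ∈ Ioo 0 T', HasDerivAt (fun τ => ψ (s, τ)) (ψt (s, t)) t)
    (hpde : ∀ s ∈ Ici (0 : ℝ), ∀ t ∈ Ioo 0 T',
      4 * (α |ψs (s, t)| t * ψss (s, t)) + μ ≤ ψt (s, t))
    (hstrict : ∀ x ∈ closure Ω, ∀ y ∈ closure Ω, ∀ t ∈ Icc 0 T',
      ψ (‖y - x‖, t) ≤ u (y, t) + v (x, t) → x ∈ Ω ∧ y ∈ Ω ∧ t ∈ Ioo 0 T' ∧ x ≠ y) :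
    ∀ x ∈ closure Ω, ∀ y ∈ closure Ω, ∀ t ∈ Icc 0 T', u (y, t) + v (x, t) < ψ (‖y - x‖, t) := by
  by_contra! hcon
  obtain ⟨x₀, hx₀, y₀, hy₀, t₀, ht₀, h₀⟩ := hcon
  obtain ⟨r, hr, C, hC, δ₀, hδ₀, a, ha, key⟩ :=
    exists_doubling_parameters hΩ hc hu hv hψ hmono hstrict hx₀ hy₀ ht₀ h₀
  obtain ⟨L, hL⟩ := ((isCompact_Icc (a := (0 : ℝ)) (b := C)).prod
    (isCompact_Icc (a := (0 : ℝ)) (b := T'))).exists_bound_of_continuousOn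
    (hψsc.mono (prod_mono_left Icc_subset_Ici_self))
  have hψs0 : ∀ s ∈ Ici (0 : ℝ), ∀ t ∈ Icc 0 T', 0 ≤ ψs (s, t) := fun s hs t ht => by
    rw [← (hψs s hs t ht).derivWithin (uniqueDiffOn_Ici 0 s hs)]
    exact (hmono t ht).derivWithin_nonneg
  have hψsL : ∀ s ∈ Icc 0 C, ∀ t ∈ Icc 0 T', ψs (s, t) ≤ L := fun s hs t ht =>
    (le_abs_self _).trans (hL (s, t) ⟨hs, ht⟩)
  set η := μ / (16 * (n ^ 2 + 1) * a) with hη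
  have hη0 : 0 < η := by positivity
  have hηa : (n : ℝ) ^ 2 * (η * (4 * a)) ≤ μ / 4 := by
    rw [hη]
    field_simp
    nlinarith [sq_nonneg (n : ℝ)]
  obtain ⟨ρ, hρ, hAρ⟩ := exists_uniform_modulus hAc (L + 1) T' hη0
  set b := max a (4 * C / ρ ^ 2 + 1) with hb
  have hab : a ≤ b := le_max_left _ _
  have hb0 : 0 < b := ha.trans_le hab
  have hbρ : 4 * C < b * ρ ^ 2 := by
    have h1 : 4 * C / ρ ^ 2 + 1 ≤ b := le_max_right _ _
    have h2 := mul_le_mul_of_nonneg_right h1 (sq_nonneg ρ)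
    rw [add_mul, div_mul_cancel₀ _ (by positivity)] at h2
    nlinarith
  have htime : ∀ x y : ℝ, b * x ^ 2 ≤ C → b * y ^ 2 ≤ C → |x - y| < ρ := by
    intro x y hx hy
    refine abs_lt_of_sq_lt_sq ?_ hρ.le
    nlinarith [sq_nonneg (x + y)]
  have hK : IsCompact (closure Ω ×ˢ Icc 0 T') := hc.prod isCompact_Icc
  obtain ⟨f, hf⟩ := exists_isSupConv hK ⟨(x₀, t₀), hx₀, ht₀⟩ a b hu
  obtain ⟨g, hg⟩ := exists_isSupConv hK ⟨(x₀, t₀), hx₀, ht₀⟩ a b hv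
  have hmin : ∀ w : (EuclideanSpace ℝ (Fin n)) × (EuclideanSpace ℝ
      (Fin n)) × ℝ, ∃ τ ∈ Icc 0 T', ∀ τ' ∈ Icc 0 T',
      -ψ (‖w.2.1 - w.1‖, τ') - b * (w.2.2 - τ') ^ 2 ≤
        -ψ (‖w.2.1 - w.1‖, τ) - b * (w.2.2 - τ) ^ 2 := by
    intro w
    have hcont : ContinuousOn (fun τ => -ψ (‖w.2.1 - w.1‖, τ) - b * (w.2.2 - τ) ^ 2)
        (Icc 0 T') := by
      have h1 : ContinuousOn (fun τ => ψ (‖w.2.1 - w.1‖, τ)) (Icc 0 T') :=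
        hψ.comp (by fun_prop) fun τ hτ => ⟨norm_nonneg _, hτ⟩
      exact h1.neg.sub (by fun_prop)
    obtain ⟨τ, hτ, hmax⟩ := isCompact_Icc.exists_isMaxOn ⟨t₀, ht₀⟩ hcont
    exact ⟨τ, hτ, fun τ' hτ' => hmax hτ'⟩
  choose τ hτ hτmax using hmin
  set h : (EuclideanSpace ℝ (Fin n)) × (EuclideanSpace ℝ (Fin n)) × ℝ → ℝ := fun w => -ψ
      (‖w.2.1 - w.1‖, τ w) - b * (w.2.2 - τ w) ^ 2 with hh
  have key' := key a le_rfl b hab f g h hf hg (fun w τ' hτ' => hτmax w τ' hτ')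
    fun w => ⟨τ w, hτ w, rfl⟩
  choose F hFK hF using hf.2
  choose G hGK hG using hg.2
  have hloc := fun q hq w hw => (key' q hq).2 w hw (F w.2) (hFK _) (G (w.1, w.2.2)) (hGK _)
    (τ w) (hτ w) (hF _) (hG _) rfl
  set δ := min δ₀ (min ρ (min 1 (μ / 4))) with hδ
  have hδ0 : 0 < δ := by positivity
  have hδδ₀ : δ ≤ δ₀ := min_le_left _ _
  have hδρ : δ ≤ ρ := (min_le_right _ _).trans (min_le_left _ _)
  have hδ1 : δ ≤ 1 := (min_le_right _ _).trans ((min_le_right _ _).trans (min_le_left _ _))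
  have hδμ : δ ≤ μ / 4 := (min_le_right _ _).trans ((min_le_right _ _).trans (min_le_right _ _))
  have hae₁ := ae_comp_of_surjective (Measure.addHaar : Measure ((EuclideanSpace ℝ (Fin n)) ×
      (EuclideanSpace ℝ (Fin n)) × ℝ))
    (Measure.addHaar : Measure ((EuclideanSpace ℝ (Fin n)) × ℝ)) (L := ContinuousLinearMap.snd ℝ
        (EuclideanSpace ℝ (Fin n)) ((EuclideanSpace ℝ (Fin n)) × ℝ))
    Prod.snd_surjective (hus.ae_jet_supConv hΩ hT ha.le hb0.le hf Measure.addHaar)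
  have hae₂ := ae_comp_of_surjective (Measure.addHaar : Measure ((EuclideanSpace ℝ (Fin n)) ×
      (EuclideanSpace ℝ (Fin n)) × ℝ))
    (Measure.addHaar : Measure ((EuclideanSpace ℝ (Fin n)) × ℝ))
    (L := (ContinuousLinearMap.fst ℝ (EuclideanSpace ℝ (Fin n)) ((EuclideanSpace ℝ
        (Fin n)) × ℝ)).prod
      ((ContinuousLinearMap.snd ℝ (EuclideanSpace ℝ (Fin n)) ℝ).comp (ContinuousLinearMap.snd ℝ
          (EuclideanSpace ℝ (Fin n)) ((EuclideanSpace ℝ (Fin n)) × ℝ))))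
    (fun z => ⟨(z.1, 0, z.2), rfl⟩)
    (IsViscositySubsoln.ae_jet_supConv (A := fun p t => A (-p) t) hΩ hT hvs ha.le hb0.le hg
      Measure.addHaar)
  have hae := hae₁.and hae₂
  obtain ⟨w, hwN, q, hq, hw⟩ := exists_perturbed_max_notMem_null
    (Measure.addHaar : Measure ((EuclideanSpace ℝ (Fin n)) × (EuclideanSpace ℝ (Fin n)) × ℝ))
    (w := fun z => f z.2 + g (z.1, z.2.2) + h z) (c := 2 * (a + b) + (2 * (L / r) + b)) hδ0
    (by
      have hL0 : 0 ≤ L := (hψs0 0 self_mem_Ici t₀ ht₀).trans (hψsL 0 ⟨le_rfl, hC.le⟩ t₀ ht₀)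
      positivity)
    (fun q hq => (key' q (hq.trans_le hδδ₀)).1)
    (fun q hq w hw => by
      obtain ⟨-, -, -, -, -, hrw, hwC, -⟩ := hloc q (hq.trans_le hδδ₀) w hw
      exact hf.exists_lower_support_doubled ha.le hb0.le hg
        (exists_lower_support_modulus (hconc _ (hτ w)) hr hb0.le hrw
          (hψs0 _ (norm_nonneg _) _ (hτ w)) (hψsL _ ⟨norm_nonneg _, hwC⟩ _ (hτ w))
          (hψs _ (norm_nonneg _) _ (hτ w)) (fun z => hτmax z _ (hτ w)) rfl))
    (ae_iff.1 hae)
  simp only [mem_ofPred_eq, not_not] at hwN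
  obtain ⟨hF1, hG1, hF2, hG2, hτ0, hrw, hwC, hbF, hbG, hbτ⟩ := hloc q (hq.trans_le hδδ₀) w hw
  obtain ⟨p, γ, X, hjet, hX, hXa, hγ⟩ := hwN.1 _ hF1 hF2 (hF _)
  obtain ⟨p', γ', X', hjet', hX', hXa', hγ'⟩ := hwN.2 _ hG1 hG2 (hG _)
  obtain ⟨x, y, t⟩ := w
  replace hjet : HasParabolicJet f (y, t) p γ X := hjet
  replace hjet' : HasParabolicJet g (x, t) p' γ' X' := hjet'
  set σ := τ (x, y, t) with hσ
  have hs0 : 0 < ‖y - x‖ := hr.trans_le hrw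
  have hxy : y ≠ x := fun h => by simp [h] at hs0
  have hderiv : ∀ s > 0, HasDerivAt (fun s => ψ (s, σ)) (ψs (s, σ)) s := fun s hs =>
    (hψs s (le_of_lt hs) σ (hτ _)).hasDerivAt (Ici_mem_nhds hs)
  obtain ⟨hp, hp', ht, hadd, he⟩ := HasParabolicJet.contact_relations (ψ := ψ)
    (ψs := fun s => ψs (s, σ)) hjet hjet' hxy hτ0 (b := b) (q := q)
    (fun k h' t' t₃ ht₃ => by
      have h1 := hw ((x, y, t) + (k, h', t'))
      have h2 := hτmax ((x, y, t) + (k, h', t')) t₃ ht₃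
      rw [add_sub_cancel_left] at h1
      simp only [hh, Prod.mk_add_mk, ← hσ] at h1 h2 ⊢
      linarith)
    ((eventually_gt_nhds hs0).mono hderiv)
    ((hψss _ hs0.le σ (hτ _)).hasDerivAt (Ici_mem_nhds hs0)) (hψt _ hs0.le σ hτ0)
  set R := ψs (‖y - x‖, σ) with hR
  set e := ‖y - x‖⁻¹ • (y - x) with he'
  have he1 : ‖e‖ = 1 := by
    rw [he', norm_smul, norm_inv, norm_norm, inv_mul_cancel₀ hs0.ne']
  have hR0 : 0 ≤ R := hψs0 _ hs0.le σ (hτ _)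
  have hRL : ‖R • e‖ ≤ L := by
    rw [norm_smul, he1, mul_one, Real.norm_of_nonneg hR0]
    exact hψsL _ ⟨hs0.le, hwC⟩ σ (hτ _)
  replace hp : ‖p - R • e‖ ≤ ‖q‖ := hp
  have hp'' : ‖-p' - R • e‖ ≤ ‖q‖ := by
    rw [← norm_neg, neg_sub, sub_neg_eq_add, add_comm]
    exact hp'
  have hbd : ∀ p : EuclideanSpace ℝ (Fin n), ‖p - R • e‖ ≤ ‖q‖ → ‖p‖ ≤ L + 1 := fun p hp => by
    have h1 := norm_add_le (p - R • e) (R • e)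
    rw [sub_add_cancel] at h1
    linarith
  have h₁ := hAρ p (R • e) (hbd p hp) (by linarith) (by linarith) _ (Ioo_subset_Icc_self hF2) σ
    (hτ _) (by
      have := htime _ _ hbτ hbF
      rwa [sub_sub_sub_cancel_left] at this)
  have h₂ := hAρ (-p') (R • e) (hbd _ hp'') (by linarith) (by linarith) _
    (Ioo_subset_Icc_self hG2) σ (hτ _) (by
      have := htime _ _ hbτ hbG
      rwa [sub_sub_sub_cancel_left] at this)
  have h3 := Matrix.trace_mul_add_trace_mul_le (hApsd (R • e) σ) (hα0 R hR0 σ (hτ _))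
    (hαA R hR0 σ (hτ _) e he1) hη0.le hX hX' hXa hXa' hadd he h₁ h₂
  have h4 := hpde _ hs0.le σ hτ0
  rw [← hR, abs_of_nonneg hR0] at h4
  linarith

lemma IsViscositySupersoln.neg {n : ℕ} {Ω : Set (EuclideanSpace ℝ (Fin n))} {T : ℝ}
    {A : (EuclideanSpace ℝ (Fin n)) → ℝ → Matrix (Fin n) (Fin n) ℝ} {u : (EuclideanSpace ℝ
        (Fin n)) × ℝ → ℝ}
    (hu : IsViscositySupersoln n Ω T (fun _ p X t => (A p t * X).trace) u) :
    IsViscositySubsoln n Ω T (fun _ p X t => (A (-p) t * X).trace) (-u) := by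
  intro φ φt Dφ D2φ ⟨ht, hx, hxx, htc, hxc, hxxc⟩ x₀ t₀ hx₀ ht₀ hmax
  have h := hu (-φ) (-φt) (-Dφ) (-D2φ) ⟨fun w hw => (ht w hw).neg, fun w hw => ?_,
    fun w hw => ?_, htc.neg, hxc.neg, hxxc.neg⟩ x₀ t₀ hx₀ ht₀ ?_
  · simp only [Pi.neg_apply, Matrix.mul_neg, Matrix.trace_neg] at h
    linarith
  · have h1 := (hx w hw).hasFDerivAt.neg
    rw [hasGradientAt_iff_hasFDerivAt, Pi.neg_apply, map_neg]
    exact h1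
  · have h1 := (hxx w hw).neg
    rw [Pi.neg_apply, map_neg, map_neg]
    exact h1
  · have h1 := hmax.neg
    refine h1.congr (Eventually.of_forall fun w => ?_)
    simp only [Pi.neg_apply]
    ring

lemma HasDerivWithinAt.comp_half {c : ℝ → ℝ} {g s : ℝ}
    (h : HasDerivWithinAt c g (Ici 0) (s / 2)) :
    HasDerivWithinAt (fun σ => c (σ / 2)) (g / 2) (Ici 0) s := by
  have h1 := h.comp s ((hasDerivWithinAt_id s (Ici 0)).div_const 2)
    fun σ hσ => div_nonneg hσ zero_le_two
  exact h1.congr_deriv (by ring)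

lemma ConcaveOn.two_mul_comp_half {c : ℝ → ℝ} (h : ConcaveOn ℝ (Ici 0) c) :
    ConcaveOn ℝ (Ici 0) fun s => 2 * c (s / 2) := by
  refine ⟨convex_Ici 0, fun x hx y hy a b ha hb hab => ?_⟩
  have h1 := h.2 (div_nonneg hx zero_le_two : (0 : ℝ) ≤ x / 2)
    (div_nonneg hy zero_le_two : (0 : ℝ) ≤ y / 2) ha hb hab
  simp only [smul_eq_mul] at h1 ⊢
  rw [show (a * x + b * y) / 2 = a * (x / 2) + b * (y / 2) by ring]
  linarith

lemma MonotoneOn.two_mul_comp_half {c : ℝ → ℝ} (h : MonotoneOn c (Ici 0)) :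
    MonotoneOn (fun s => 2 * c (s / 2)) (Ici 0) := fun x hx y hy hxy => by
  have h1 := h (div_nonneg hx zero_le_two : (0 : ℝ) ≤ x / 2)
    (div_nonneg hy zero_le_two : (0 : ℝ) ≤ y / 2) (by linarith)
  simp only
  linarith

lemma continuousOn_of_hasDerivWithinAt_time {φ φt : ℝ × ℝ → ℝ} {T T' : ℝ} (hT : T' < T)
    (hφ : ∀ t ∈ Icc 0 T', ContinuousOn (fun s => φ (s, t)) (Ici 0))
    (hφt : ∀ s ∈ Ici (0 : ℝ), ∀ t ∈ Ico (0 : ℝ) T,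
      HasDerivWithinAt (fun τ => φ (s, τ)) (φt (s, t)) (Ico 0 T) t)
    (hφtc : ContinuousOn φt (Ici (0 : ℝ) ×ˢ Ico (0 : ℝ) T)) :
    ContinuousOn φ (Ici 0 ×ˢ Icc 0 T') := by
  have hsub : Icc 0 T' ⊆ Ico 0 T := Icc_subset_Ico_right hT
  have hbdd : ∀ S, ContinuousOn φ (Icc 0 S ×ˢ Icc 0 T') := by
    intro S
    obtain ⟨K, hK⟩ := ((isCompact_Icc (a := (0 : ℝ)) (b := S)).prod
      (isCompact_Icc (a := (0 : ℝ)) (b := T'))).exists_bound_of_continuousOn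
      (hφtc.mono (prod_mono Icc_subset_Ici_self hsub))
    refine continuousOn_prod_of_continuousOn_lipschitzOnWith' φ K.toNNReal (fun s hs => ?_)
      fun t ht => (hφ t ht).mono Icc_subset_Ici_self
    refine (convex_Icc 0 T').lipschitzOnWith_of_nnnorm_hasDerivWithin_le
      (fun t ht => (hφt s hs.1 t (hsub ht)).mono hsub) fun t ht => ?_
    rw [← NNReal.coe_le_coe, coe_nnnorm]
    exact (hK (s, t) ⟨hs, ht⟩).trans (Real.le_coe_toNNReal K)
  rintro ⟨s, t⟩ ⟨hs, ht⟩
  have hs' : (0 : ℝ) ≤ s := hs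
  refine (hbdd (s + 1) (s, t) ⟨⟨hs', by linarith⟩, ht⟩).mono_of_mem_nhdsWithin ?_
  rw [nhdsWithin_prod_eq]
  refine prod_mem_prod ?_ self_mem_nhdsWithin
  filter_upwards [self_mem_nhdsWithin, mem_nhdsWithin_of_mem_nhds (Iic_mem_nhds (lt_add_one s))]
    with z hz hz'
  exact ⟨hz, hz'⟩

/-- Let `Ω ⊂ ℝⁿ` be a smooth bounded open convex domain and `T > 0`.
Let `u`, continuous on `Ω̄ × [0,T)`, be a viscosity solution of
`∂ₜu = tr(A(Du,t)D²u)` in `Ω × (0,T)` vanishing on `∂Ω × (0,T)`, where `A` is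
positive semidefinite and `0 < α(R,t) ≤ R² inf{vᵀA(p,t)v/(v·p)² : |p|=R, v·p ≠ 0}`.
Let `φ₀` be a modulus of continuity of `u(·,0)` and suppose `φ` is `C^{2,1}`,
nondecreasing and concave in the first variable, satisfies
`∂ₜφ ≥ α(|∂ₛφ|,t) ∂ₛ²φ` and `φ(·,t) ≥ φ₀`.  Then `φ(·,t)` is a modulus of continuity
of `u(·,t)` for all `t ∈ [0,T)`. -/
theorem dirichlet_modulus_of_continuity (n : ℕ)
    (Ω : Set (EuclideanSpace ℝ (Fin n))) (hΩo : IsOpen Ω) (hΩne : Ω.Nonempty)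
    (hΩb : Bornology.IsBounded Ω) (hΩconv : Convex ℝ Ω)
    (T : ℝ) (hT : 0 < T)
    (A : EuclideanSpace ℝ (Fin n) → ℝ → Matrix (Fin n) (Fin n) ℝ)
    (hAc : Continuous fun q : EuclideanSpace ℝ (Fin n) × ℝ => A q.1 q.2)
    (hApsd : ∀ p t, (A p t).PosSemidef)
    (α : ℝ → ℝ → ℝ) (hαc : Continuous fun q : ℝ × ℝ => α q.1 q.2)
    (hαpos : ∀ R > (0 : ℝ), ∀ t ∈ Icc (0 : ℝ) T, 0 < α R t)
    (hαle : ∀ R > (0 : ℝ), ∀ t ∈ Icc (0 : ℝ) T, ∀ p v : EuclideanSpace ℝ (Fin n),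
      ‖p‖ = R → ⟪v, p⟫ ≠ 0 →
      α R t ≤ R ^ 2 * ((∑ i, ∑ j, v i * A p t i j * v j) / ⟪v, p⟫ ^ 2))
    (u : EuclideanSpace ℝ (Fin n) × ℝ → ℝ)
    (hu : ContinuousOn u (closure Ω ×ˢ Ico 0 T))
    (hsub : IsViscositySubsoln n Ω T (fun _ p X t => (A p t * X).trace) u)
    (hsup : IsViscositySupersoln n Ω T (fun _ p X t => (A p t * X).trace) u)
    (hbdry : ∀ x ∈ frontier Ω, ∀ t ∈ Ioo (0 : ℝ) T, u (x, t) = 0)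
    (φ₀ : ℝ → ℝ)
    (hφ₀ : ∀ x ∈ closure Ω, ∀ y ∈ closure Ω, u (y, 0) - u (x, 0) ≤ 2 * φ₀ (‖y - x‖ / 2))
    (φ φt φs φss : ℝ × ℝ → ℝ)
    (hφt : ∀ s ∈ Ici (0 : ℝ), ∀ t ∈ Ico (0 : ℝ) T,
      HasDerivWithinAt (fun τ => φ (s, τ)) (φt (s, t)) (Ico 0 T) t)
    (hφs : ∀ s ∈ Ici (0 : ℝ), ∀ t ∈ Ico (0 : ℝ) T,
      HasDerivWithinAt (fun σ => φ (σ, t)) (φs (s, t)) (Ici 0) s)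
    (hφss : ∀ s ∈ Ici (0 : ℝ), ∀ t ∈ Ico (0 : ℝ) T,
      HasDerivWithinAt (fun σ => φs (σ, t)) (φss (s, t)) (Ici 0) s)
    (hφtc : ContinuousOn φt (Ici (0 : ℝ) ×ˢ Ico (0 : ℝ) T))
    (hφsc : ContinuousOn φs (Ici (0 : ℝ) ×ˢ Ico (0 : ℝ) T))
    (hφssc : ContinuousOn φss (Ici (0 : ℝ) ×ˢ Ico (0 : ℝ) T))
    (hmono : ∀ t ∈ Ico (0 : ℝ) T, MonotoneOn (fun s => φ (s, t)) (Ici 0))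
    (hconc : ∀ t ∈ Ico (0 : ℝ) T, ConcaveOn ℝ (Ici 0) (fun s => φ (s, t)))
    (hpde : ∀ s ∈ Ici (0 : ℝ), ∀ t ∈ Ico (0 : ℝ) T,
      α |φs (s, t)| t * φss (s, t) ≤ φt (s, t))
    (hinit : ∀ z ∈ Ici (0 : ℝ), ∀ t ∈ Ico (0 : ℝ) T, φ₀ z ≤ φ (z, t)) :
    ∀ t ∈ Ico (0 : ℝ) T, ∀ x ∈ closure Ω, ∀ y ∈ closure Ω,
      u (y, t) - u (x, t) ≤ 2 * φ (‖y - x‖ / 2, t) := by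
  have hsubI : ∀ {T' : ℝ}, T' < T → Icc 0 T' ⊆ Ico 0 T := fun h => Icc_subset_Ico_right h
  have hhalf : ∀ s ∈ Ici (0 : ℝ), s / 2 ∈ Ici (0 : ℝ) := fun s hs =>
    (div_nonneg hs zero_le_two : (0 : ℝ) ≤ s / 2)
  have hφ0 : ∀ s ∈ Ici (0 : ℝ), ∀ t ∈ Ico (0 : ℝ) T, 0 ≤ φ (s, t) := fun s hs t ht => by
    obtain ⟨x, hx⟩ := hΩne
    have h1 := hφ₀ x (subset_closure hx) x (subset_closure hx)
    rw [sub_self, sub_self, norm_zero, zero_div] at h1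
    have h2 := hinit 0 self_mem_Ici t ht
    have h3 := hmono t ht self_mem_Ici hs hs
    simp only at h3
    linarith
  have h0 : ∀ t ∈ Ico 0 T, ∀ x ∈ closure Ω, ∀ y ∈ closure Ω,
      u (y, 0) - u (x, 0) ≤ 2 * φ (‖y - x‖ / 2, t) := fun t ht x hx y hy => by
    have h1 := hinit _ (hhalf _ (norm_nonneg (y - x))) t ht
    linarith [hφ₀ x hx y hy]
  have hdiff : ∀ t ∈ Ico 0 T, ∀ s ∈ Ici (0 : ℝ),
      HasDerivWithinAt (fun σ => 2 * φ (σ / 2, t)) (φs (s / 2, t)) (Ici 0) s :=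
    fun t ht s hs => ((hφs _ (hhalf s hs) t ht).comp_half.const_mul 2).congr_deriv (by ring)
  have hvs := hsup.neg
  have hright : ∀ x ∈ frontier Ω, ∀ y ∈ closure Ω, ∀ t ∈ Ico 0 T,
      u (y, t) ≤ 2 * φ (‖y - x‖ / 2, t) := fun x hx y hy t ht =>
    hsub.le_modulus_of_mem_frontier hΩo hΩb hΩconv hT hu hbdry (hconc t ht).two_mul_comp_half
      (hmono t ht).two_mul_comp_half (fun s hs => ⟨_, hdiff t ht s hs⟩)
      (fun y hy x hx => h0 t ht x hx y hy) x hx y hy t ht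
  have hleft : ∀ y ∈ frontier Ω, ∀ x ∈ closure Ω, ∀ t ∈ Ico 0 T,
      -u (x, t) ≤ 2 * φ (‖y - x‖ / 2, t) := fun y hy x hx t ht => by
    rw [norm_sub_rev]
    refine IsViscositySubsoln.le_modulus_of_mem_frontier (A := fun p t => A (-p) t) hΩo hΩb hΩconv
      hT hvs hu.neg (fun x hx t ht => by rw [Pi.neg_apply, hbdry x hx t ht, neg_zero])
      (hconc t ht).two_mul_comp_half (hmono t ht).two_mul_comp_half
      (fun s hs => ⟨_, hdiff t ht s hs⟩) (fun x hx y hy => ?_) y hy x hx t ht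
    have h1 := h0 t ht x hx y hy
    rw [norm_sub_rev] at h1
    simp only [Pi.neg_apply]
    linarith
  by_contra! hcon
  obtain ⟨t₀, ht₀, x₀, hx₀, y₀, hy₀, hlt⟩ := hcon
  obtain ⟨T', hT₀, hT'⟩ := exists_between ht₀.2
  have hT'0 : 0 ≤ T' := ht₀.1.trans hT₀.le
  have hI := hsubI hT'
  have hT'I : T' ∈ Icc 0 T' := ⟨hT'0, le_rfl⟩
  have hc : IsCompact (closure Ω) := hΩb.isCompact_closure
  have huI : ContinuousOn u (closure Ω ×ˢ Icc 0 T') := hu.mono (prod_mono_right hI)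
  obtain ⟨B, hB⟩ := (hc.prod isCompact_Icc).exists_bound_of_continuousOn huI
  obtain ⟨m, m', μ, hμ, hm, -, hm', hmpos, hm₀, hmT⟩ :=
    exists_exp_penalty (sub_pos.2 hlt) hT₀ (2 * B)
  have hφc : ContinuousOn φ (Ici 0 ×ˢ Icc 0 T') := continuousOn_of_hasDerivWithinAt_time hT'
    (fun t ht s hs => (hφs s hs t (hI ht)).continuousWithinAt) hφt hφtc
  have hscale : MapsTo (fun q : ℝ × ℝ => (q.1 / 2, q.2)) (Ici 0 ×ˢ Icc 0 T') (Ici 0 ×ˢ Icc 0 T') :=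
    fun q hq => ⟨hhalf _ hq.1, hq.2⟩
  have hcore := IsViscositySubsoln.add_lt_modulus (α := α) hΩo hc hT' hAc hApsd
    (fun R hR t ht => nonneg_of_pos_of_continuous (α := fun R => α R t)
      (hαc.comp (by fun_prop : Continuous fun R : ℝ => (R, t)))
      (fun R hR => hαpos R hR t (Ico_subset_Icc_self (hI ht))) hR)
    (fun R hR t ht e he w => mul_inner_sq_le_of_ellipticity hAc hApsd hαc hαle hR
      (Ico_subset_Icc_self (hI ht)) he w)
    hsub hvs huI huI.neg (ψ := fun q => 2 * φ (q.1 / 2, q.2) + m q.2)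
    (ψt := fun q => 2 * φt (q.1 / 2, q.2) + m' q.2) (ψs := fun q => φs (q.1 / 2, q.2))
    (ψss := fun q => φss (q.1 / 2, q.2) / 2) hμ
    (((hφc.comp (by fun_prop) hscale).const_mul 2).add
      ((continuous_iff_continuousAt.2 fun t => (hm t).continuousAt).comp
        continuous_snd).continuousOn)
    (fun t ht => (hmono t (hI ht)).two_mul_comp_half.add_const (m t))
    (fun t ht => (hconc t (hI ht)).two_mul_comp_half.add_const (m t))
    (fun s hs t ht => (hdiff t (hI ht) s hs).add_const (m t))
    ((hφsc.mono (prod_mono_right hI)).comp (by fun_prop) hscale)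
    (fun s hs t ht => (hφss _ (hhalf s hs) t (hI ht)).comp_half)
    (fun s hs t ht => (((hφt _ (hhalf s hs) t (hI (Ioo_subset_Icc_self ht))).hasDerivAt
      (Ico_mem_nhds ht.1 (ht.2.trans hT'))).const_mul 2).add (hm t))
    (fun s hs t ht => by
      have h1 := hpde _ (hhalf s hs) t (hI (Ioo_subset_Icc_self ht))
      have h2 := hm' t ht.1.le
      simp only
      linarith)
    (fun x hx y hy t ht hle => by
      simp only [Pi.neg_apply] at hle
      have hmt := hmpos t
      have hφn := hφ0 _ (hhalf _ (norm_nonneg (y - x))) t (hI ht)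
      have htI : t ∈ Ioo 0 T' := by
        refine ⟨ht.1.lt_of_ne ?_, ht.2.lt_of_ne ?_⟩
        · rintro rfl
          linarith [h0 0 ⟨le_rfl, hT⟩ x hx y hy]
        · rintro rfl
          have h1 := abs_le.1 (hB (x, t) ⟨hx, ht⟩)
          have h2 := abs_le.1 (hB (y, t) ⟨hy, ht⟩)
          linarith
      have htT : t ∈ Ioo 0 T := ⟨htI.1, htI.2.trans hT'⟩
      refine ⟨?_, ?_, htI, ?_⟩
      · by_contra hxΩ
        have hxf : x ∈ frontier Ω := ⟨hx, by rwa [hΩo.interior_eq]⟩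
        linarith [hright x hxf y hy t (hI ht), hbdry x hxf t htT]
      · by_contra hyΩ
        have hyf : y ∈ frontier Ω := ⟨hy, by rwa [hΩo.interior_eq]⟩
        linarith [hleft y hyf x hx t (hI ht), hbdry y hyf t htT]
      · rintro rfl
        linarith)
    x₀ hx₀ y₀ hy₀ t₀ ⟨ht₀.1, hT₀.le⟩
  simp only [Pi.neg_apply] at hcore
  linarith
end

section
/- Let (M, d) be a nonempty compact connected metric space with diameter D, let T > 0, and let u : M × (0,T) → ℝ be continuous. For s ∈ [0, D/2] and t ∈ (0,T) define the modulus of continuity ω(s,t) := sup{ (u(y,t) − u(x,t))/2 : x, y ∈ M, d(x,y) = 2s }. Fix s₀ ∈ (0, D/2] and t₀ ∈ (0,T), and let ψ : [0, D/2] × (0,T) → ℝ be a continuous function such that ψ ≥ ω on U × (t₀ − ε₀, t₀ + ε₀) for some relative neighborhood U of s₀ in [0, D/2] and some ε₀ > 0, with ψ(s₀,t₀) = ω(s₀,t₀). Then there exist x₀, y₀ ∈ M with d(x₀, y₀) = 2s₀ and u(y₀,t₀) − u(x₀,t₀) = 2ω(s₀,t₀), and the function Z(x, y, t) := u(y,t)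 − u(x,t) − 2ψ(d(x,y)/2, t) attains a local maximum on M × M × (0,T) at the point (x₀, y₀, t₀). -/
open Set

/-- In a nonempty compact connected metric space, every distance between `0` and the diameter
is realised by a pair of points. -/
theorem exists_dist_eq_of_le_diam (M : Type*) [MetricSpace M] [CompactSpace M]
    [ConnectedSpace M] [Nonempty M] {r : ℝ} (hr : 0 ≤ r)
    (hrD : r ≤ Metric.diam (Set.univ : Set M)) : ∃ x y : M, dist x y = r := by
  obtain ⟨p, -, hp⟩ := isCompact_univ.exists_isMaxOn (univ_nonempty (α := M × M))
    (f := fun p : M × M => dist p.1 p.2) (by fun_prop)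
  have hdiam : Metric.diam (Set.univ : Set M) ≤ dist p.1 p.2 :=
    Metric.diam_le_of_forall_dist_le dist_nonneg fun x _ y _ => hp (mem_univ (x, y))
  obtain ⟨y, hy⟩ := mem_range_of_exists_le_of_exists_ge (f := fun y => dist p.1 y) (c := r)
    (by fun_prop) ⟨p.1, by simpa using hr⟩ ⟨p.2, hrD.trans hdiam⟩
  exact ⟨p.1, y, hy⟩

/-- The half-increments of a continuous function on a compact metric space over pairs of points
at a fixed distance are bounded above. -/
theorem bddAbove_half_increments {M : Type*} [MetricSpace M] [CompactSpace M] {f : M → ℝ}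
    (hf : Continuous f) (r : ℝ) :
    BddAbove {a : ℝ | ∃ x y : M, dist x y = r ∧ a = (f y - f x) / 2} := by
  refine (isCompact_range (f := fun p : M × M => (f p.2 - f p.1) / 2)
    (by fun_prop)).bddAbove.mono ?_
  rintro a ⟨x, y, -, rfl⟩
  exact ⟨(x, y), rfl⟩

/-- The supremum of the half-increments over pairs of points at a realised distance is
attained. -/
theorem exists_half_increment_eq_sSup {M : Type*} [MetricSpace M] [CompactSpace M] {f : M → ℝ}
    (hf : Continuous f) {r : ℝ} (hr : ∃ x y : M, dist x y = r) :
    ∃ x y : M, dist x y = r ∧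
      sSup {a : ℝ | ∃ x y : M, dist x y = r ∧ a = (f y - f x) / 2} = (f y - f x) / 2 := by
  have hK : IsCompact {p : M × M | dist p.1 p.2 = r} :=
    (isClosed_eq (by fun_prop) continuous_const).isCompact
  obtain ⟨a, b, hab⟩ := hr
  obtain ⟨p, hp, hmax⟩ := hK.exists_isMaxOn ⟨(a, b), hab⟩
    (f := fun p : M × M => (f p.2 - f p.1) / 2) (by fun_prop)
  refine ⟨p.1, p.2, hp, IsGreatest.csSup_eq ⟨⟨p.1, p.2, hp, rfl⟩, ?_⟩⟩
  rintro _ ⟨x, y, hxy, rfl⟩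
  exact hmax (show (x, y) ∈ {p : M × M | dist p.1 p.2 = r} from hxy)

/-- Let `(M,d)` be a nonempty compact connected metric space of
diameter `D`, `T > 0` and `u : M × (0,T) → ℝ` continuous.  Let
`ω(s,t) = sup { (u(y,t) − u(x,t))/2 : d(x,y) = 2s }` be the modulus of continuity.
Fix `s₀ ∈ (0, D/2]`, `t₀ ∈ (0,T)`, and a continuous `ψ` on `[0,D/2] × (0,T)` with
`ψ ≥ ω` on `U × (t₀−ε₀, t₀+ε₀)` for some relative neighborhood `U` of `s₀` in
`[0, D/2]` and some `ε₀ > 0`, and `ψ(s₀,t₀) = ω(s₀,t₀)`.  Then there are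
`x₀, y₀ ∈ M` with `d(x₀,y₀) = 2s₀`, `u(y₀,t₀) − u(x₀,t₀) = 2ω(s₀,t₀)`, and the
function `Z(x,y,t) = u(y,t) − u(x,t) − 2ψ(d(x,y)/2, t)` attains a local maximum on
`M × M × (0,T)` at `(x₀, y₀, t₀)`. -/
theorem modulus_touching_attained (M : Type*) [MetricSpace M] [CompactSpace M]
    [ConnectedSpace M] [Nonempty M]
    (D T : ℝ) (hD : D = Metric.diam (Set.univ : Set M)) (hT : 0 < T)
    (u : M × ℝ → ℝ) (hu : ContinuousOn u (Set.univ ×ˢ Set.Ioo 0 T))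
    (ω : ℝ → ℝ → ℝ)
    (hω : ω = fun s t =>
      sSup {r : ℝ | ∃ x y : M, dist x y = 2 * s ∧ r = (u (y, t) - u (x, t)) / 2})
    (s₀ t₀ : ℝ) (hs₀ : s₀ ∈ Set.Ioc 0 (D / 2)) (ht₀ : t₀ ∈ Set.Ioo 0 T)
    (ψ : ℝ × ℝ → ℝ) (hψ : ContinuousOn ψ (Set.Icc 0 (D / 2) ×ˢ Set.Ioo 0 T))
    (U : Set ℝ) (hU : U ∈ nhdsWithin s₀ (Set.Icc 0 (D / 2)))
    (ε₀ : ℝ) (hε₀ : 0 < ε₀) (hIoo : Set.Ioo (t₀ - ε₀) (t₀ + ε₀) ⊆ Set.Ioo 0 T)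
    (hge : ∀ s ∈ U, ∀ t ∈ Set.Ioo (t₀ - ε₀) (t₀ + ε₀), ω s t ≤ ψ (s, t))
    (heq : ψ (s₀, t₀) = ω s₀ t₀) :
    ∃ x₀ y₀ : M, dist x₀ y₀ = 2 * s₀ ∧ u (y₀, t₀) - u (x₀, t₀) = 2 * ω s₀ t₀ ∧
      IsLocalMaxOn
        (fun z : M × M × ℝ =>
          u (z.2.1, z.2.2) - u (z.1, z.2.2) - 2 * ψ (dist z.1 z.2.1 / 2, z.2.2))
        (Set.univ ×ˢ Set.univ ×ˢ Set.Ioo 0 T) (x₀, y₀, t₀) := by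
  subst hω
  have hcont : ∀ t ∈ Ioo 0 T, Continuous fun x => u (x, t) := fun t ht =>
    hu.comp_continuous (by fun_prop) fun x => ⟨mem_univ x, ht⟩
  obtain ⟨x₀, y₀, hdist, hsup⟩ := exists_half_increment_eq_sSup (hcont t₀ ht₀)
    (exists_dist_eq_of_le_diam M (r := 2 * s₀) (by linarith [hs₀.1]) (by linarith [hs₀.2]))
  refine ⟨x₀, y₀, hdist, by linarith, ?_⟩
  have hs : Filter.Tendsto (fun z : M × M × ℝ => dist z.1 z.2.1 / 2) (nhds (x₀, y₀, t₀))
      (nhdsWithin s₀ (Icc 0 (D / 2))) := by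
    refine tendsto_nhdsWithin_iff.2 ⟨?_, .of_forall fun z => ⟨by positivity, ?_⟩⟩
    · have h : Continuous fun z : M × M × ℝ => dist z.1 z.2.1 / 2 := by fun_prop
      convert h.tendsto (x₀, y₀, t₀) using 2
      simp [hdist]
    · have := Metric.dist_le_diam_of_mem (isCompact_univ (X := M)).isBounded
        (mem_univ z.1) (mem_univ z.2.1)
      rw [hD]
      linarith
  have ht : ∀ᶠ z : M × M × ℝ in nhds (x₀, y₀, t₀), z.2.2 ∈ Ioo (t₀ - ε₀) (t₀ + ε₀) :=
    (show Continuous fun z : M × M × ℝ => z.2.2 by fun_prop).continuousAt.eventually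
      (Ioo_mem_nhds (by simpa using hε₀) (by simpa using hε₀))
  refine Filter.Eventually.filter_mono nhdsWithin_le_nhds ?_
  filter_upwards [hs.eventually hU, ht] with z hzU hzt
  have hle := (le_csSup (bddAbove_half_increments (hcont _ (hIoo hzt)) (2 * (dist z.1 z.2.1 / 2)))
    ⟨z.1, z.2.1, by ring, rfl⟩).trans (hge _ hzU _ hzt)
  have hs₀' : dist x₀ y₀ / 2 = s₀ := by linarith
  simp only [hs₀', heq]
  linarith
end
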